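/- arXiv:1606.01361 — 8 statements merged into one kernel-verified Lean document; each statement's English description precedes it below -/
import Mathlib

section
/- Let M be a nonnegative Borel measure on ℝ such that M(X) ≥ |X| (the Lebesgue measure of X) for every Borel set X ⊆ ℝ and ∫_ℝ (1+λ²)^{-p} dM(λ) < ∞ for some p > 0. Define the Wiener–Hopf quadratic form q[f] = (2π)^{-1} ∫_ℝ |∫_0^∞ e^{iλx} f(x) dx|² dM(λ) on the domain C_c^∞((0,∞)) ⊆ L²((0,∞)); one has q[f] ≥ ‖f‖²_{L²((0,∞))} for all such f. Then q is closable in L²((0,∞)) if and only if M is absolutely continuous with respect to Lebesgue measure. -/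
open MeasureTheory Filter Set

/-- Test functions: smooth, compactly supported, with support in the open half-line `(0, ∞)`. -/
def IsTestHalf (f : ℝ → ℂ) : Prop :=
  ContDiff ℝ (⊤ : ℕ∞) f ∧ HasCompactSupport f ∧ tsupport f ⊆ Set.Ioi 0

/-- The squared `L²((0,∞))`-norm. -/
noncomputable def L2halfNormSq (f : ℝ → ℂ) : ℝ :=
  ∫ x in Set.Ioi (0 : ℝ), ‖f x‖ ^ 2

/-- The Wiener–Hopf quadratic form associated with the spectral measure `M`:
`q[f] = (2π)⁻¹ ∫ |∫_0^∞ e^{iλx} f(x) dx|² dM(λ)`. -/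
noncomputable def WHform (M : Measure ℝ) (f : ℝ → ℂ) : ℝ :=
  (2 * Real.pi)⁻¹ *
    ∫ lam : ℝ, ‖∫ x in Set.Ioi (0 : ℝ), Complex.exp (Complex.I * lam * x) * f x‖ ^ 2 ∂M

/-- A function holomorphic on a neighbourhood of the closed unit disc is uniformly approximable
by polynomials on the unit circle. -/
lemma exists_polynomial_near_of_differentiableOn {F : ℂ → ℂ} {R : ℝ} (hR : 1 < R)
    (hF : DifferentiableOn ℂ F (Metric.closedBall 0 R)) {ε : ℝ} (hε : 0 < ε) :
    ∃ P : Polynomial ℂ, ∀ z : ℂ, ‖z‖ = 1 → ‖P.eval z - F z‖ < ε := by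
  lift R to NNReal using by linarith
  have hR' : (1 : NNReal) < R := by exact_mod_cast hR
  have h := hF.hasFPowerSeriesOnBall (by positivity)
  obtain ⟨r, hr1, hr2⟩ := exists_between hR'
  have hu := Metric.tendstoUniformlyOn_iff.1
    (h.tendstoUniformlyOn' (ENNReal.coe_lt_coe.2 hr2)) ε hε
  obtain ⟨n, hn⟩ := hu.exists
  set p := cauchyPowerSeries F 0 R
  refine ⟨∑ k ∈ Finset.range n, Polynomial.monomial k (p.coeff k), fun z hz => ?_⟩
  have hz' : z ∈ Metric.ball (0 : ℂ) r := by simpa [hz] using hr1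
  have := hn z hz'
  rw [dist_comm, dist_eq_norm] at this
  have hsum : (∑ k ∈ Finset.range n, Polynomial.monomial k (p.coeff k)).eval z =
      p.partialSum n (z - 0) := by
    rw [Polynomial.eval_finsetSum]
    change _ = ∑ k ∈ Finset.range n, p k (fun _ => z - 0)
    refine Finset.sum_congr rfl fun k _ => ?_
    simp [mul_comm]
  rwa [hsum]

lemma Complex.re_inv_one_sub {w : ℂ} {s : ℝ} (hs : 0 < s) (hw : ‖w‖ ≤ 1 - s)
    {d : ℝ} (hd : ‖1 - w‖ ≤ d) : s / d ^ 2 ≤ ((1 - w)⁻¹).re := by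
  have h1 : s ≤ (1 - w).re := by
    have := Complex.re_le_norm w
    simp only [Complex.sub_re, Complex.one_re]
    linarith
  have h2 : 0 < ‖1 - w‖ := by
    refine norm_pos_iff.2 fun h => ?_
    simp [h] at h1
    linarith
  rw [Complex.inv_re, Complex.normSq_eq_norm_sq]
  have := hs.le.trans h1
  gcongr

/-- A compact null set of reals has finite covers by open intervals of small total length,
centred at points of the set. -/
lemma IsCompact.exists_finset_ball_cover {K : Set ℝ} (hK : IsCompact K) (h0 : volume K = 0)
    {δ : ℝ} (hδ : 0 < δ) :
    ∃ (T : Finset ℝ) (s : ℝ → ℝ), (∀ c ∈ T, c ∈ K ∧ 0 < s c) ∧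
      (∀ x ∈ K, ∃ c ∈ T, |x - c| < s c) ∧ ∑ c ∈ T, s c ≤ δ := by
  obtain ⟨t, r, -, htK, hr, hcov, hsum⟩ :=
    Besicovitch.exists_closedBall_covering_tsum_measure_le (volume : Measure ℝ)
      (ε := ENNReal.ofReal δ) (by simpa using hδ) (fun _ => Ioi 0) K
      (fun x _ η hη => ⟨η / 2, by simp [hη], by simp [hη], by linarith⟩)
  rw [h0, zero_add] at hsum
  have hr' : ∀ x ∈ t, 0 < r x := hr
  obtain ⟨b, hbt, hbfin, hbcov⟩ := hK.elim_finite_subcover_image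
    (b := t) (c := fun x => Metric.ball x (2 * r x)) (fun _ _ => Metric.isOpen_ball) (by
      refine hcov.trans (iUnion₂_mono fun x hx => ?_)
      exact Metric.closedBall_subset_ball (by linarith [hr' x hx]))
  refine ⟨hbfin.toFinset, fun x => 2 * r x, ?_, ?_, ?_⟩
  · intro c hc
    have : c ∈ t := hbt (by simpa using hc)
    exact ⟨htK this, by linarith [hr' c this]⟩
  · intro x hx
    obtain ⟨c, hc, hxc⟩ := mem_iUnion₂.1 (hbcov hx)
    exact ⟨c, by simpa using hc, hxc⟩
  · have hnn : ∀ c ∈ hbfin.toFinset, 0 ≤ 2 * r c := fun c hc => by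
      linarith [hr' c (hbt (by simpa using hc))]
    rw [← ENNReal.ofReal_le_ofReal_iff hδ.le, ENNReal.ofReal_sum_of_nonneg hnn]
    refine le_trans ?_ hsum
    rw [tsum_subtype t (fun x => volume (Metric.closedBall x (r x)))]
    refine le_trans (le_of_eq ?_) (ENNReal.sum_le_tsum hbfin.toFinset)
    refine Finset.sum_congr rfl fun c hc => ?_
    rw [indicator_of_mem (hbt (by simpa using hc)), Real.volume_closedBall]

/-- Polynomials peaking, on the unit circle, at the image of a compact null set under
`x ↦ exp (i x)`. -/
lemma exists_polynomial_peak {K : Set ℝ} (hK : IsCompact K) (h0 : volume K = 0)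
    {ε : ℝ} (hε : 0 < ε) (hε1 : ε ≤ 1) :
    ∃ P : Polynomial ℂ, (∀ z : ℂ, ‖z‖ = 1 → ‖P.eval z‖ ≤ 3) ∧
      (∀ x ∈ K, ‖P.eval (Complex.exp (Complex.I * x)) - 1‖ ≤ ε) ∧
      ∀ z : ℂ, ‖z‖ = 1 → (∀ x ∈ K, ε ≤ ‖z - Complex.exp (Complex.I * x)‖) →
        ‖P.eval z‖ ≤ ε := by
  set δ : ℝ := ε ^ 3 / 64 with hδ
  have hδ0 : 0 < δ := by positivity
  have hδε : δ ≤ ε / 64 := by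
    have : ε ^ 3 ≤ ε := pow_le_of_le_one hε.le hε1 (by norm_num)
    linarith
  set A : ℝ := 8 / ε with hA
  have hA0 : 0 < A := by positivity
  obtain ⟨T, s, hT, hcov, hsum⟩ := hK.exists_finset_ball_cover h0 hδ0
  have hsδ : ∀ c ∈ T, s c ≤ δ := fun c hc =>
    (Finset.single_le_sum (fun i hi => (hT i hi).2.le) hc).trans hsum
  set w : ℝ → ℂ → ℂ := fun c z => (1 - s c : ℝ) * Complex.exp (-(Complex.I * c)) * z with hw
  have hexp : ∀ c : ℝ, ‖Complex.exp (Complex.I * c)‖ = 1 := fun c =>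
    Complex.norm_exp_I_mul_ofReal c
  have hexp' : ∀ c : ℝ, ‖Complex.exp (-(Complex.I * c))‖ = 1 := fun c => by
    rw [Complex.exp_neg, norm_inv, hexp, inv_one]
  have hnw : ∀ c ∈ T, ∀ z, ‖w c z‖ = (1 - s c) * ‖z‖ := by
    intro c hc z
    have : 0 ≤ 1 - s c := by linarith [hsδ c hc]
    simp only [hw, norm_mul, hexp', Complex.norm_real, Real.norm_of_nonneg this, mul_one]
  set G : ℂ → ℂ := fun z => ∑ c ∈ T, ((A * s c : ℝ) : ℂ) * (1 - w c z)⁻¹ with hG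
  obtain ⟨R, hR1, hR⟩ : ∃ R : ℝ, 1 < R ∧ ∀ c ∈ T, (1 - s c) * R < 1 := by
    have h : ∀ᶠ R in nhds (1 : ℝ), ∀ c ∈ T, (1 - s c) * R < 1 := by
      refine (Finset.eventually_all T).2 fun c hc => ?_
      have : ContinuousAt (fun R : ℝ => (1 - s c) * R) 1 := by fun_prop
      exact this.eventually_lt continuousAt_const (by linarith [(hT c hc).2])
    have h2 := (h.filter_mono nhdsWithin_le_nhds).and
      (self_mem_nhdsWithin : Ioi (1 : ℝ) ∈ nhdsWithin 1 (Ioi 1))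
    obtain ⟨R, h3, h4⟩ := h2.exists
    exact ⟨R, h4, h3⟩
  have hdiff : DifferentiableOn ℂ (fun z => 1 - Complex.exp (-G z)) (Metric.closedBall 0 R) := by
    have hGd : DifferentiableOn ℂ G (Metric.closedBall 0 R) := by
      refine DifferentiableOn.fun_sum fun c hc => DifferentiableOn.const_mul ?_ _
      refine DifferentiableOn.inv (by fun_prop) fun z hz h => ?_
      have h1 : w c z = 1 := (sub_eq_zero.1 h).symm
      have h2 := hnw c hc z
      rw [h1, norm_one] at h2
      have h3 : ‖z‖ ≤ R := by simpa using hz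
      have : 0 ≤ 1 - s c := by linarith [hsδ c hc]
      nlinarith [hR c hc]
    exact (hGd.neg.cexp).const_sub 1
  obtain ⟨P, hP⟩ := exists_polynomial_near_of_differentiableOn hR1 hdiff (half_pos hε)
  have hre0 : ∀ z : ℂ, ‖z‖ = 1 → ∀ c ∈ T,
      0 ≤ (((A * s c : ℝ) : ℂ) * (1 - w c z)⁻¹).re := by
    intro z hz c hc
    rw [Complex.re_ofReal_mul]
    have h1 : ‖w c z‖ ≤ 1 - s c := by rw [hnw c hc, hz, mul_one]
    have := Complex.re_inv_one_sub (hT c hc).2 h1 le_rfl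
    have hs := (hT c hc).2
    exact mul_nonneg (by positivity) (le_trans (by positivity) this)
  have hnexp : ∀ z, ‖Complex.exp (-G z)‖ = Real.exp (-(G z).re) := fun z => by
    rw [Complex.norm_exp, Complex.neg_re]
  have hGre : ∀ z, (G z).re = ∑ c ∈ T, (((A * s c : ℝ) : ℂ) * (1 - w c z)⁻¹).re := fun z => by
    rw [hG, Complex.re_sum]
  refine ⟨P, fun z hz => ?_, fun x hx => ?_, fun z hz hzK => ?_⟩
  · have h1 : ‖Complex.exp (-G z)‖ ≤ 1 := by
      rw [hnexp, Real.exp_le_one_iff, hGre]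
      simpa using Finset.sum_nonneg (hre0 z hz)
    calc ‖P.eval z‖ = ‖(P.eval z - (1 - Complex.exp (-G z))) + 1 - Complex.exp (-G z)‖ := by
          congr 1; ring
      _ ≤ ‖P.eval z - (1 - Complex.exp (-G z))‖ + ‖(1 : ℂ)‖ + ‖Complex.exp (-G z)‖ :=
          (norm_sub_le _ _).trans (by gcongr; exact norm_add_le _ _)
      _ ≤ 3 := by rw [norm_one]; linarith [hP z hz]
  · set z := Complex.exp (Complex.I * x) with hz
    have hz1 : ‖z‖ = 1 := hexp x
    obtain ⟨c, hc, hxc⟩ := hcov x hx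
    have hs := (hT c hc).2
    have hs1 : s c ≤ 1 := by linarith [hsδ c hc]
    have hd : ‖1 - w c z‖ ≤ 2 * s c := by
      have e1 : 1 - w c z = (s c : ℂ) -
          ((1 - s c : ℝ) : ℂ) * (Complex.exp (Complex.I * ((x - c : ℝ) : ℂ)) - 1) := by
        have : Complex.exp (Complex.I * ((x - c : ℝ) : ℂ)) = Complex.exp (-(Complex.I * c)) * z := by
          rw [hz, ← Complex.exp_add]; congr 1; push_cast; ring
        rw [this, hw]; push_cast; ring
      have e2 : ‖Complex.exp (Complex.I * ((x - c : ℝ) : ℂ)) - 1‖ ≤ |x - c| :=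
        Real.norm_exp_I_mul_ofReal_sub_one_le
      rw [e1]
      refine (norm_sub_le _ _).trans ?_
      rw [norm_mul, Complex.norm_real, Complex.norm_real, Real.norm_of_nonneg hs.le,
        Real.norm_of_nonneg (by linarith)]
      nlinarith [norm_nonneg (Complex.exp (Complex.I * ((x - c : ℝ) : ℂ)) - 1)]
    have h1 : ‖w c z‖ ≤ 1 - s c := by rw [hnw c hc, hz1, mul_one]
    have h2 := Complex.re_inv_one_sub hs h1 hd
    have h3 : A / 4 ≤ (G z).re := by
      rw [hGre]
      refine le_trans ?_ (Finset.single_le_sum (hre0 z hz1) hc)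
      rw [Complex.re_ofReal_mul]
      calc A / 4 = A * s c * (s c / (2 * s c) ^ 2) := by field_simp; norm_num
        _ ≤ _ := by gcongr
    have h4 : ‖Complex.exp (-G z)‖ ≤ ε / 2 := by
      rw [hnexp, Real.exp_neg]
      have : 2 / ε ≤ Real.exp (G z).re := by
        have := Real.add_one_le_exp (G z).re
        have : A / 4 = 2 / ε := by rw [hA]; ring
        linarith
      calc (Real.exp (G z).re)⁻¹ ≤ (2 / ε)⁻¹ := by gcongr
        _ = ε / 2 := by rw [inv_div]
    calc ‖P.eval z - 1‖ = ‖(P.eval z - (1 - Complex.exp (-G z))) - Complex.exp (-G z)‖ := by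
          congr 1; ring
      _ ≤ ‖P.eval z - (1 - Complex.exp (-G z))‖ + ‖Complex.exp (-G z)‖ := norm_sub_le _ _
      _ ≤ ε := by linarith [hP z hz1]
  · have h1 : ∀ c ∈ T, ε / 2 ≤ ‖1 - w c z‖ := by
      intro c hc
      have e1 : 1 - w c z = Complex.exp (-(Complex.I * c)) *
          ((s c : ℂ) * z - (z - Complex.exp (Complex.I * c))) := by
        have : Complex.exp (-(Complex.I * c)) * Complex.exp (Complex.I * c) = 1 := by
          rw [← Complex.exp_add]; simp
        rw [mul_sub, mul_sub, this, hw]; push_cast; ring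
      rw [e1, norm_mul, hexp', one_mul, norm_sub_rev]
      have e2 := norm_sub_norm_le (z - Complex.exp (Complex.I * c)) ((s c : ℂ) * z)
      rw [norm_mul, hz, Complex.norm_real, Real.norm_of_nonneg (hT c hc).2.le] at e2
      linarith [hzK c (hT c hc).1, hsδ c hc]
    have h2 : ‖G z‖ ≤ ε / 4 := by
      calc ‖G z‖ ≤ ∑ c ∈ T, A * s c * (ε / 2)⁻¹ := by
            refine norm_sum_le_of_le _ fun c hc => ?_
            have hs := (hT c hc).2
            rw [norm_mul, norm_inv, Complex.norm_real, Real.norm_of_nonneg (by positivity)]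
            gcongr
            exact h1 c hc
        _ = A * (ε / 2)⁻¹ * ∑ c ∈ T, s c := by rw [Finset.mul_sum]; congr 1; ext; ring
        _ ≤ A * (ε / 2)⁻¹ * δ := by gcongr
        _ = ε / 4 := by rw [hA, hδ]; field_simp; norm_num
    have h3 : ‖Complex.exp (-G z) - 1‖ ≤ ε / 2 := by
      have := Complex.norm_exp_sub_one_le (x := -G z) (by rw [norm_neg]; linarith)
      rw [norm_neg] at this
      linarith
    calc ‖P.eval z‖ = ‖(P.eval z - (1 - Complex.exp (-G z))) - (Complex.exp (-G z) - 1)‖ := by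
          congr 1; ring
      _ ≤ ‖P.eval z - (1 - Complex.exp (-G z))‖ + ‖Complex.exp (-G z) - 1‖ := norm_sub_le _ _
      _ ≤ ε := by linarith [hP z hz]

/-- The Fourier transform `λ ↦ ∫_0^∞ e^{iλx} f(x) dx` of a function on the half-line. -/
noncomputable def halfFourier (f : ℝ → ℂ) (lam : ℝ) : ℂ :=
  ∫ x in Ioi (0 : ℝ), Complex.exp (Complex.I * lam * x) * f x

namespace IsTestHalf

variable {f g : ℝ → ℂ}

lemma continuous (hf : IsTestHalf f) : Continuous f := hf.1.continuous

lemma add (hf : IsTestHalf f) (hg : IsTestHalf g) : IsTestHalf (f + g) :=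
  ⟨hf.1.add hg.1, hf.2.1.add hg.2.1,
    (tsupport_add f g).trans (union_subset hf.2.2 hg.2.2)⟩

lemma const_smul (hf : IsTestHalf f) (a : ℂ) : IsTestHalf (fun x => a * f x) :=
  ⟨contDiff_const.mul hf.1, hf.2.1.mul_left,
    (tsupport_mul_subset_right (f := fun _ => a) (g := f)).trans hf.2.2⟩

lemma sub (hf : IsTestHalf f) (hg : IsTestHalf g) : IsTestHalf (f - g) := by
  convert hf.add (hg.const_smul (-1)) using 1
  ext x
  simp [sub_eq_add_neg]

lemma comp_sub (hf : IsTestHalf f) {a : ℝ} (ha : 0 ≤ a) : IsTestHalf (fun x => f (x - a)) := by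
  refine ⟨hf.1.comp (contDiff_id.sub contDiff_const),
    hf.2.1.comp_homeomorph (Homeomorph.subRight a), ?_⟩
  intro x hx
  have h := tsupport_comp_subset_preimage f (f := fun x : ℝ => x - a) (by fun_prop) hx
  have : 0 < x - a := hf.2.2 h
  exact mem_Ioi.2 (by linarith)

lemma setIntegral_eq (hf : IsTestHalf f) (c : ℝ → ℂ) :
    ∫ x in Ioi (0 : ℝ), c x * f x = ∫ x, c x * f x := by
  refine setIntegral_eq_integral_of_forall_compl_eq_zero fun x hx => ?_
  rw [image_eq_zero_of_notMem_tsupport fun h => hx (hf.2.2 h), mul_zero]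

lemma integrable_exp_mul (hf : IsTestHalf f) (lam : ℝ) :
    Integrable (fun x : ℝ => Complex.exp (Complex.I * lam * x) * f x) :=
  ((by fun_prop : Continuous fun x : ℝ => Complex.exp (Complex.I * lam * x)).mul
    hf.continuous).integrable_of_hasCompactSupport hf.2.1.mul_left

lemma halfFourier_eq (hf : IsTestHalf f) (lam : ℝ) :
    halfFourier f lam = ∫ x : ℝ, Complex.exp (Complex.I * lam * x) * f x :=
  hf.setIntegral_eq _

lemma halfFourier_add (hf : IsTestHalf f) (hg : IsTestHalf g) (lam : ℝ) :
    halfFourier (f + g) lam = halfFourier f lam + halfFourier g lam := by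
  rw [(hf.add hg).halfFourier_eq, hf.halfFourier_eq, hg.halfFourier_eq,
    ← integral_add (hf.integrable_exp_mul lam) (hg.integrable_exp_mul lam)]
  simp [mul_add]

lemma halfFourier_const_smul (a : ℂ) (lam : ℝ) :
    halfFourier (fun x => a * f x) lam = a * halfFourier f lam := by
  rw [halfFourier, halfFourier, ← integral_const_mul]
  congr 1 with x
  ring

lemma halfFourier_sub (hf : IsTestHalf f) (hg : IsTestHalf g) (lam : ℝ) :
    halfFourier (f - g) lam = halfFourier f lam - halfFourier g lam := by
  rw [(hf.sub hg).halfFourier_eq, hf.halfFourier_eq, hg.halfFourier_eq,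
    ← integral_sub (hf.integrable_exp_mul lam) (hg.integrable_exp_mul lam)]
  simp [mul_sub]

lemma halfFourier_comp_sub (hf : IsTestHalf f) {a : ℝ} (ha : 0 ≤ a) (lam : ℝ) :
    halfFourier (fun x => f (x - a)) lam =
      Complex.exp (Complex.I * lam * a) * halfFourier f lam := by
  rw [(hf.comp_sub ha).halfFourier_eq, hf.halfFourier_eq, ← integral_const_mul,
    ← integral_add_right_eq_self _ a]
  congr 1 with x
  rw [← mul_assoc, ← Complex.exp_add, add_sub_cancel_right]
  congr 2
  push_cast
  ring

/-- Multiplying a Fourier transform by a polynomial in `e^{iλ}` yields the Fourier transform of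
another test function. -/
lemma exists_halfFourier_eq_eval_mul (hf : IsTestHalf f) (P : Polynomial ℂ) :
    ∃ g, IsTestHalf g ∧ ∀ lam : ℝ,
      halfFourier g lam = P.eval (Complex.exp (Complex.I * lam)) * halfFourier f lam := by
  induction P using Polynomial.induction_on' with
  | add P Q hP hQ =>
    obtain ⟨g, hg, hgP⟩ := hP
    obtain ⟨h, hh, hhQ⟩ := hQ
    exact ⟨g + h, hg.add hh, fun lam => by
      rw [hg.halfFourier_add hh, hgP, hhQ, Polynomial.eval_add, add_mul]⟩
  | monomial n a =>
    refine ⟨fun x => a * f (x - n), (hf.comp_sub n.cast_nonneg).const_smul a, fun lam => ?_⟩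
    rw [halfFourier_const_smul (f := fun x => f (x - n)), hf.halfFourier_comp_sub n.cast_nonneg,
      Polynomial.eval_monomial, ← Complex.exp_nat_mul, ← mul_assoc]
    congr 3
    push_cast
    ring

/-- A test function, as a Schwartz function. -/
noncomputable def toSchwartz (hf : IsTestHalf f) : SchwartzMap ℝ ℂ :=
  hf.2.1.toSchwartzMap hf.1

lemma halfFourier_eq_fourier (hf : IsTestHalf f) (lam : ℝ) :
    halfFourier f lam = (FourierTransform.fourier hf.toSchwartz) (-(2 * Real.pi)⁻¹ * lam) := by
  rw [SchwartzMap.fourier_coe, Real.fourier_real_eq_integral_exp_smul, hf.halfFourier_eq]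
  congr 1 with x
  rw [smul_eq_mul]
  congr 2
  have : (Real.pi : ℂ) ≠ 0 := by exact_mod_cast Real.pi_ne_zero
  push_cast
  field_simp

lemma continuous_halfFourier (hf : IsTestHalf f) : Continuous (halfFourier f) := by
  rw [funext hf.halfFourier_eq_fourier]
  exact (SchwartzMap.continuous _).comp (by fun_prop)

/-- Plancherel's theorem for test functions. -/
lemma L2halfNormSq_eq (hf : IsTestHalf f) : L2halfNormSq f = WHform volume f := by
  have h1 : WHform volume f = (2 * Real.pi)⁻¹ * ∫ lam : ℝ, ‖halfFourier f lam‖ ^ 2 := rfl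
  have h2 : L2halfNormSq f = ∫ x, ‖f x‖ ^ 2 := by
    refine setIntegral_eq_integral_of_forall_compl_eq_zero fun x hx => ?_
    simp [image_eq_zero_of_notMem_tsupport fun h => hx (hf.2.2 h)]
  have h3 := SchwartzMap.integral_norm_sq_fourier hf.toSchwartz
  simp_rw [h1, hf.halfFourier_eq_fourier]
  rw [Measure.integral_comp_mul_left
    (fun x => ‖(FourierTransform.fourier hf.toSchwartz) x‖ ^ 2), h3, h2]
  have : |(-(2 * Real.pi)⁻¹)⁻¹| = 2 * Real.pi := by
    rw [inv_neg, inv_inv, abs_neg, abs_of_pos (by positivity)]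
  rw [this, smul_eq_mul, ← mul_assoc, inv_mul_cancel₀ (by positivity), one_mul]
  rfl

lemma exists_halfFourier_le (hf : IsTestHalf f) (p : ℝ) :
    ∃ C : ℝ, ∀ lam : ℝ, ‖halfFourier f lam‖ ^ 2 ≤ C * (1 + lam ^ 2) ^ (-p) := by
  obtain ⟨k, hk⟩ := exists_nat_ge p
  set φ := FourierTransform.fourier hf.toSchwartz
  set B := 2 ^ (k, 0).1 *
    ((Finset.Iic (k, 0)).sup (fun m => SchwartzMap.seminorm ℝ m.1 m.2)) φ
  have hb : ∀ x : ℝ, (1 + ‖x‖) ^ k * ‖φ x‖ ≤ B := fun x => by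
    simpa using SchwartzMap.one_add_le_sup_seminorm_apply (𝕜 := ℝ) (m := (k, 0)) le_rfl le_rfl φ x
  refine ⟨((2 * Real.pi) ^ k * B) ^ 2, fun lam => ?_⟩
  rw [Real.rpow_neg (by positivity), ← div_eq_mul_inv, le_div_iff₀ (by positivity)]
  have hpi : 1 ≤ 2 * Real.pi := by linarith [Real.pi_gt_three]
  have h1 : (1 + lam ^ 2) ^ p ≤ ((1 + |lam|) ^ k) ^ 2 := by
    calc (1 + lam ^ 2) ^ p ≤ (1 + lam ^ 2) ^ (k : ℝ) :=
          Real.rpow_le_rpow_of_exponent_le (by nlinarith [sq_nonneg lam]) hk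
      _ = (1 + lam ^ 2) ^ k := Real.rpow_natCast _ _
      _ ≤ ((1 + |lam|) ^ 2) ^ k := by
          gcongr
          nlinarith [sq_abs lam, abs_nonneg lam]
      _ = _ := by rw [← pow_mul, ← pow_mul, mul_comm]
  have h2 : 1 + |lam| ≤ 2 * Real.pi * (1 + ‖-(2 * Real.pi)⁻¹ * lam‖) := by
    rw [Real.norm_eq_abs, abs_mul, abs_neg,
      abs_of_pos (show (0 : ℝ) < (2 * Real.pi)⁻¹ by positivity), mul_add, ← mul_assoc,
      mul_inv_cancel₀ (by positivity)]
    linarith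
  have h3 : ‖halfFourier f lam‖ * (1 + |lam|) ^ k ≤ (2 * Real.pi) ^ k * B := by
    rw [hf.halfFourier_eq_fourier]
    calc _ ≤ ‖φ (-(2 * Real.pi)⁻¹ * lam)‖ *
            (2 * Real.pi * (1 + ‖-(2 * Real.pi)⁻¹ * lam‖)) ^ k := by gcongr
      _ = (2 * Real.pi) ^ k * ((1 + ‖-(2 * Real.pi)⁻¹ * lam‖) ^ k *
            ‖φ (-(2 * Real.pi)⁻¹ * lam)‖) := by rw [mul_pow]; ring
      _ ≤ _ := by gcongr; exact hb _
  calc _ ≤ ‖halfFourier f lam‖ ^ 2 * ((1 + |lam|) ^ k) ^ 2 := by gcongr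
    _ = (‖halfFourier f lam‖ * (1 + |lam|) ^ k) ^ 2 := by ring
    _ ≤ _ := by gcongr

lemma integrable_halfFourier_sq (hf : IsTestHalf f) {M : Measure ℝ} {p : ℝ}
    (hmom : ∫⁻ lam : ℝ, ENNReal.ofReal ((1 + lam ^ 2) ^ (-p)) ∂M < ⊤) :
    Integrable (fun lam => ‖halfFourier f lam‖ ^ 2) M := by
  obtain ⟨C, hC⟩ := hf.exists_halfFourier_le p
  have hw : Integrable (fun lam : ℝ => (1 + lam ^ 2) ^ (-p)) M := by
    refine ⟨(Measurable.pow_const (by fun_prop) _).aestronglyMeasurable, ?_⟩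
    rw [hasFiniteIntegral_iff_ofReal (.of_forall fun x => by positivity)]
    exact hmom
  refine (hw.const_mul C).mono' (by
    have := hf.continuous_halfFourier
    exact (this.norm.pow 2).aestronglyMeasurable) (.of_forall fun x => ?_)
  rw [Real.norm_of_nonneg (by positivity)]
  exact hC x

end IsTestHalf

/-- For every `R` there is a test function whose Fourier transform has no zeros on `[-R, R]`. -/
lemma exists_isTestHalf_halfFourier_ne_zero {R : ℝ} (hR : 0 < R) :
    ∃ f, IsTestHalf f ∧ ∀ lam : ℝ, |lam| ≤ R → halfFourier f lam ≠ 0 := by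
  set c : ℝ := (2 * R)⁻¹ with hc
  have hc0 : 0 < c := by positivity
  let b : ContDiffBump c := ⟨c / 4, c / 2, by positivity, by linarith⟩
  have hb0 : ∀ x, x ∉ Icc 0 (2 * c) → b x = 0 := fun x hx => by
    by_contra h
    have : x ∈ Function.support b := h
    rw [b.support_eq, Metric.mem_ball, Real.dist_eq, abs_lt] at this
    have h2 : b.rOut = c / 2 := rfl
    rw [h2] at this
    exact hx ⟨by linarith, by linarith⟩
  have htest : IsTestHalf (fun x => (b x : ℂ)) := by
    refine ⟨Complex.ofRealCLM.contDiff.comp b.contDiff,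
      b.hasCompactSupport.comp_left (g := fun x : ℝ => (x : ℂ)) rfl, ?_⟩
    refine (closure_mono (Function.support_comp_subset (g := fun x : ℝ => (x : ℂ)) rfl b)).trans ?_
    change tsupport b ⊆ _
    rw [b.tsupport_eq]
    intro x hx
    rw [Metric.mem_closedBall, Real.dist_eq, abs_le] at hx
    have h2 : b.rOut = c / 2 := rfl
    rw [h2] at hx
    exact mem_Ioi.2 (by linarith)
  refine ⟨_, htest, fun lam hlam h0 => ?_⟩
  have hint := htest.integrable_exp_mul lam
  rw [htest.halfFourier_eq] at h0
  have hre : ∫ x : ℝ, (Complex.exp (Complex.I * lam * x) * (b x : ℂ)).re = 0 := by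
    have := integral_re hint
    rw [h0] at this
    simpa using this
  have hle : ∫ x : ℝ, 2⁻¹ * b x ≤
      ∫ x : ℝ, (Complex.exp (Complex.I * lam * x) * (b x : ℂ)).re := by
    refine integral_mono (b.integrable.const_mul _) hint.re fun x => ?_
    have e : (Complex.exp (Complex.I * lam * x) * (b x : ℂ)).re = Real.cos (lam * x) * b x := by
      rw [Complex.re_mul_ofReal, mul_assoc, mul_comm Complex.I, ← Complex.ofReal_mul,
        Complex.exp_ofReal_mul_I_re]
    change 2⁻¹ * b x ≤ (Complex.exp (Complex.I * lam * x) * (b x : ℂ)).re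
    rw [e]
    by_cases hx : x ∈ Icc 0 (2 * c)
    · refine mul_le_mul_of_nonneg_right ?_ b.nonneg
      have h1 : |lam * x| ≤ 1 := by
        rw [abs_mul, abs_of_nonneg hx.1]
        calc |lam| * x ≤ R * (2 * c) := by
              gcongr
              · exact hx.1
              · exact hx.2
          _ = 1 := by rw [hc]; field_simp
      have h2 : (lam * x) ^ 2 ≤ 1 := (sq_le_one_iff_abs_le_one _).2 h1
      linarith [Real.one_sub_sq_div_two_le_cos (x := lam * x)]
    · simp [hb0 x hx]
  rw [hre, integral_const_mul] at hle
  linarith [b.integral_pos (μ := volume)]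

lemma WHform_eq (M : Measure ℝ) (f : ℝ → ℂ) :
    WHform M f = (2 * Real.pi)⁻¹ * ∫ lam : ℝ, ‖halfFourier f lam‖ ^ 2 ∂M := rfl

lemma WHform_nonneg (M : Measure ℝ) (f : ℝ → ℂ) : 0 ≤ WHform M f :=
  mul_nonneg (by positivity) (integral_nonneg fun _ => by positivity)

lemma ofReal_two_pi_mul_WHform {M : Measure ℝ} {p : ℝ}
    (hmom : ∫⁻ lam : ℝ, ENNReal.ofReal ((1 + lam ^ 2) ^ (-p)) ∂M < ⊤) {f : ℝ → ℂ}
    (hf : IsTestHalf f) :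
    ENNReal.ofReal (2 * Real.pi * WHform M f) =
      ∫⁻ lam : ℝ, ENNReal.ofReal (‖halfFourier f lam‖ ^ 2) ∂M := by
  rw [WHform_eq, ← mul_assoc, mul_inv_cancel₀ (by positivity), one_mul,
    ofReal_integral_eq_lintegral_ofReal (hf.integrable_halfFourier_sq hmom)
      (.of_forall fun _ => by positivity)]

/-- If the spectral measure is absolutely continuous, the form is closable. -/
lemma tendsto_WHform_of_absolutelyContinuous {M : Measure ℝ} {p : ℝ}
    (hmom : ∫⁻ lam : ℝ, ENNReal.ofReal ((1 + lam ^ 2) ^ (-p)) ∂M < ⊤)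
    (hvol : ∫⁻ lam : ℝ, ENNReal.ofReal ((1 + lam ^ 2) ^ (-p)) < ⊤)
    (hac : M ≪ (volume : Measure ℝ)) {f : ℕ → ℝ → ℂ} (hf : ∀ n, IsTestHalf (f n))
    (hL2 : Tendsto (fun n => L2halfNormSq (f n)) atTop (nhds 0))
    (hC : Tendsto (fun nm : ℕ × ℕ => WHform M (f nm.1 - f nm.2)) atTop (nhds 0)) :
    Tendsto (fun n => WHform M (f n)) atTop (nhds 0) := by
  have hmeas : ∀ n, Continuous (halfFourier (f n)) := fun n => (hf n).continuous_halfFourier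
  have hmeasure : TendstoInMeasure volume (fun n lam => ‖halfFourier (f n) lam‖ ^ 2) atTop
      (fun _ => (0 : ℝ)) := by
    refine tendstoInMeasure_of_tendsto_eLpNorm one_ne_zero
      (fun n => ((hmeas n).norm.pow 2).aestronglyMeasurable) aestronglyMeasurable_const ?_
    have h1 : ∀ n, eLpNorm ((fun lam => ‖halfFourier (f n) lam‖ ^ 2) - fun _ => (0 : ℝ)) 1 volume
        = ENNReal.ofReal (2 * Real.pi * L2halfNormSq (f n)) := fun n => by
      rw [(hf n).L2halfNormSq_eq, ofReal_two_pi_mul_WHform hvol (hf n),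
        eLpNorm_one_eq_lintegral_enorm]
      congr 1 with x
      rw [Pi.sub_apply, sub_zero, Real.enorm_of_nonneg (by positivity)]
    simp_rw [h1]
    simpa using ENNReal.tendsto_ofReal (hL2.const_mul (2 * Real.pi))
  obtain ⟨φ, hφ, hae⟩ := hmeasure.exists_seq_tendsto_ae
  have hae' := hac.ae_le hae
  rw [Metric.tendsto_atTop]
  intro ε hε
  obtain ⟨N, hN⟩ := eventually_atTop_prod_self.1 (hC.eventually (gt_mem_nhds (half_pos hε)))
  refine ⟨N, fun n hn => ?_⟩
  rw [Real.dist_eq, sub_zero, abs_of_nonneg (WHform_nonneg _ _)]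
  have key : ENNReal.ofReal (2 * Real.pi * WHform M (f n)) ≤
      ENNReal.ofReal (2 * Real.pi * (ε / 2)) := by
    rw [ofReal_two_pi_mul_WHform hmom (hf n)]
    calc _ = ∫⁻ lam, liminf (fun k =>
          ENNReal.ofReal (‖halfFourier (f n - f (φ k)) lam‖ ^ 2)) atTop ∂M := by
          refine lintegral_congr_ae ?_
          filter_upwards [hae'] with lam hlam
          refine (Tendsto.liminf_eq ?_).symm
          refine ENNReal.tendsto_ofReal ?_
          have h0 : Tendsto (fun k => halfFourier (f (φ k)) lam) atTop (nhds 0) := by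
            rw [tendsto_zero_iff_norm_tendsto_zero]
            simpa using hlam.sqrt
          simp_rw [(hf n).halfFourier_sub (hf _)]
          simpa using ((h0.const_sub (halfFourier (f n) lam)).norm.pow 2)
      _ ≤ liminf (fun k => ∫⁻ lam,
          ENNReal.ofReal (‖halfFourier (f n - f (φ k)) lam‖ ^ 2) ∂M) atTop := by
          refine lintegral_liminf_le fun k => ?_
          have := ((hf n).sub (hf (φ k))).continuous_halfFourier
          exact (ENNReal.continuous_ofReal.comp (this.norm.pow 2)).measurable
      _ ≤ ENNReal.ofReal (2 * Real.pi * (ε / 2)) := by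
          refine liminf_le_of_frequently_le' (Eventually.frequently ?_)
          filter_upwards [eventually_ge_atTop N] with k hk
          rw [← ofReal_two_pi_mul_WHform hmom ((hf n).sub (hf _))]
          gcongr
          exact (hN n (φ k) hn (hk.trans hφ.le_apply)).le
  rw [ENNReal.ofReal_le_ofReal_iff (by positivity)] at key
  have := le_of_mul_le_mul_left key (by positivity)
  linarith

/-- The set of reals congruent modulo `2π` to a point of a null set is a null set. -/
lemma volume_preimage_image_exp {K : Set ℝ} (h0 : volume K = 0) :
    volume ((fun x : ℝ => Complex.exp (Complex.I * x)) ⁻¹'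
      ((fun x : ℝ => Complex.exp (Complex.I * x)) '' K)) = 0 := by
  refine measure_mono_null (t := ⋃ k : ℤ, (fun x : ℝ => x + k * (2 * Real.pi)) ⁻¹' K) ?_
    (measure_iUnion_null fun k => by rw [measure_preimage_add_right, h0])
  rintro x ⟨y, hy, hxy⟩
  obtain ⟨k, hk⟩ := Complex.exp_eq_exp_iff_exists_int.1 hxy
  refine mem_iUnion.2 ⟨k, ?_⟩
  have : y = x + k * (2 * Real.pi) := by
    have h : Complex.I * (y : ℂ) = Complex.I * ((x + k * (2 * Real.pi) : ℝ) : ℂ) := by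
      rw [hk]; push_cast; ring
    exact_mod_cast mul_left_cancel₀ Complex.I_ne_zero h
  simpa [this] using hy

/-- Polynomials in `e^{iλ}` converging boundedly to the indicator function of the `2π`-periodic
hull of a compact null set. -/
lemma exists_polynomial_tendsto_indicator {K : Set ℝ} (hK : IsCompact K) (h0 : volume K = 0) :
    ∃ P : ℕ → Polynomial ℂ, (∀ n (z : ℂ), ‖z‖ = 1 → ‖(P n).eval z‖ ≤ 3) ∧
      ∀ lam : ℝ, Tendsto (fun n => (P n).eval (Complex.exp (Complex.I * lam))) atTop
        (nhds (((fun x : ℝ => Complex.exp (Complex.I * x)) ⁻¹'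
          ((fun x : ℝ => Complex.exp (Complex.I * x)) '' K)).indicator (fun _ => (1 : ℂ)) lam)) := by
  choose P hP1 hP2 hP3 using fun n : ℕ => exists_polynomial_peak hK h0
    (ε := 1 / ((n : ℝ) + 1)) (by positivity) (by
      rw [div_le_one (by positivity)]
      linarith [n.cast_nonneg (α := ℝ)])
  refine ⟨P, hP1, fun lam => ?_⟩
  have hlim := tendsto_one_div_add_atTop_nhds_zero_nat (𝕜 := ℝ)
  set e : ℝ → ℂ := fun x => Complex.exp (Complex.I * x) with he
  by_cases hlam : e lam ∈ e '' K
  · rw [indicator_of_mem (by exact hlam)]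
    obtain ⟨y, hy, hye⟩ := hlam
    rw [tendsto_iff_norm_sub_tendsto_zero]
    refine squeeze_zero (fun _ => norm_nonneg _) (fun n => ?_) hlim
    have := hP2 n y hy
    change ‖(P n).eval (e y) - 1‖ ≤ _ at this
    rwa [hye] at this
  · rw [indicator_of_notMem (by exact hlam)]
    have hcl : IsClosed (e '' K) := (hK.image (by fun_prop)).isClosed
    obtain ⟨d, hd, hball⟩ := Metric.isOpen_iff.1 hcl.isOpen_compl _ hlam
    rw [tendsto_zero_iff_norm_tendsto_zero]
    refine squeeze_zero' (.of_forall fun _ => norm_nonneg _) ?_ hlim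
    filter_upwards [hlim.eventually (gt_mem_nhds hd)] with n hn
    refine hP3 n _ (Complex.norm_exp_I_mul_ofReal lam) fun x hx => ?_
    by_contra! hlt
    refine hball (show e x ∈ Metric.ball (e lam) d from ?_) ⟨x, hx, rfl⟩
    rw [Metric.mem_ball, dist_comm, dist_eq_norm]
    exact hlt.trans hn

lemma isLocallyFiniteMeasure_of_moment {M : Measure ℝ} {p : ℝ}
    (hmom : ∫⁻ lam : ℝ, ENNReal.ofReal ((1 + lam ^ 2) ^ (-p)) ∂M < ⊤) :
    IsLocallyFiniteMeasure M := by
  refine ⟨fun x => ?_⟩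
  have hcont : Continuous fun lam : ℝ => (1 + lam ^ 2) ^ (-p) :=
    Continuous.rpow_const (by fun_prop) fun y => Or.inl (by positivity)
  set c : ℝ := (1 + x ^ 2) ^ (-p) / 2 with hc
  have hc0 : 0 < (1 + x ^ 2) ^ (-p) := by positivity
  refine ⟨{lam | c < (1 + lam ^ 2) ^ (-p)}, ?_, ?_⟩
  · exact (isOpen_lt continuous_const hcont).mem_nhds (by
      change c < _
      linarith)
  · have hne : ENNReal.ofReal c ≠ 0 := (ENNReal.ofReal_pos.2 (half_pos hc0)).ne'
    refine (measure_mono fun y hy => ?_).trans_lt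
      ((meas_ge_le_lintegral_div (f := fun lam : ℝ => ENNReal.ofReal ((1 + lam ^ 2) ^ (-p)))
        (ENNReal.continuous_ofReal.comp hcont).measurable.aemeasurable hne
        ENNReal.ofReal_ne_top).trans_lt (ENNReal.div_lt_top hmom.ne hne))
    exact ENNReal.ofReal_le_ofReal (le_of_lt hy)

/-- Limits of the form along transforms multiplied by boundedly convergent symbols. -/
lemma tendsto_WHform_of_mul {ι : Type*} {l : Filter ι} [l.IsCountablyGenerated] {M : Measure ℝ}
    {p : ℝ} (hmom : ∫⁻ lam : ℝ, ENNReal.ofReal ((1 + lam ^ 2) ^ (-p)) ∂M < ⊤)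
    {f : ℝ → ℂ} (hf : IsTestHalf f) {g : ι → ℝ → ℂ} (hg : ∀ i, IsTestHalf (g i))
    {m : ι → ℝ → ℂ} {m₀ : ℝ → ℂ} {C : ℝ} (hm : ∀ i lam, ‖m i lam‖ ≤ C)
    (hgm : ∀ i lam, halfFourier (g i) lam = m i lam * halfFourier f lam)
    (hlim : ∀ lam, Tendsto (fun i => m i lam) l (nhds (m₀ lam))) :
    Tendsto (fun i => WHform M (g i)) l
      (nhds ((2 * Real.pi)⁻¹ * ∫ lam, ‖m₀ lam * halfFourier f lam‖ ^ 2 ∂M)) := by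
  simp_rw [WHform_eq]
  refine Tendsto.const_mul _ ?_
  refine tendsto_integral_filter_of_dominated_convergence
    (fun lam => C ^ 2 * ‖halfFourier f lam‖ ^ 2) (.of_forall fun i => ?_)
    (.of_forall fun i => .of_forall fun lam => ?_)
    ((hf.integrable_halfFourier_sq hmom).const_mul _) (.of_forall fun lam => ?_)
  · exact ((hg i).continuous_halfFourier.norm.pow 2).aestronglyMeasurable
  · rw [hgm, norm_mul, mul_pow, norm_mul, norm_pow, norm_pow, norm_norm, norm_norm]
    gcongr
    exact hm i lam
  · simp_rw [hgm]
    exact (((hlim lam).mul_const _).norm.pow 2)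

/-- If the form is closable, compact null sets are null for the spectral measure. -/
lemma measure_eq_zero_of_closable {M : Measure ℝ} {p : ℝ}
    (hmom : ∫⁻ lam : ℝ, ENNReal.ofReal ((1 + lam ^ 2) ^ (-p)) ∂M < ⊤)
    (hvol : ∫⁻ lam : ℝ, ENNReal.ofReal ((1 + lam ^ 2) ^ (-p)) < ⊤)
    (hclos : ∀ f : ℕ → ℝ → ℂ, (∀ n, IsTestHalf (f n)) →
        Tendsto (fun n => L2halfNormSq (f n)) atTop (nhds 0) →
        Tendsto (fun nm : ℕ × ℕ => WHform M (f nm.1 - f nm.2)) atTop (nhds 0) →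
        Tendsto (fun n => WHform M (f n)) atTop (nhds 0))
    {K : Set ℝ} (hK : IsCompact K) (h0 : volume K = 0) : M K = 0 := by
  obtain ⟨R, hR0, hR⟩ := hK.isBounded.exists_pos_norm_le
  obtain ⟨f, hf, hfR⟩ := exists_isTestHalf_halfFourier_ne_zero hR0
  obtain ⟨P, hPb, hPlim⟩ := exists_polynomial_tendsto_indicator hK h0
  set e : ℝ → ℂ := fun x => Complex.exp (Complex.I * x) with he
  set K' : Set ℝ := e ⁻¹' (e '' K) with hK'
  have he1 : ∀ x, ‖e x‖ = 1 := fun x => Complex.norm_exp_I_mul_ofReal x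
  choose g hg hgP using fun n => hf.exists_halfFourier_eq_eval_mul (P n)
  have hlim : ∀ {μ : Measure ℝ}, ∫⁻ lam : ℝ, ENNReal.ofReal ((1 + lam ^ 2) ^ (-p)) ∂μ < ⊤ →
      Tendsto (fun n => WHform μ (g n)) atTop (nhds ((2 * Real.pi)⁻¹ *
        ∫ lam, ‖K'.indicator (fun _ => (1 : ℂ)) lam * halfFourier f lam‖ ^ 2 ∂μ)) := fun hμ =>
    tendsto_WHform_of_mul hμ hf hg (m := fun n lam => (P n).eval (e lam))
      (fun n lam => hPb n _ (he1 lam)) hgP hPlim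
  have hL2 : Tendsto (fun n => L2halfNormSq (g n)) atTop (nhds 0) := by
    simp_rw [fun n => (hg n).L2halfNormSq_eq]
    convert hlim hvol
    rw [integral_eq_zero_of_ae, mul_zero]
    have hnull : ∀ᵐ lam, lam ∉ K' := measure_eq_zero_iff_ae_notMem.1 (volume_preimage_image_exp h0)
    filter_upwards [hnull] with lam hlam
    simp [hlam]
  have hC : Tendsto (fun nm : ℕ × ℕ => WHform M (g nm.1 - g nm.2)) atTop (nhds 0) := by
    have := tendsto_WHform_of_mul (l := atTop) hmom hf
      (g := fun nm : ℕ × ℕ => g nm.1 - g nm.2) (fun nm => (hg nm.1).sub (hg nm.2))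
      (m := fun nm lam => (P nm.1).eval (e lam) - (P nm.2).eval (e lam)) (m₀ := fun _ => 0)
      (C := 3 + 3)
      (fun nm lam => (norm_sub_le _ _).trans
        (add_le_add (hPb _ _ (he1 lam)) (hPb _ _ (he1 lam))))
      (fun nm lam => by rw [(hg nm.1).halfFourier_sub (hg nm.2), hgP, hgP, sub_mul])
      (fun lam => by
        rw [← prod_atTop_atTop_eq]
        simpa using ((hPlim lam).comp tendsto_fst).sub ((hPlim lam).comp tendsto_snd))
    simpa using this
  have hzero := tendsto_nhds_unique (hlim hmom) (hclos g hg hL2 hC)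
  rw [mul_eq_zero, or_iff_right (by positivity)] at hzero
  have hK'm : MeasurableSet K' :=
    ((hK.image (by fun_prop)).isClosed.preimage (by fun_prop)).measurableSet
  have hind : Measurable (K'.indicator (fun _ => (1 : ℂ))) := measurable_const.indicator hK'm
  rw [integral_eq_zero_iff_of_nonneg (fun _ => by positivity)] at hzero
  · refine measure_eq_zero_iff_ae_notMem.2 ?_
    filter_upwards [hzero] with lam hlam hmem
    have hmem' : lam ∈ K' := ⟨lam, hmem, rfl⟩
    rw [indicator_of_mem hmem', one_mul] at hlam
    exact hfR lam (hR lam hmem) (by simpa using hlam)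
  · refine (hf.integrable_halfFourier_sq hmom).mono'
      ((hind.mul hf.continuous_halfFourier.measurable).norm.pow_const 2).aestronglyMeasurable
      (.of_forall fun lam => ?_)
    rw [Real.norm_of_nonneg (by positivity)]
    by_cases h : lam ∈ K' <;> simp [h]

/-- A semibounded Wiener–Hopf quadratic form is closable in `L²((0,∞))` if and only if
its spectral measure is absolutely continuous with respect to Lebesgue measure. -/
theorem wienerHopf_closable_iff_absolutelyContinuous (M : Measure ℝ)
    (hdom : ∀ X : Set ℝ, MeasurableSet X → volume X ≤ M X)
    (p : ℝ) (hp : 0 < p)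
    (hmom : ∫⁻ lam : ℝ, ENNReal.ofReal ((1 + lam ^ 2) ^ (-p)) ∂M < ⊤) :
    (∀ f : ℕ → ℝ → ℂ, (∀ n, IsTestHalf (f n)) →
        Tendsto (fun n => L2halfNormSq (f n)) atTop (nhds 0) →
        Tendsto (fun nm : ℕ × ℕ => WHform M (f nm.1 - f nm.2)) atTop (nhds 0) →
        Tendsto (fun n => WHform M (f n)) atTop (nhds 0)) ↔
      M ≪ (volume : Measure ℝ) := by
  have hle : (volume : Measure ℝ) ≤ M := Measure.le_iff.2 hdom
  have hvol : ∫⁻ lam : ℝ, ENNReal.ofReal ((1 + lam ^ 2) ^ (-p)) < ⊤ :=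
    (lintegral_mono' hle le_rfl).trans_lt hmom
  refine ⟨fun hclos => ?_, fun hac f hf => tendsto_WHform_of_absolutelyContinuous hmom hvol hac hf⟩
  have := isLocallyFiniteMeasure_of_moment hmom
  refine Measure.AbsolutelyContinuous.mk fun S hS h0 => ?_
  by_contra hne
  obtain ⟨K, hKS, hK, hlt⟩ := hS.exists_lt_isCompact (pos_iff_ne_zero.2 hne)
  exact hlt.ne' (measure_eq_zero_of_closable hmom hvol hclos hK (measure_mono_null hKS h0))
end

section
/- Let M be a nonnegative Borel measure on ℝ such that M(X) ≥ |X| (the Lebesgue measure of X) for every Borel set X ⊆ ℝ and ∫_ℝ (1+λ²)^{-p} dM(λ) < ∞ for some p > 0. Define the convolution quadratic form q[f] = (2π)^{-1} ∫_ℝ |∫_ℝ e^{iλx} f(x) dx|² dM(λ) on the domain C_c^∞(ℝ) ⊆ L²(ℝ); one has q[f] ≥ ‖f‖²_{L²(ℝ)} for all such f. Then q is closable in L²(ℝ) if and only if M is absolutely continuous with respect to Lebesgue measure. -/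
open MeasureTheory Filter Set

/-- Test functions: smooth, compactly supported functions on `ℝ`. -/
def IsTest (f : ℝ → ℂ) : Prop :=
  ContDiff ℝ (⊤ : ℕ∞) f ∧ HasCompactSupport f

/-- The squared `L²(ℝ)`-norm. -/
noncomputable def L2NormSq (f : ℝ → ℂ) : ℝ :=
  ∫ x : ℝ, ‖f x‖ ^ 2

/-- The convolution quadratic form associated with the spectral measure `M`:
`q[f] = (2π)⁻¹ ∫ |∫_ℝ e^{iλx} f(x) dx|² dM(λ)`. -/
noncomputable def convForm (M : Measure ℝ) (f : ℝ → ℂ) : ℝ :=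
  (2 * Real.pi)⁻¹ *
    ∫ lam : ℝ, ‖∫ x : ℝ, Complex.exp (Complex.I * lam * x) * f x‖ ^ 2 ∂M

open scoped SchwartzMap FourierTransform ContDiff

section Density

/-- The error `χ (c x) - 1` of a dilated cutoff `χ` which is `1` on the unit ball, together with
all its derivatives, is `O(c (1 + |x|))` for `0 < c ≤ 1`. -/
lemma SchwartzMap.exists_norm_iteratedFDeriv_dilate_sub_one_le (χ : 𝓢(ℝ, ℝ))
    (hχ : ∀ x, |x| ≤ 1 → χ x = 1) (i : ℕ) :
    ∃ A : ℝ, 0 ≤ A ∧ ∀ c : ℝ, 0 < c → c ≤ 1 → ∀ x : ℝ,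
      ‖iteratedFDeriv ℝ i (fun y => χ (c * y) - 1) x‖ ≤ c * (A * (1 + ‖x‖)) := by
  have hB (x : ℝ) := χ.norm_iteratedFDeriv_le_seminorm ℝ i x
  set B := SchwartzMap.seminorm ℝ 0 i χ with hBdef
  have hB0 : 0 ≤ B := apply_nonneg _ _
  refine ⟨B + 1, by positivity, fun c hc hc1 x => ?_⟩
  rw [norm_iteratedFDeriv_eq_norm_iteratedDeriv]
  rcases Nat.eq_zero_or_pos i with rfl | hi
  · rw [iteratedDeriv_zero]
    have h0 := hB (c * x)
    rw [norm_iteratedFDeriv_zero] at h0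
    rcases le_or_gt |c * x| 1 with h | h
    · rw [hχ _ h]
      simp only [sub_self, norm_zero]
      positivity
    · rw [abs_mul, abs_of_pos hc] at h
      calc ‖χ (c * x) - 1‖ ≤ ‖χ (c * x)‖ + ‖(1 : ℝ)‖ := norm_sub_le _ _
        _ ≤ B + 1 := by rw [norm_one]; linarith
        _ ≤ (B + 1) * (c * (1 + |x|)) := by
          apply le_mul_of_one_le_right (by positivity)
          nlinarith
        _ = c * ((B + 1) * (1 + ‖x‖)) := by rw [Real.norm_eq_abs]; ring
  · have e : iteratedDeriv i (fun y => χ (c * y) - 1) x = c ^ i * iteratedDeriv i χ (c * x) := by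
      have := iteratedDeriv_const_add (f := fun y => χ (c * y)) (x := x) hi (-1)
      rw [← congrFun (iteratedDeriv_comp_const_mul (n := i) (χ.smooth i) c) x, ← this]
      congr 1
      ext y
      ring
    have h0 := hB (c * x)
    rw [norm_iteratedFDeriv_eq_norm_iteratedDeriv] at h0
    rw [e, norm_mul, norm_pow, Real.norm_of_nonneg hc.le]
    calc c ^ i * ‖iteratedDeriv i χ (c * x)‖ ≤ c * (B + 1) := by
          gcongr
          · exact pow_le_of_le_one hc.le hc1 hi.ne'
          · linarith
      _ ≤ c * ((B + 1) * (1 + ‖x‖)) := by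
          gcongr
          apply le_mul_of_one_le_right (by positivity)
          linarith [norm_nonneg x]

/-- Smooth compactly supported functions are dense in the Schwartz space on `ℝ`. -/
lemma SchwartzMap.dense_hasCompactSupport :
    Dense {f : 𝓢(ℝ, ℂ) | HasCompactSupport f} := by
  intro f
  let b : ContDiffBump (0 : ℝ) := ⟨1, 2, one_pos, one_lt_two⟩
  let χ : 𝓢(ℝ, ℝ) := b.hasCompactSupport.toSchwartzMap b.contDiff
  have hχ (x : ℝ) (hx : |x| ≤ 1) : χ x = 1 := b.one_of_mem_closedBall (by simpa using hx)
  have hcs (c : ℝ) (hc : 0 < c) : HasCompactSupport (fun x => χ (c * x) • f x) :=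
    (b.hasCompactSupport.comp_homeomorph (Homeomorph.mulLeft₀ c hc.ne')).smul_right
  have hsm (c : ℝ) : ContDiff ℝ ∞ (fun x => χ (c * x) • f x) :=
    ((χ.smooth ⊤).comp (contDiff_const.mul contDiff_id)).smul (f.smooth ⊤)
  let c : ℕ → ℝ := fun n => 1 / ((n : ℝ) + 1)
  have hc0 (n : ℕ) : 0 < c n := Nat.one_div_pos_of_nat
  have hc1 (n : ℕ) : c n ≤ 1 := by
    have := Nat.one_div_le_one_div (α := ℝ) (Nat.zero_le n)
    simpa [c] using this
  let u : ℕ → 𝓢(ℝ, ℂ) := fun n => (hcs _ (hc0 n)).toSchwartzMap (hsm _)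
  refine mem_closure_of_tendsto (b := atTop) (f := u) ?_
    (Eventually.of_forall fun n => hcs _ (hc0 n))
  rw [(schwartz_withSeminorms ℝ ℝ ℂ).tendsto_nhds]
  rintro ⟨k, m⟩ ε hε
  choose A hA0 hA using χ.exists_norm_iteratedFDeriv_dilate_sub_one_le hχ
  set p := fun k m => SchwartzMap.seminorm ℝ k m f
  have hp (k m : ℕ) : 0 ≤ p k m := apply_nonneg _ _
  set K := ∑ i ∈ Finset.range (m + 1), (m.choose i : ℝ) * A i * (p k (m - i) + p (k + 1) (m - i))
  have key (n : ℕ) : SchwartzMap.seminorm ℝ k m (u n - f) ≤ c n * K := by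
    refine SchwartzMap.seminorm_le_bound ℝ k m _ ?_ fun x => ?_
    · refine mul_nonneg (hc0 n).le (Finset.sum_nonneg fun i _ => ?_)
      have := hA0 i
      have := hp k (m - i)
      have := hp (k + 1) (m - i)
      positivity
    have e : ⇑(u n - f) = fun y => (χ (c n * y) - 1) • f y := by
      ext y
      change χ (c n * y) • f y - f y = _
      rw [sub_smul, one_smul]
    rw [e]
    have hl := norm_iteratedFDeriv_smul_le (𝕜 := ℝ) (N := ∞) (n := m)
      (f := fun y => χ (c n * y) - 1) (g := f)
      (((χ.smooth ⊤).comp (contDiff_const.mul contDiff_id)).sub contDiff_const) (f.smooth ⊤) x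
      (mod_cast le_top)
    refine (mul_le_mul_of_nonneg_left hl (by positivity)).trans ?_
    rw [Finset.mul_sum, Finset.mul_sum]
    refine Finset.sum_le_sum fun i _ => ?_
    have h1 := hA i (c n) (hc0 n) (hc1 n) x
    have h2 := SchwartzMap.le_seminorm ℝ k (m - i) f x
    have h3 := SchwartzMap.le_seminorm ℝ (k + 1) (m - i) f x
    calc ‖x‖ ^ k * ((m.choose i : ℝ) * ‖iteratedFDeriv ℝ i (fun y => χ (c n * y) - 1) x‖ *
          ‖iteratedFDeriv ℝ (m - i) f x‖)
        ≤ ‖x‖ ^ k * ((m.choose i : ℝ) * (c n * (A i * (1 + ‖x‖))) *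
          ‖iteratedFDeriv ℝ (m - i) f x‖) := by gcongr
      _ = c n * ((m.choose i : ℝ) * A i * (‖x‖ ^ k * ‖iteratedFDeriv ℝ (m - i) f x‖ +
          ‖x‖ ^ (k + 1) * ‖iteratedFDeriv ℝ (m - i) f x‖)) := by ring
      _ ≤ _ := by
        have := hA0 i
        have := (hc0 n).le
        gcongr
  have hlim : Tendsto (fun n => c n * K) atTop (nhds 0) := by
    simpa only [zero_mul] using
      (tendsto_one_div_add_atTop_nhds_zero_nat (𝕜 := ℝ)).mul_const K
  filter_upwards [hlim.eventually_lt_const hε] with n hn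
  exact (key n).trans_lt hn

end Density

section ExpTransform

/-- The Fourier transform `f ↦ (λ ↦ ∫ e^{iλx} f(x) dx)` on the Schwartz space. -/
noncomputable def expTransform : 𝓢(ℝ, ℂ) ≃L[ℂ] 𝓢(ℝ, ℂ) :=
  let e : ℝ ≃L[ℝ] ℝ := ContinuousLinearEquiv.unitsEquivAut ℝ
    (Units.mk0 (-(2 * Real.pi)⁻¹) (by simp [Real.pi_ne_zero]))
  (FourierTransform.fourierCLE ℂ 𝓢(ℝ, ℂ)).trans
    (ContinuousLinearEquiv.equivOfInverse (SchwartzMap.compCLMOfContinuousLinearEquiv ℂ e)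
      (SchwartzMap.compCLMOfContinuousLinearEquiv ℂ e.symm)
      (fun f => by ext x; simp) (fun f => by ext x; simp))

lemma expTransform_apply_eq_fourier (f : 𝓢(ℝ, ℂ)) (l : ℝ) :
    expTransform f l = 𝓕 f (l * -(2 * Real.pi)⁻¹) := rfl

lemma expTransform_apply (f : 𝓢(ℝ, ℂ)) (l : ℝ) :
    expTransform f l = ∫ x : ℝ, Complex.exp (Complex.I * l * x) * f x := by
  rw [expTransform_apply_eq_fourier, SchwartzMap.fourier_coe,
    Real.fourier_real_eq_integral_exp_smul]
  refine integral_congr_ae (Eventually.of_forall fun x => ?_)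
  have : (Real.pi : ℂ) ≠ 0 := mod_cast Real.pi_ne_zero
  simp only [smul_eq_mul]
  congr 2
  push_cast
  field_simp

lemma SchwartzMap.integral_norm_sq_eq_norm_toLp_sq (f : 𝓢(ℝ, ℂ)) (μ : Measure ℝ)
    [μ.HasTemperateGrowth] : ∫ x, ‖f x‖ ^ 2 ∂μ = ‖f.toLp 2 μ‖ ^ 2 := by
  rw [SchwartzMap.norm_toLp' (by simp) (by simp)]
  have : 0 ≤ ∫ x, ‖f x‖ ^ 2 ∂μ := integral_nonneg fun x => by positivity
  rw [← Real.rpow_natCast, ← Real.rpow_mul (by positivity)]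
  simp

lemma convForm_coe (M : Measure ℝ) [M.HasTemperateGrowth] (f : 𝓢(ℝ, ℂ)) :
    convForm M f = (2 * Real.pi)⁻¹ * ‖(expTransform f).toLp 2 M‖ ^ 2 := by
  simp_rw [convForm, ← expTransform_apply, SchwartzMap.integral_norm_sq_eq_norm_toLp_sq]

/-- Plancherel's theorem for `expTransform`. -/
lemma L2NormSq_coe (f : 𝓢(ℝ, ℂ)) :
    L2NormSq f = (2 * Real.pi)⁻¹ * ‖(expTransform f).toLp 2 volume‖ ^ 2 := by
  rw [← SchwartzMap.integral_norm_sq_eq_norm_toLp_sq]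
  simp_rw [expTransform_apply_eq_fourier]
  rw [Measure.integral_comp_mul_right (fun y => ‖𝓕 f y‖ ^ 2), SchwartzMap.integral_norm_sq_fourier]
  have := Real.pi_pos
  rw [inv_neg, inv_inv, abs_neg, abs_of_pos (by positivity), smul_eq_mul, L2NormSq]
  field_simp

end ExpTransform

section Measure

lemma hasTemperateGrowth_of_lintegral_lt_top {M : Measure ℝ} {p : ℝ} (hp : 0 < p)
    (hmom : ∫⁻ x : ℝ, ENNReal.ofReal ((1 + x ^ 2) ^ (-p)) ∂M < ⊤) : M.HasTemperateGrowth := by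
  refine ⟨⌈2 * p⌉₊, ?_⟩
  have h_int : Integrable (fun x : ℝ => (1 + x ^ 2) ^ (-p)) M := by
    refine ⟨Measurable.aestronglyMeasurable (by fun_prop), ?_⟩
    rwa [hasFiniteIntegral_iff_ofReal (Eventually.of_forall fun x => by positivity)]
  refine h_int.mono' (Measurable.aestronglyMeasurable (by fun_prop))
    (Eventually.of_forall fun x => ?_)
  rw [Real.norm_of_nonneg (by positivity)]
  have h1 : 1 ≤ 1 + ‖x‖ := by linarith [norm_nonneg x]
  calc (1 + ‖x‖) ^ (-(⌈2 * p⌉₊ : ℝ)) ≤ (1 + ‖x‖) ^ (2 * -p) :=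
        Real.rpow_le_rpow_of_exponent_le h1 (by linarith [Nat.le_ceil (2 * p)])
    _ = ((1 + ‖x‖) ^ 2) ^ (-p) := by
        rw [Real.rpow_mul (by positivity), Real.rpow_two]
    _ ≤ (1 + x ^ 2) ^ (-p) := by
        refine Real.rpow_le_rpow_of_nonpos (by positivity) ?_ (by linarith)
        nlinarith [norm_nonneg x, Real.norm_eq_abs x, sq_abs x]

lemma isFiniteMeasureOnCompacts_of_hasTemperateGrowth (M : Measure ℝ) [h : M.HasTemperateGrowth] :
    IsFiniteMeasureOnCompacts M := by
  obtain ⟨n, hn⟩ := h.exists_integrable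
  refine ⟨fun K hK => ?_⟩
  obtain ⟨R, hR, hKR⟩ := hK.isBounded.exists_pos_norm_le
  refine lt_of_le_of_lt (measure_mono fun x hx => ?_)
    (hn.measure_ge_lt_top (ε := (1 + R) ^ (-(n : ℝ))) (by positivity))
  exact Real.rpow_le_rpow_of_nonpos (by positivity) (by linarith [hKR x hx]) (by simp)

end Measure

section Closability

variable {M : Measure ℝ} [M.HasTemperateGrowth]

lemma tendsto_const_mul_norm_sq_zero_iff {ι E : Type*} [NormedAddCommGroup E] {l : Filter ι}
    {a : ℝ} (ha : a ≠ 0) {v : ι → E} :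
    Tendsto (fun i => a * ‖v i‖ ^ 2) l (nhds 0) ↔ Tendsto v l (nhds 0) := by
  rw [tendsto_zero_iff_norm_tendsto_zero (f := v)]
  refine ⟨fun h => ?_, fun h => by simpa using (h.pow 2).const_mul a⟩
  have := (h.const_mul a⁻¹).sqrt
  simpa [← mul_assoc, inv_mul_cancel₀ ha] using this

/-- Closability of the convolution form, phrased in terms of Fourier transforms in `L²(M)`. -/
lemma closable_iff_forall_tendsto_toLp :
    (∀ f : ℕ → ℝ → ℂ, (∀ n, IsTest (f n)) →
        Tendsto (fun n => L2NormSq (f n)) atTop (nhds 0) →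
        Tendsto (fun nm : ℕ × ℕ => convForm M (f nm.1 - f nm.2)) atTop (nhds 0) →
        Tendsto (fun n => convForm M (f n)) atTop (nhds 0)) ↔
      ∀ f : ℕ → 𝓢(ℝ, ℂ), (∀ n, HasCompactSupport (f n)) →
        Tendsto (fun n => (expTransform (f n)).toLp 2 volume) atTop (nhds 0) →
        CauchySeq (fun n => (expTransform (f n)).toLp 2 M) →
        Tendsto (fun n => (expTransform (f n)).toLp 2 M) atTop (nhds 0) := by
  have ha : (2 * Real.pi)⁻¹ ≠ 0 := by simp [Real.pi_ne_zero]
  have key (f : ℕ → 𝓢(ℝ, ℂ)) :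
      (Tendsto (fun n => L2NormSq (f n)) atTop (nhds 0) →
        Tendsto (fun nm : ℕ × ℕ => convForm M (f nm.1 - f nm.2)) atTop (nhds 0) →
        Tendsto (fun n => convForm M (f n)) atTop (nhds 0)) ↔
      (Tendsto (fun n => (expTransform (f n)).toLp 2 volume) atTop (nhds 0) →
        CauchySeq (fun n => (expTransform (f n)).toLp 2 M) →
        Tendsto (fun n => (expTransform (f n)).toLp 2 M) atTop (nhds 0)) := by
    have hsub (n m : ℕ) : convForm M (⇑(f n) - ⇑(f m)) = (2 * Real.pi)⁻¹ *
        ‖(expTransform (f n)).toLp 2 M - (expTransform (f m)).toLp 2 M‖ ^ 2 := by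
      have h1 : ⇑(f n) - ⇑(f m) = ⇑(f n - f m) := rfl
      rw [h1, convForm_coe, map_sub]
      rfl
    simp_rw [hsub, convForm_coe, L2NormSq_coe, tendsto_const_mul_norm_sq_zero_iff ha,
      cauchySeq_iff_tendsto_dist_atTop_0, dist_eq_norm, ← tendsto_zero_iff_norm_tendsto_zero]
  refine ⟨fun h f hf => (key f).1 (h (fun n => f n) fun n => ⟨(f n).smooth ⊤, hf n⟩),
    fun h f hf => ?_⟩
  exact (key fun n => (hf n).2.toSchwartzMap (hf n).1).2 (h _ fun n => (hf n).2)

/-- Fourier transforms of test functions are dense in `L²(M)`. -/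
lemma dense_image_toLp_expTransform [IsFiniteMeasureOnCompacts M] :
    Dense ((fun f : 𝓢(ℝ, ℂ) => (expTransform f).toLp 2 M) '' {f | HasCompactSupport f}) := by
  have hd : DenseRange fun f : 𝓢(ℝ, ℂ) => (expTransform f).toLp 2 M :=
    (SchwartzMap.denseRange_toLpCLM (F := ℂ) (p := 2) (μ := M) (by simp)).comp
      expTransform.surjective.denseRange (SchwartzMap.toLpCLM ℝ ℂ 2 M).continuous
  exact hd.dense_image (SchwartzMap.continuous_toLp.comp expTransform.continuous)
    SchwartzMap.dense_hasCompactSupport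

lemma tendsto_toLp_zero_of_absolutelyContinuous (hM : M ≪ volume) {g : ℕ → 𝓢(ℝ, ℂ)}
    (h0 : Tendsto (fun n => (g n).toLp 2 volume) atTop (nhds 0))
    (hg : CauchySeq fun n => (g n).toLp 2 M) :
    Tendsto (fun n => (g n).toLp 2 M) atTop (nhds 0) := by
  obtain ⟨v, hv⟩ := cauchySeq_tendsto_of_complete hg
  obtain ⟨ns, hns, h1⟩ := (tendstoInMeasure_of_tendsto_Lp h0).exists_seq_tendsto_ae
  obtain ⟨ms, hms, h2⟩ :=
    (tendstoInMeasure_of_tendsto_Lp (hv.comp hns.tendsto_atTop)).exists_seq_tendsto_ae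
  have e1 : ∀ᵐ x ∂M, ∀ n, (g n).toLp 2 volume x = g n x :=
    hM.ae_le (ae_all_iff.2 fun n => (g n).coeFn_toLp 2 volume)
  have e2 : ∀ᵐ x ∂M, ∀ n, (g n).toLp 2 M x = g n x := ae_all_iff.2 fun n => (g n).coeFn_toLp 2 M
  have e3 : ∀ᵐ x ∂M, (0 : Lp ℂ 2 (volume : Measure ℝ)) x = 0 := hM.ae_le (Lp.coeFn_zero _ _ _)
  have : v = 0 := by
    rw [Lp.eq_zero_iff_ae_eq_zero]
    filter_upwards [e1, e2, e3, hM.ae_le h1, h2] with x e1 e2 e3 h1 h2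
    simp only [Function.comp_apply, e2] at h2
    simp only [e1, e3] at h1
    exact tendsto_nhds_unique h2 (h1.comp hms.tendsto_atTop)
  rwa [this] at hv

lemma measure_eq_zero_of_closable_s1 [IsFiniteMeasureOnCompacts M] (hle : volume ≤ M)
    (h : ∀ f : ℕ → 𝓢(ℝ, ℂ), (∀ n, HasCompactSupport (f n)) →
        Tendsto (fun n => (expTransform (f n)).toLp 2 volume) atTop (nhds 0) →
        CauchySeq (fun n => (expTransform (f n)).toLp 2 M) →
        Tendsto (fun n => (expTransform (f n)).toLp 2 M) atTop (nhds 0))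
    {N : Set ℝ} (hN : MeasurableSet N) (h0 : volume N = 0) (hfin : M N ≠ ⊤) : M N = 0 := by
  set v := indicatorConstLp 2 hN hfin (1 : ℂ)
  obtain ⟨w, hw, hlim⟩ := mem_closure_iff_seq_limit.1 (dense_image_toLp_expTransform v)
  choose f hf hfw using hw
  obtain rfl : (fun n => (expTransform (f n)).toLp 2 M) = w := funext hfw
  have hv : (v : ℝ → ℂ) =ᵐ[M] N.indicator fun _ => 1 := indicatorConstLp_coeFn
  have hvol : Tendsto (fun n => (expTransform (f n)).toLp 2 volume) atTop (nhds 0) := by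
    have hM := (Lp.tendsto_Lp_iff_tendsto_eLpNorm' _ _).1 hlim
    rw [Lp.tendsto_Lp_iff_tendsto_eLpNorm']
    refine tendsto_of_tendsto_of_tendsto_of_le_of_le tendsto_const_nhds hM (fun _ => zero_le)
      fun n => ?_
    have hz : N.indicator (fun _ => (1 : ℂ)) =ᵐ[volume] 0 := indicator_meas_zero h0
    have e : ⇑((expTransform (f n)).toLp 2 volume) - ⇑(0 : Lp ℂ 2 (volume : Measure ℝ))
        =ᵐ[volume] ⇑(expTransform (f n)) - N.indicator fun _ => 1 :=
      ((expTransform (f n)).coeFn_toLp 2 volume).sub ((Lp.coeFn_zero _ _ _).trans hz.symm)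
    have e' : ⇑((expTransform (f n)).toLp 2 M) - ⇑v
        =ᵐ[M] ⇑(expTransform (f n)) - N.indicator fun _ => 1 :=
      ((expTransform (f n)).coeFn_toLp 2 M).sub hv
    rw [eLpNorm_congr_ae e, eLpNorm_congr_ae e']
    exact eLpNorm_mono_measure _ hle
  have hv0 : v = 0 := tendsto_nhds_unique hlim (h f hf hvol hlim.cauchySeq)
  have hae : N.indicator (fun _ => (1 : ℂ)) =ᵐ[M] 0 :=
    hv.symm.trans (hv0 ▸ Lp.coeFn_zero ℂ 2 M)
  simpa [Function.support_const] using indicator_ae_eq_zero.1 hae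

end Closability

/-- A semibounded convolution quadratic form is closable in `L²(ℝ)` if and only if
its spectral measure is absolutely continuous with respect to Lebesgue measure. -/
theorem convolution_closable_iff_absolutelyContinuous (M : Measure ℝ)
    (hdom : ∀ X : Set ℝ, MeasurableSet X → volume X ≤ M X)
    (p : ℝ) (hp : 0 < p)
    (hmom : ∫⁻ lam : ℝ, ENNReal.ofReal ((1 + lam ^ 2) ^ (-p)) ∂M < ⊤) :
    (∀ f : ℕ → ℝ → ℂ, (∀ n, IsTest (f n)) →
        Tendsto (fun n => L2NormSq (f n)) atTop (nhds 0) →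
        Tendsto (fun nm : ℕ × ℕ => convForm M (f nm.1 - f nm.2)) atTop (nhds 0) →
        Tendsto (fun n => convForm M (f n)) atTop (nhds 0)) ↔
      M ≪ (volume : Measure ℝ) := by
  have := hasTemperateGrowth_of_lintegral_lt_top hp hmom
  have := isFiniteMeasureOnCompacts_of_hasTemperateGrowth M
  rw [closable_iff_forall_tendsto_toLp]
  refine ⟨fun h => ?_, fun hM f _ => tendsto_toLp_zero_of_absolutelyContinuous hM⟩
  refine Measure.AbsolutelyContinuous.mk fun N hN h0 => ?_
  have hcover : N = ⋃ k : ℕ, N ∩ Metric.closedBall 0 k := by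
    rw [← inter_iUnion, Metric.iUnion_closedBall_nat, inter_univ]
  rw [hcover, measure_iUnion_null_iff]
  intro k
  refine measure_eq_zero_of_closable_s1 (Measure.le_iff.2 hdom) h
    (hN.inter Metric.isClosed_closedBall.measurableSet) (measure_inter_null_of_null_left _ h0) ?_
  exact (measure_mono inter_subset_right).trans_lt
    (isCompact_closedBall _ _).measure_lt_top |>.ne
end

section
/- (Continuous Riesz Brothers theorem.) Let p ≥ 0, let μ be a nonnegative Borel measure on ℝ with ∫_ℝ (1+λ²)^{-p} dμ(λ) < ∞, and let h : ℝ → ℂ be a Borel function with |h(λ)| = 1 for all λ (so that dM = h dμ represents a complex measure whose variation μ has at most polynomial growth). Suppose there exist a ∈ ℝ and a Borel function g : ℝ → ℂ with ∫_a^∞ |g(x)|² dx < ∞ such that for every φ ∈ C_c^∞((a,∞)) one has ∫_ℝ φ(x) g(x) dx = (2π)^{-1} ∫_ℝ ( ∫_ℝ e^{-iλx} φ(x) dx ) h(λ) dμ(λ). Then μ is absolutely continuous with respect to Lebesgue measure. -/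
open MeasureTheory Filter Set

section
open scoped FourierTransform SchwartzMap Topology ContDiff

theorem SchwartzMap.integrable_comp_mul_mul (χ f : 𝓢(ℝ, ℂ)) (ε : ℝ) :
    Integrable fun x ↦ χ (ε * x) * f x :=
  f.integrable.bdd_mul (c := SchwartzMap.seminorm ℝ 0 0 χ)
    (by fun_prop) (.of_forall fun _ ↦ χ.norm_le_seminorm ℝ _)

theorem SchwartzMap.hasDerivAt_comp_mul_mul (χ f : 𝓢(ℝ, ℂ)) (ε x : ℝ) :
    HasDerivAt (fun x ↦ χ (ε * x) * f x)
      (ε * (SchwartzMap.derivCLM ℂ ℂ χ (ε * x) * f x)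
        + χ (ε * x) * SchwartzMap.derivCLM ℂ ℂ f x) x := by
  have h1 : HasDerivAt (fun x : ℝ ↦ ε * x) ε x := by
    simpa using (hasDerivAt_id x).const_mul ε
  have h2 := (χ.hasDerivAt (ε * x)).scomp x h1
  have h3 := h2.mul (f.hasDerivAt x)
  refine h3.congr_deriv ?_
  simp [SchwartzMap.derivCLM_apply, mul_assoc]

/-- The Fourier transforms of the dilated cutoffs `x ↦ χ (ε * x) * f x`, `0 ≤ ε ≤ 1`, of a Schwartz
function `f` decay faster than any power, uniformly in `ε`. -/
theorem SchwartzMap.exists_pow_mul_norm_fourier_comp_mul_mul_le (k : ℕ) (χ f : 𝓢(ℝ, ℂ)) :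
    ∃ C : ℝ, ∀ ε : ℝ, 0 ≤ ε → ε ≤ 1 → ∀ ξ : ℝ,
      ‖ξ‖ ^ k * ‖𝓕 (fun x ↦ χ (ε * x) * f x) ξ‖ ≤ C := by
  induction k generalizing χ f with
  | zero =>
    refine ⟨∫ x, SchwartzMap.seminorm ℝ 0 0 χ * ‖f x‖, fun ε _ _ ξ ↦ ?_⟩
    rw [pow_zero, one_mul]
    refine (VectorFourier.norm_fourierIntegral_le_integral_norm _ _ _ _ _).trans ?_
    refine integral_mono (χ.integrable_comp_mul_mul f ε).norm
      (f.integrable.norm.const_mul _) fun x ↦ ?_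
    rw [norm_mul]
    gcongr
    exact χ.norm_le_seminorm ℝ _
  | succ k ih =>
    obtain ⟨C₁, h₁⟩ := ih (SchwartzMap.derivCLM ℂ ℂ χ) f
    obtain ⟨C₂, h₂⟩ := ih χ (SchwartzMap.derivCLM ℂ ℂ f)
    refine ⟨C₁ + C₂, fun ε hε hε' ξ ↦ ?_⟩
    have hd := fun x ↦ χ.hasDerivAt_comp_mul_mul f ε x
    have hi₁ := (SchwartzMap.derivCLM ℂ ℂ χ).integrable_comp_mul_mul f ε
    have hi₂ := χ.integrable_comp_mul_mul (SchwartzMap.derivCLM ℂ ℂ f) ε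
    have hderiv : deriv (fun x ↦ χ (ε * x) * f x) =
        (ε : ℂ) • (fun x ↦ SchwartzMap.derivCLM ℂ ℂ χ (ε * x) * f x)
          + fun x ↦ χ (ε * x) * SchwartzMap.derivCLM ℂ ℂ f x :=
      funext fun x ↦ (hd x).deriv
    have hF := congrFun (Real.fourier_deriv (χ.integrable_comp_mul_mul f ε)
      (fun x ↦ (hd x).differentiableAt) (by rw [hderiv]; exact (hi₁.smul _).add hi₂)) ξ
    have hsplit : 𝓕 (deriv fun x ↦ χ (ε * x) * f x) ξ =
        ε * 𝓕 (fun x ↦ SchwartzMap.derivCLM ℂ ℂ χ (ε * x) * f x) ξ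
          + 𝓕 (fun x ↦ χ (ε * x) * SchwartzMap.derivCLM ℂ ℂ f x) ξ := by
      rw [hderiv]
      have h₁ := VectorFourier.fourierIntegral_add (L := innerₗ ℝ) Real.continuous_fourierChar
        (by exact continuous_inner) (hi₁.smul (ε : ℂ)) hi₂
      rw [VectorFourier.fourierIntegral_const_smul] at h₁
      exact congrFun h₁ ξ
    have hle : ‖ξ‖ * ‖𝓕 (fun x ↦ χ (ε * x) * f x) ξ‖ ≤
        ‖𝓕 (fun x ↦ SchwartzMap.derivCLM ℂ ℂ χ (ε * x) * f x) ξ‖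
          + ‖𝓕 (fun x ↦ χ (ε * x) * SchwartzMap.derivCLM ℂ ℂ f x) ξ‖ := by
      calc ‖ξ‖ * ‖𝓕 (fun x ↦ χ (ε * x) * f x) ξ‖
          ≤ (2 * Real.pi * ‖ξ‖) * ‖𝓕 (fun x ↦ χ (ε * x) * f x) ξ‖ := by
            gcongr
            nlinarith [Real.pi_gt_three, norm_nonneg ξ]
        _ = ‖𝓕 (deriv fun x ↦ χ (ε * x) * f x) ξ‖ := by
            rw [hF, norm_smul]
            simp [abs_of_pos Real.pi_pos]
        _ ≤ _ := by
            rw [hsplit]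
            refine (norm_add_le _ _).trans ?_
            gcongr
            rw [norm_mul, Complex.norm_real, Real.norm_of_nonneg hε]
            exact mul_le_of_le_one_left (norm_nonneg _) hε'
    calc ‖ξ‖ ^ (k + 1) * ‖𝓕 (fun x ↦ χ (ε * x) * f x) ξ‖
        = ‖ξ‖ ^ k * (‖ξ‖ * ‖𝓕 (fun x ↦ χ (ε * x) * f x) ξ‖) := by ring
      _ ≤ ‖ξ‖ ^ k * (_ + _) := by gcongr
      _ ≤ C₁ + C₂ := by
        rw [mul_add]
        exact add_le_add (h₁ ε hε hε' ξ) (h₂ ε hε hε' ξ)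

/-- The resolvent symbol has temperate growth. -/
theorem hasTemperateGrowth_resolvent {r : ℝ} (hr : 0 < r) (t : ℝ) :
    Function.HasTemperateGrowth fun ξ : ℝ ↦ (r : ℂ) / (r + Complex.I * (ξ - t)) := by
  have h1 : Function.HasTemperateGrowth fun ξ : ℝ ↦ (1 + ‖(ξ - t) / r‖ ^ 2) ^ (-1 : ℝ) := by
    refine (Function.hasTemperateGrowth_one_add_norm_sq_rpow ℝ (-1)).comp
      (f := fun ξ : ℝ ↦ (ξ - t) / r) ?_
    simp only [div_eq_mul_inv]
    fun_prop
  have h2 : Function.HasTemperateGrowth fun ξ : ℝ ↦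
      ((r : ℂ) - Complex.I * (ξ - t)) * (r : ℂ)⁻¹ *
        (((1 + ‖(ξ - t) / r‖ ^ 2) ^ (-1 : ℝ) : ℝ) : ℂ) := by
    have := Function.Complex.hasTemperateGrowth_ofReal.comp h1
    have h3 : Function.HasTemperateGrowth fun ξ : ℝ ↦ (ξ : ℂ) :=
      Function.Complex.hasTemperateGrowth_ofReal
    refine Function.HasTemperateGrowth.mul (f := fun ξ : ℝ ↦
      ((r : ℂ) - Complex.I * (ξ - t)) * (r : ℂ)⁻¹) ?_ this
    fun_prop
  convert h2 using 2 with ξ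
  have hne : (r : ℂ) + Complex.I * (ξ - t) ≠ 0 := fun h ↦ hr.ne' (by simpa using congrArg Complex.re h)
  have hne' : (r : ℂ) ≠ 0 := by exact_mod_cast hr.ne'
  have hpos : (r : ℂ) ^ 2 + (ξ - t) ^ 2 ≠ 0 := by
    norm_cast; positivity
  rw [Real.rpow_neg_one, Real.norm_eq_abs, sq_abs]
  push_cast
  field_simp
  ring_nf
  rw [Complex.I_sq]; ring

/-- The resolvent multiplier preserves Schwartz functions vanishing on a left half-line. -/
theorem SchwartzMap.exists_fourier_eq_resolvent_mul {r : ℝ} (hr : 0 < r) (t b : ℝ) (f : 𝓢(ℝ, ℂ))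
    (hf : ∀ x < b, f x = 0) :
    ∃ v : 𝓢(ℝ, ℂ), (∀ x < b, v x = 0) ∧
      ∀ ξ : ℝ, 𝓕 v ξ = (r : ℂ) / (r + Complex.I * (ξ - t)) * 𝓕 f ξ := by
  set m : ℝ → ℂ := fun ξ ↦ (r : ℂ) / (r + Complex.I * (ξ - t)) with hm
  have hmg : Function.HasTemperateGrowth m := hasTemperateGrowth_resolvent hr t
  set v : 𝓢(ℝ, ℂ) := 𝓕⁻ (SchwartzMap.smulLeftCLM ℂ m (𝓕 f)) with hv
  have hFv (ξ : ℝ) : 𝓕 v ξ = m ξ * 𝓕 f ξ := by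
    rw [hv, FourierTransform.fourier_fourierInv_eq, SchwartzMap.smulLeftCLM_apply_apply hmg,
      smul_eq_mul]
  refine ⟨v, ?_, hFv⟩
  have hode : (r : ℂ) • f = ((r : ℂ) - Complex.I * t) • v
      + ((2 * Real.pi : ℂ))⁻¹ • SchwartzMap.derivCLM ℂ ℂ v := by
    have hinj : Function.Injective (fun f : 𝓢(ℝ, ℂ) ↦ 𝓕 f) := fun f g hfg ↦ by
      simpa using congrArg (fun f : 𝓢(ℝ, ℂ) ↦ 𝓕⁻ f) hfg
    have hder (ξ : ℝ) : 𝓕 (SchwartzMap.derivCLM ℂ ℂ v) ξ =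
        2 * Real.pi * Complex.I * ξ * 𝓕 v ξ :=
      congrFun (Real.fourier_deriv v.integrable v.differentiable
        (SchwartzMap.derivCLM ℂ ℂ v).integrable) ξ
    apply hinj
    ext ξ
    have hne : (r : ℂ) + Complex.I * (ξ - t) ≠ 0 :=
      fun h ↦ hr.ne' (by simpa using congrArg Complex.re h)
    have hpi : (Real.pi : ℂ) ≠ 0 := by exact_mod_cast Real.pi_ne_zero
    simp only [FourierTransform.fourier_smul, FourierTransform.fourier_add, add_apply,
      smul_apply, hder, hFv, smul_eq_mul, hm]
    field_simp
    ring
  set c : ℂ := 2 * Real.pi * ((r : ℂ) - Complex.I * t) with hc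
  have hcre : 0 < c.re := by simp [hc]; positivity
  have hexp (x : ℝ) : HasDerivAt (fun x : ℝ ↦ Complex.exp (c * x)) (Complex.exp (c * x) * c) x := by
    have := ((hasDerivAt_id (x : ℂ)).const_mul c).cexp.comp_ofReal
    simpa using this
  have hw (x : ℝ) : HasDerivAt (fun x : ℝ ↦ Complex.exp (c * x) * v x)
      (Complex.exp (c * x) * c * v x + Complex.exp (c * x) * deriv v x) x :=
    (hexp x).mul (v.hasDerivAt x)
  have hconst : ∀ x < b, ∀ y < b, Complex.exp (c * x) * v x = Complex.exp (c * y) * v y := by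
    intro x hx y hy
    refine isOpen_Iio.is_const_of_deriv_eq_zero (𝕜 := ℝ) (s := Iio b)
      (f := fun x : ℝ ↦ Complex.exp (c * x) * v x) isPreconnected_Iio
      (fun x _ ↦ (hw x).differentiableAt.differentiableWithinAt) (fun z hz ↦ ?_) hx hy
    have hz' := DFunLike.congr_fun hode z
    simp only [add_apply, smul_apply, SchwartzMap.derivCLM_apply,
      smul_eq_mul, hf z hz, mul_zero] at hz'
    have hpi : (Real.pi : ℂ) ≠ 0 := by exact_mod_cast Real.pi_ne_zero
    rw [(hw z).deriv, Pi.zero_apply, mul_assoc, ← mul_add]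
    have : c * v z + deriv v z = 0 := by
      rw [hc]
      field_simp at hz'
      linear_combination -hz'
    rw [this, mul_zero]
  have hlim : Tendsto (fun x : ℝ ↦ Complex.exp (c * x) * v x) atBot (𝓝 0) := by
    have hb : Tendsto (fun x : ℝ ↦ Real.exp (c.re * x) * SchwartzMap.seminorm ℝ 0 0 v) atBot
        (𝓝 0) := by
      simpa using (Real.tendsto_exp_atBot.comp (tendsto_id.const_mul_atBot hcre)).mul_const
        (SchwartzMap.seminorm ℝ 0 0 v)
    refine squeeze_zero_norm (fun x ↦ ?_) hb
    rw [norm_mul, Complex.norm_exp]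
    simp only [Complex.re_mul_ofReal]
    gcongr
    exact v.norm_le_seminorm ℝ x
  intro x hx
  have : Complex.exp (c * x) * v x = 0 := by
    refine tendsto_nhds_unique (tendsto_const_nhds.congr' ?_) hlim
    filter_upwards [eventually_lt_atBot b] with y hy using hconst x hx y hy
  exact (mul_eq_zero.1 this).resolve_left (Complex.exp_ne_zero _)
/-- A function `m` is a causal multiplier at `b` if multiplication by `m` on the Fourier side
preserves the Schwartz functions that vanish to the left of `b`. -/
def IsCausalMultiplier (b : ℝ) (m : ℝ → ℂ) : Prop :=
  ∀ f : 𝓢(ℝ, ℂ), (∀ x < b, f x = 0) →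
    ∃ u : 𝓢(ℝ, ℂ), (∀ x < b, u x = 0) ∧ ∀ ξ : ℝ, 𝓕 u ξ = m ξ * 𝓕 f ξ

namespace IsCausalMultiplier

variable {b : ℝ} {m m' : ℝ → ℂ}

theorem one (b : ℝ) : IsCausalMultiplier b fun _ ↦ 1 :=
  fun f hf ↦ ⟨f, hf, fun _ ↦ (one_mul _).symm⟩

theorem sub (hm : IsCausalMultiplier b m) (hm' : IsCausalMultiplier b m') :
    IsCausalMultiplier b fun ξ ↦ m ξ - m' ξ := by
  intro f hf
  obtain ⟨u, hu, hFu⟩ := hm f hf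
  obtain ⟨v, hv, hFv⟩ := hm' f hf
  refine ⟨u + (-1 : ℂ) • v, fun x hx ↦ by simp [hu x hx, hv x hx], fun ξ ↦ ?_⟩
  rw [FourierTransform.fourier_add, FourierTransform.fourier_smul, add_apply, smul_apply, hFu, hFv]
  simp only [smul_eq_mul]
  ring

theorem mul (hm : IsCausalMultiplier b m) (hm' : IsCausalMultiplier b m') :
    IsCausalMultiplier b fun ξ ↦ m ξ * m' ξ := by
  intro f hf
  obtain ⟨v, hv, hFv⟩ := hm' f hf
  obtain ⟨u, hu, hFu⟩ := hm v hv
  exact ⟨u, hu, fun ξ ↦ by rw [hFu, hFv, mul_assoc]⟩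

theorem prod {ι : Type*} (s : Finset ι) {m : ι → ℝ → ℂ} (hm : ∀ i, IsCausalMultiplier b (m i)) :
    IsCausalMultiplier b fun ξ ↦ ∏ i ∈ s, m i ξ := by
  classical
  induction s using Finset.induction_on with
  | empty => simpa using one b
  | insert i s hi ih => simpa [Finset.prod_insert hi] using (hm i).mul ih

theorem resolvent {r : ℝ} (hr : 0 < r) (t b : ℝ) :
    IsCausalMultiplier b fun ξ : ℝ ↦ (r : ℂ) / (r + Complex.I * (ξ - t)) :=
  fun f hf ↦ f.exists_fourier_eq_resolvent_mul hr t b hf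

end IsCausalMultiplier

/-- A compact Lebesgue-null set of reals is covered by finitely many intervals of equal, arbitrarily
small radius and arbitrarily small total length. -/
theorem IsCompact.exists_finset_cover_of_volume_eq_zero {K : Set ℝ} (hK : IsCompact K)
    (h0 : volume K = 0) {δ : ℝ} (hδ : 0 < δ) :
    ∃ s : ℝ, 0 < s ∧ s ≤ δ ∧ ∃ T : Finset ℝ, T.card * s ≤ δ ∧
      (∀ x ∈ K, ∃ t ∈ T, |x - t| ≤ s) ∧ ∀ t ∈ T, ∃ x ∈ K, |x - t| ≤ s := by
  have hlim := tendsto_measure_cthickening_of_isCompact (μ := volume) hK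
  rw [h0] at hlim
  have hev : ∀ᶠ s in 𝓝[>] (0 : ℝ), volume (Metric.cthickening s K) < ENNReal.ofReal δ :=
    (hlim.mono_left nhdsWithin_le_nhds).eventually_lt_const (by simpa using hδ)
  obtain ⟨s, hs, ⟨hs0, hsδ⟩⟩ := (hev.and (Ioc_mem_nhdsGT hδ)).exists
  have hfin : ((fun x : ℝ ↦ ⌊x / s⌋) '' K).Finite := by
    obtain ⟨R, hR⟩ := hK.isBounded.subset_closedBall 0
    refine (Set.finite_Icc ⌊-R / s⌋ ⌊R / s⌋).subset ?_
    rintro _ ⟨x, hx, rfl⟩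
    have := hR hx
    rw [Real.closedBall_eq_Icc] at this
    exact ⟨Int.floor_mono (by gcongr; linarith [this.1]),
      Int.floor_mono (by gcongr; linarith [this.2])⟩
  have hcell {z : ℝ} {j : ℤ} : ⌊z / s⌋ = j ↔ z ∈ Ico (j * s) ((j + 1) * s) := by
    rw [Int.floor_eq_iff, le_div_iff₀ hs0, div_lt_iff₀ hs0, mem_Ico]
  classical
  refine ⟨s, hs0, hsδ, hfin.toFinset.image fun j : ℤ ↦ (j : ℝ) * s, ?_, fun x hx ↦ ?_, ?_⟩
  · have hvol : volume (⋃ j ∈ hfin.toFinset, Ico ((j : ℝ) * s) ((j + 1) * s)) =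
        ENNReal.ofReal (hfin.toFinset.card * s) := by
      rw [measure_biUnion_finset]
      · have (j : ℤ) : ((j : ℝ) + 1) * s - j * s = s := by ring
        simp [Real.volume_Ico, this, ENNReal.ofReal_mul]
      · intro i _ j _ hij
        refine Set.disjoint_left.2 fun z hi hj ↦ hij ?_
        rw [← hcell.2 hi, ← hcell.2 hj]
      · exact fun _ _ ↦ measurableSet_Ico
    have hsub : (⋃ j ∈ hfin.toFinset, Ico ((j : ℝ) * s) ((j + 1) * s)) ⊆
        Metric.cthickening s K := by
      refine iUnion₂_subset fun j hj z hz ↦ ?_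
      obtain ⟨x, hx, hxj⟩ := hfin.mem_toFinset.1 hj
      have hx' := hcell.1 hxj
      refine Metric.mem_cthickening_of_dist_le z x s K hx ?_
      rw [Real.dist_eq, abs_le]
      constructor <;> linarith [hz.1, hz.2, hx'.1, hx'.2]
    have hle := (measure_mono hsub).trans hs.le
    rw [hvol, ENNReal.ofReal_le_ofReal_iff hδ.le] at hle
    refine le_trans ?_ hle
    gcongr
    exact Finset.card_image_le
  · refine ⟨⌊x / s⌋ * s, Finset.mem_image_of_mem _ (hfin.mem_toFinset.2 ⟨x, hx, rfl⟩), ?_⟩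
    have hx' := hcell.1 (rfl : ⌊x / s⌋ = ⌊x / s⌋)
    rw [abs_le]
    constructor <;> linarith [hx'.1, hx'.2]
  · intro t ht
    obtain ⟨j, hj, rfl⟩ := Finset.mem_image.1 ht
    obtain ⟨x, hx, hxj⟩ := hfin.mem_toFinset.1 hj
    have hx' := hcell.1 hxj
    refine ⟨x, hx, ?_⟩
    rw [abs_le]
    constructor <;> linarith [hx'.1, hx'.2]

theorem Finset.norm_one_sub_prod_le {ι : Type*} (s : Finset ι) {b : ι → ℂ} (hb : ∀ i, ‖b i‖ ≤ 1) :
    ‖1 - ∏ i ∈ s, b i‖ ≤ ∑ i ∈ s, ‖1 - b i‖ := by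
  classical
  induction s using Finset.induction_on with
  | empty => simp
  | insert i s hi ih =>
    rw [Finset.prod_insert hi, Finset.sum_insert hi]
    calc ‖1 - b i * ∏ j ∈ s, b j‖ = ‖(1 - b i) + b i * (1 - ∏ j ∈ s, b j)‖ := by ring_nf
      _ ≤ ‖1 - b i‖ + ‖b i‖ * ‖1 - ∏ j ∈ s, b j‖ := (norm_add_le _ _).trans (by rw [norm_mul])
      _ ≤ _ := by
        gcongr
        exact (mul_le_of_le_one_left (norm_nonneg _) (hb i)).trans ih

theorem sq_norm_ofReal_add_I_mul (r y : ℝ) : ‖(r : ℂ) + Complex.I * y‖ ^ 2 = r ^ 2 + y ^ 2 := by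
  rw [mul_comm, ← Complex.normSq_eq_norm_sq, Complex.normSq_add_mul_I]

theorem sq_norm_one_sub_resolvent {r : ℝ} (hr : 0 < r) (t ξ : ℝ) :
    ‖1 - (r : ℂ) / (r + Complex.I * (ξ - t))‖ ^ 2 = (ξ - t) ^ 2 / (r ^ 2 + (ξ - t) ^ 2) := by
  have hne : (r : ℂ) + Complex.I * (ξ - t) ≠ 0 :=
    fun h ↦ hr.ne' (by simpa using congrArg Complex.re h)
  have hsq := sq_norm_ofReal_add_I_mul r (ξ - t)
  push_cast at hsq
  rw [one_sub_div hne, add_sub_cancel_left, norm_div, div_pow, hsq, norm_mul, Complex.norm_I,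
    one_mul, ← Complex.ofReal_sub, Complex.norm_real, Real.norm_eq_abs, sq_abs]

theorem norm_resolvent_le {r : ℝ} (hr : 0 < r) {t ξ d : ℝ} (hd : 0 < d) (h : d ≤ |ξ - t|) :
    ‖(r : ℂ) / (r + Complex.I * (ξ - t))‖ ≤ r / d := by
  have hsq := sq_norm_ofReal_add_I_mul r (ξ - t)
  push_cast at hsq
  rw [norm_div, Complex.norm_real, Real.norm_of_nonneg hr.le]
  gcongr
  exact h.trans (abs_le_of_sq_le_sq (by nlinarith) (norm_nonneg _))

/-- The indicator of a compact Lebesgue-null set is a bounded pointwise limit of causal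
multipliers. -/
theorem IsCompact.exists_isCausalMultiplier_tendsto_indicator {K : Set ℝ} (hK : IsCompact K)
    (h0 : volume K = 0) :
    ∃ G : ℕ → ℝ → ℂ, (∀ n b, IsCausalMultiplier b (G n)) ∧ (∀ n ξ, ‖G n ξ‖ ≤ 2) ∧
      ∀ ξ, Tendsto (fun n ↦ G n ξ) atTop (𝓝 (K.indicator 1 ξ)) := by
  have hδ (n : ℕ) : (0 : ℝ) < ((n + 1 : ℝ) ^ 2)⁻¹ := by positivity
  choose s hs hsδ T hcard hcov hnear using fun n ↦
    hK.exists_finset_cover_of_volume_eq_zero h0 (hδ n)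
  set c : ℕ → ℝ → ℝ → ℂ := fun n t ξ ↦ (s n : ℂ) / (s n + Complex.I * (ξ - t)) with hc
  set B : ℕ → ℝ → ℂ := fun n ξ ↦ ∏ t ∈ T n, (1 - c n t ξ) with hB
  have hc1 (n : ℕ) (t ξ : ℝ) : ‖1 - c n t ξ‖ ≤ 1 := by
    rw [← sq_le_one_iff₀ (norm_nonneg _), sq_norm_one_sub_resolvent (hs n)]
    exact div_le_one_of_le₀ (by nlinarith [hs n]) (by positivity)
  have hB1 (n : ℕ) (ξ : ℝ) : ‖B n ξ‖ ≤ 1 := by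
    rw [hB, norm_prod]
    exact Finset.prod_le_one (fun _ _ ↦ norm_nonneg _) fun t _ ↦ hc1 n t ξ
  refine ⟨fun n ξ ↦ 1 - ∏ _i ∈ Finset.range n, B n ξ, fun n b ↦ ?_, fun n ξ ↦ ?_, fun ξ ↦ ?_⟩
  · exact (IsCausalMultiplier.one b).sub <| .prod _ fun _ ↦ .prod _ fun t ↦
      (IsCausalMultiplier.one b).sub (.resolvent (hs n) t b)
  · refine (norm_sub_le _ _).trans ?_
    rw [norm_one, norm_prod]
    have := Finset.prod_le_one (s := Finset.range n) (f := fun _ ↦ ‖B n ξ‖)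
      (fun _ _ ↦ norm_nonneg _) fun _ _ ↦ hB1 n ξ
    linarith
  · by_cases hξ : ξ ∈ K
    · have hlim : Tendsto (fun n ↦ ∏ _i ∈ Finset.range n, B n ξ) atTop (𝓝 0) := by
        refine squeeze_zero_norm (fun n ↦ ?_) (tendsto_pow_atTop_nhds_zero_of_lt_one
          (r := (3 / 4 : ℝ)) (by norm_num) (by norm_num))
        rw [Finset.prod_const, Finset.card_range, norm_pow]
        gcongr
        obtain ⟨t, ht, hξt⟩ := hcov n ξ hξ
        rw [hB]
        dsimp only
        rw [← Finset.mul_prod_erase _ _ ht, norm_mul]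
        refine (mul_le_of_le_one_right (norm_nonneg _) ?_).trans ?_
        · rw [norm_prod]
          exact Finset.prod_le_one (fun _ _ ↦ norm_nonneg _) fun t _ ↦ hc1 n t ξ
        · refine abs_le_of_sq_le_sq' ?_ (by norm_num) |>.2
          rw [sq_norm_one_sub_resolvent (hs n), div_le_iff₀ (by nlinarith [hs n])]
          have := sq_le_sq' (by linarith [(abs_le.1 hξt).1]) (abs_le.1 hξt).2
          nlinarith
      simpa [hξ] using hlim.const_sub 1
    · rw [Set.indicator_of_notMem hξ]
      obtain ⟨d, hd, hball⟩ := Metric.isOpen_iff.1 hK.isClosed.isOpen_compl ξ hξ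
      have hlim : Tendsto (fun n : ℕ ↦ 2 / d * (1 / ((n : ℝ) + 1))) atTop (𝓝 0) := by
        simpa using tendsto_one_div_add_atTop_nhds_zero_nat.const_mul (2 / d)
      have hsmall : ∀ᶠ n : ℕ in atTop, 1 / ((n : ℝ) + 1) ≤ d / 2 :=
        (tendsto_one_div_add_atTop_nhds_zero_nat.eventually_le_const (by positivity))
      refine squeeze_zero_norm' ?_ hlim
      filter_upwards [hsmall] with n hn
      have hn1 : ((n + 1 : ℝ) ^ 2)⁻¹ ≤ 1 / ((n : ℝ) + 1) := by
        rw [← one_div]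
        gcongr
        nlinarith [(n.cast_nonneg : (0 : ℝ) ≤ n)]
      have hfar (t : ℝ) (ht : t ∈ T n) : d / 2 ≤ |ξ - t| := by
        obtain ⟨x, hx, hxt⟩ := hnear n t ht
        have h1 : d ≤ |ξ - x| := by
          by_contra! hlt
          exact hball (Metric.mem_ball'.2 hlt) hx
        have h2 : |ξ - x| ≤ |ξ - t| + |t - x| := abs_sub_le _ _ _
        rw [abs_sub_comm] at hxt
        linarith [hsδ n]
      calc ‖1 - ∏ _i ∈ Finset.range n, B n ξ‖
          ≤ ∑ _i ∈ Finset.range n, ‖1 - B n ξ‖ :=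
            Finset.norm_one_sub_prod_le _ fun _ ↦ hB1 n ξ
        _ = n * ‖1 - B n ξ‖ := by simp
        _ ≤ n * ∑ t ∈ T n, ‖c n t ξ‖ := by
          gcongr
          simpa using Finset.norm_one_sub_prod_le (T n) fun t ↦ hc1 n t ξ
        _ ≤ n * ∑ t ∈ T n, s n / (d / 2) := by
          gcongr with t ht
          exact norm_resolvent_le (hs n) (by positivity) (hfar t ht)
        _ = 2 / d * (n * ((T n).card * s n)) := by
          rw [Finset.sum_const, nsmul_eq_mul]
          field_simp
        _ ≤ 2 / d * ((n + 1) * ((n + 1 : ℝ) ^ 2)⁻¹) := by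
          gcongr
          · exact mul_nonneg (Nat.cast_nonneg _) (hs n).le
          · linarith
          · exact hcard n
        _ = 2 / d * (1 / ((n : ℝ) + 1)) := by
          field_simp
/-- An `L²` bound for the pairing of a tempered complex measure with Fourier transforms of test
functions on `(a, ∞)` extends to Schwartz functions supported in `[b, ∞)`, `a < b`. -/
theorem SchwartzMap.sq_norm_integral_fourier_mul_le {ν : Measure ℝ} [ν.HasTemperateGrowth]
    {h : ℝ → ℂ} (hmeas : Measurable h) (hmod : ∀ ξ, ‖h ξ‖ = 1) {a b C : ℝ} (hab : a < b)
    (hC : 0 ≤ C)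
    (hbound : ∀ φ : ℝ → ℂ, ContDiff ℝ ∞ φ → HasCompactSupport φ → tsupport φ ⊆ Ioi a →
      ‖∫ ξ, 𝓕 φ ξ * h ξ ∂ν‖ ^ 2 ≤ C * ∫ x, ‖φ x‖ ^ 2)
    (f : 𝓢(ℝ, ℂ)) (hf : ∀ x < b, f x = 0) :
    ‖∫ ξ, 𝓕 f ξ * h ξ ∂ν‖ ^ 2 ≤ C * ∫ x, ‖f x‖ ^ 2 := by
  let β : ContDiffBump (0 : ℝ) := ⟨1, 2, one_pos, one_lt_two⟩
  have hβs : HasCompactSupport fun x ↦ (β x : ℂ) :=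
    β.hasCompactSupport.comp_left Complex.ofReal_zero
  let χ : 𝓢(ℝ, ℂ) := hβs.toSchwartzMap (Complex.ofRealCLM.contDiff.comp β.contDiff)
  have hχ (x : ℝ) : χ x = β x := rfl
  have hχ1 (x : ℝ) : ‖χ x‖ ≤ 1 := by
    rw [hχ, Complex.norm_real, Real.norm_of_nonneg β.nonneg]
    exact β.le_one
  let ε : ℕ → ℝ := fun n ↦ 1 / ((n : ℝ) + 1)
  have hε0 (n : ℕ) : 0 < ε n := by positivity
  have hε1 (n : ℕ) : ε n ≤ 1 := by
    simp only [ε]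
    rw [div_le_one (by positivity)]
    linarith [(n.cast_nonneg : (0 : ℝ) ≤ n)]
  have hεlim : Tendsto ε atTop (𝓝 0) := tendsto_one_div_add_atTop_nhds_zero_nat
  let φ : ℕ → ℝ → ℂ := fun n x ↦ χ (ε n * x) * f x
  have hφi (n : ℕ) : Integrable (φ n) := χ.integrable_comp_mul_mul f (ε n)
  have hφle (n : ℕ) (x : ℝ) : ‖φ n x‖ ≤ ‖f x‖ := by
    rw [norm_mul]
    exact mul_le_of_le_one_left (norm_nonneg _) (hχ1 _)
  have hφlim (x : ℝ) : Tendsto (fun n ↦ φ n x) atTop (𝓝 (f x)) := by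
    have h1 : Tendsto (fun n ↦ χ (ε n * x)) atTop (𝓝 (χ 0)) :=
      (χ.continuous.tendsto 0).comp (by simpa using hεlim.mul_const x)
    have h2 : χ 0 = 1 := by
      rw [hχ, β.one_of_mem_closedBall (Metric.mem_closedBall_self β.rIn_pos.le)]
      simp
    simpa [h2] using h1.mul_const (f x)
  have hφsm (n : ℕ) : ContDiff ℝ ∞ (φ n) :=
    ((χ.smooth ⊤).comp (contDiff_const.mul contDiff_id)).mul (f.smooth ⊤)
  have hφcs (n : ℕ) : HasCompactSupport (φ n) := by
    refine HasCompactSupport.intro (isCompact_closedBall 0 (2 / ε n)) fun x hx ↦ ?_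
    have hx' : 2 < ε n * |x| := by
      rw [Metric.mem_closedBall, dist_zero_right, Real.norm_eq_abs, not_le,
        div_lt_iff₀ (hε0 n)] at hx
      linarith
    have : β (ε n * x) = 0 := β.zero_of_le_dist (by
      rw [dist_zero_right, norm_mul, Real.norm_of_nonneg (hε0 n).le, Real.norm_eq_abs]
      exact hx'.le)
    simp [φ, hχ, this]
  have hφts (n : ℕ) : tsupport (φ n) ⊆ Ioi a := by
    refine (closure_minimal (fun x hx ↦ ?_) isClosed_Ici : tsupport (φ n) ⊆ Ici b).trans
      (Ici_subset_Ioi.2 hab)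
    by_contra hxb
    exact hx (by simp [φ, hf x (not_le.1 hxb)])
  have hF (ξ : ℝ) : Tendsto (fun n ↦ 𝓕 (φ n) ξ) atTop (𝓝 (𝓕 f ξ)) := by
    simp only [SchwartzMap.fourier_coe, Real.fourier_eq]
    refine tendsto_integral_of_dominated_convergence (fun x ↦ ‖f x‖) (fun n ↦ ?_)
      f.integrable.norm (fun n ↦ .of_forall fun x ↦ ?_) (.of_forall fun x ↦ ?_)
    · exact ((Real.fourierIntegral_convergent_iff ξ).2 (hφi n)).aestronglyMeasurable
    · rw [Circle.norm_smul]
      exact hφle n x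
    · exact (hφlim x).const_smul _
  obtain ⟨C₁, hC₁⟩ := SchwartzMap.exists_pow_mul_norm_fourier_comp_mul_mul_le 0 χ f
  obtain ⟨C₂, hC₂⟩ := SchwartzMap.exists_pow_mul_norm_fourier_comp_mul_mul_le
    (0 + ν.integrablePower) χ f
  have hI : Tendsto (fun n ↦ ∫ ξ, 𝓕 (φ n) ξ * h ξ ∂ν) atTop (𝓝 (∫ ξ, 𝓕 f ξ * h ξ ∂ν)) := by
    refine tendsto_integral_of_dominated_convergence _ (fun n ↦ ?_)
      ((Measure.integrable_pow_neg_integrablePower ν).const_mul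
        (2 ^ ν.integrablePower * (C₁ + C₂)))
      (fun n ↦ .of_forall fun ξ ↦ ?_) (.of_forall fun ξ ↦ (hF ξ).mul_const _)
    · have : Continuous (𝓕 (φ n)) := (𝓕 ((hφcs n).toSchwartzMap (hφsm n))).continuous
      exact (this.measurable.mul hmeas).aestronglyMeasurable
    · rw [norm_mul, hmod, mul_one]
      have := pow_mul_le_of_le_of_pow_mul_le (k := 0) (norm_nonneg ξ)
        (norm_nonneg (𝓕 (φ n) ξ)) (by simpa using hC₁ (ε n) (hε0 n).le (hε1 n) ξ)
        (hC₂ (ε n) (hε0 n).le (hε1 n) ξ)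
      simpa using this
  refine le_of_tendsto (hI.norm.pow 2) (.of_forall fun n ↦ ?_)
  refine (hbound (φ n) (hφsm n) (hφcs n) (hφts n)).trans ?_
  have hint (g : 𝓢(ℝ, ℂ)) : Integrable fun x ↦ ‖g x‖ ^ 2 :=
    (memLp_two_iff_integrable_sq_norm g.continuous.aestronglyMeasurable).1 (g.memLp 2)
  refine mul_le_mul_of_nonneg_left (integral_mono
    (hint ((hφcs n).toSchwartzMap (hφsm n))) (hint f) fun x ↦ ?_) hC
  exact pow_le_pow_left₀ (norm_nonneg _) (hφle n x) 2

theorem setIntegral_fourier_mul_eq_zero_of_isCompact {ν : Measure ℝ} [ν.HasTemperateGrowth]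
    {h : ℝ → ℂ} (hmeas : Measurable h) (hmod : ∀ ξ, ‖h ξ‖ = 1) {b C : ℝ}
    (hbound : ∀ f : 𝓢(ℝ, ℂ), (∀ x < b, f x = 0) →
      ‖∫ ξ, 𝓕 f ξ * h ξ ∂ν‖ ^ 2 ≤ C * ∫ x, ‖f x‖ ^ 2)
    (f : 𝓢(ℝ, ℂ)) (hf : ∀ x < b, f x = 0) {K : Set ℝ} (hK : IsCompact K) (h0 : volume K = 0) :
    ∫ ξ in K, 𝓕 f ξ * h ξ ∂ν = 0 := by
  obtain ⟨G, hG, hG2, hGlim⟩ := hK.exists_isCausalMultiplier_tendsto_indicator h0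
  choose u hu hFu using fun n ↦ hG n b f hf
  have hint : Integrable (fun ξ ↦ 2 * ‖𝓕 f ξ‖) ν := (𝓕 f).integrable.norm.const_mul 2
  have hint2 : Integrable fun ξ ↦ (2 * ‖𝓕 f ξ‖) ^ 2 := by
    simp only [mul_pow]
    exact ((memLp_two_iff_integrable_sq_norm (𝓕 f).continuous.aestronglyMeasurable).1
      ((𝓕 f).memLp 2)).const_mul _
  have hFle (n : ℕ) (ξ : ℝ) : ‖𝓕 (u n) ξ‖ ≤ 2 * ‖𝓕 f ξ‖ := by
    rw [hFu, norm_mul]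
    gcongr
    exact hG2 n ξ
  have hFlim (ξ : ℝ) : Tendsto (fun n ↦ 𝓕 (u n) ξ) atTop (𝓝 (K.indicator (fun η ↦ 𝓕 f η) ξ)) := by
    simp only [hFu]
    convert (hGlim ξ).mul_const (𝓕 f ξ) using 2
    by_cases hξ : ξ ∈ K <;> simp [hξ]
  have hlim1 : Tendsto (fun n ↦ ∫ ξ, 𝓕 (u n) ξ * h ξ ∂ν) atTop
      (𝓝 (∫ ξ in K, 𝓕 f ξ * h ξ ∂ν)) := by
    rw [← integral_indicator hK.measurableSet]
    refine tendsto_integral_of_dominated_convergence _ (fun n ↦ ?_) hint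
      (fun n ↦ .of_forall fun ξ ↦ ?_) (.of_forall fun ξ ↦ ?_)
    · exact ((𝓕 (u n)).continuous.measurable.mul hmeas).aestronglyMeasurable
    · rw [norm_mul, hmod, mul_one]
      exact hFle n ξ
    · rw [Set.indicator_mul_left]
      exact (hFlim ξ).mul_const _
  have hlim2 : Tendsto (fun n ↦ ∫ x, ‖u n x‖ ^ 2) atTop (𝓝 0) := by
    rw [show (fun n ↦ ∫ x, ‖u n x‖ ^ 2) = fun n ↦ ∫ ξ, ‖𝓕 (u n) ξ‖ ^ 2 from
      funext fun n ↦ ((u n).integral_norm_sq_fourier).symm]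
    have hz : ∫ ξ, ‖K.indicator (fun η ↦ 𝓕 f η) ξ‖ ^ 2 = 0 := by
      refine integral_eq_zero_of_ae ?_
      filter_upwards [measure_eq_zero_iff_ae_notMem.1 h0] with ξ hξ
      simp [hξ]
    rw [← hz]
    refine tendsto_integral_of_dominated_convergence _ (fun n ↦ ?_) hint2
      (fun n ↦ .of_forall fun ξ ↦ ?_) (.of_forall fun ξ ↦ ((hFlim ξ).norm.pow 2))
    · exact ((𝓕 (u n)).continuous.norm.pow 2).aestronglyMeasurable
    · rw [Real.norm_of_nonneg (by positivity)]
      gcongr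
      exact hFle n ξ
  have hle := le_of_tendsto_of_tendsto (hlim1.norm.pow 2) (hlim2.const_mul C)
    (.of_forall fun n ↦ hbound (u n) (hu n))
  rw [mul_zero] at hle
  simpa using le_antisymm hle (by positivity)

theorem SchwartzMap.exists_vanishing_left_fourier_ne_zero (b ξ : ℝ) :
    ∃ f : 𝓢(ℝ, ℂ), (∀ x < b, f x = 0) ∧ 𝓕 f ξ ≠ 0 := by
  let β : ContDiffBump (b + 2) := ⟨1, 2, one_pos, one_lt_two⟩
  have hs : HasCompactSupport fun x : ℝ ↦
      (β x : ℂ) * Complex.exp (((2 * Real.pi * (x * ξ) : ℝ) : ℂ) * Complex.I) :=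
    (β.hasCompactSupport.comp_left Complex.ofReal_zero).mul_right
  have hsm : ContDiff ℝ ∞ fun x : ℝ ↦
      (β x : ℂ) * Complex.exp (((2 * Real.pi * (x * ξ) : ℝ) : ℂ) * Complex.I) := by
    refine (Complex.ofRealCLM.contDiff.comp β.contDiff).mul
      (ContDiff.cexp (ContDiff.mul (Complex.ofRealCLM.contDiff.comp
        (contDiff_const.mul (contDiff_id.mul contDiff_const))) contDiff_const))
  refine ⟨hs.toSchwartzMap hsm, fun x hx ↦ ?_, ?_⟩
  · have : β x = 0 := β.zero_of_le_dist (by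
      rw [Real.dist_eq, abs_sub_comm]
      exact le_trans (by linarith) (le_abs_self _))
    simp [this]
  · rw [SchwartzMap.fourier_coe, Real.fourier_real_eq_integral_exp_smul]
    have : ∫ x : ℝ, (β x : ℂ) ≠ 0 := by
      rw [integral_complex_ofReal]
      exact_mod_cast β.integral_pos.ne'
    refine ne_of_eq_of_ne (integral_congr_ae (.of_forall fun x ↦ ?_)) this
    change Complex.exp (((-2 * Real.pi * x * ξ : ℝ) : ℂ) * Complex.I) *
      ((β x : ℂ) * Complex.exp (((2 * Real.pi * (x * ξ) : ℝ) : ℂ) * Complex.I)) = β x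
    rw [mul_left_comm, ← Complex.exp_add, ← add_mul, ← Complex.ofReal_add,
      show -2 * Real.pi * x * ξ + 2 * Real.pi * (x * ξ) = 0 by ring]
    simp

theorem MeasureTheory.Measure.HasTemperateGrowth.isLocallyFiniteMeasure {E : Type*}
    [NormedAddCommGroup E] [MeasurableSpace E] [OpensMeasurableSpace E] {ν : Measure E}
    [hν : ν.HasTemperateGrowth] : IsLocallyFiniteMeasure ν := by
  obtain ⟨n, hn⟩ := hν.exists_integrable
  refine ⟨fun x ↦ ⟨Metric.ball x 1, Metric.ball_mem_nhds x one_pos, ?_⟩⟩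
  refine (measure_mono fun y hy ↦ ?_).trans_lt
    (hn.measure_ge_lt_top (ε := (2 + ‖x‖) ^ (-(n : ℝ))) (by positivity))
  have hy' : ‖y‖ ≤ ‖x‖ + 1 := by
    have h1 : ‖y - x‖ < 1 := by simpa [dist_eq_norm] using hy
    have h2 := norm_le_norm_add_norm_sub x y
    rw [norm_sub_rev] at h2
    linarith
  exact Real.rpow_le_rpow_of_nonpos (by positivity) (by linarith) (by simp)

/-- The brothers Riesz theorem for a tempered complex measure `h ν` whose Fourier transform is
square-integrable on a half-line. -/
theorem absolutelyContinuous_of_sq_norm_integral_fourier_mul_le {ν : Measure ℝ}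
    [ν.HasTemperateGrowth] {h : ℝ → ℂ} (hmeas : Measurable h) (hmod : ∀ ξ, ‖h ξ‖ = 1) {a C : ℝ}
    (hC : 0 ≤ C)
    (hbound : ∀ φ : ℝ → ℂ, ContDiff ℝ ∞ φ → HasCompactSupport φ → tsupport φ ⊆ Ioi a →
      ‖∫ ξ, 𝓕 φ ξ * h ξ ∂ν‖ ^ 2 ≤ C * ∫ x, ‖φ x‖ ^ 2) :
    ν ≪ volume := by
  have : IsLocallyFiniteMeasure ν := Measure.HasTemperateGrowth.isLocallyFiniteMeasure
  have hcompact (K : Set ℝ) (hK : IsCompact K) (h0 : volume K = 0) : ν K = 0 := by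
    refine measure_null_of_locally_null K fun ξ hξ ↦ ?_
    obtain ⟨f, hf, hfξ⟩ := SchwartzMap.exists_vanishing_left_fourier_ne_zero (a + 1) ξ
    refine ⟨{η | 𝓕 f η ≠ 0} ∩ K, inter_mem (mem_nhdsWithin_of_mem_nhds
      ((isOpen_ne_fun (𝓕 f).continuous continuous_const).mem_nhds hfξ)) self_mem_nhdsWithin, ?_⟩
    · have hint : Integrable (fun η ↦ 𝓕 f η * h η) (ν.restrict K) :=
        ((𝓕 f).integrable.mul_bdd (c := 1) hmeas.aestronglyMeasurable
          (.of_forall fun η ↦ (hmod η).le)).integrableOn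
      have hae := ae_eq_zero_of_forall_setIntegral_isCompact_eq_zero hint fun S hS ↦ by
        rw [Measure.restrict_restrict hS.measurableSet]
        exact setIntegral_fourier_mul_eq_zero_of_isCompact hmeas hmod
          (fun f hf ↦ f.sq_norm_integral_fourier_mul_le hmeas hmod (lt_add_one a) hC hbound hf)
          f hf (hS.inter hK) (measure_mono_null inter_subset_right h0)
      rw [← Measure.restrict_apply' hK.measurableSet]
      refine measure_mono_null ?_ (ae_iff.1 hae)
      intro η hη h0
      have := hmod η
      have hh : h η ≠ 0 := fun h ↦ by simp [h] at this
      exact mul_ne_zero hη hh h0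
  refine Measure.AbsolutelyContinuous.mk fun s hs h0 ↦ ?_
  rw [hs.measure_eq_iSup_isCompact]
  simp only [ENNReal.iSup_eq_zero]
  exact fun K hKs hK ↦ hcompact K hK (measure_mono_null hKs h0)
theorem hasTemperateGrowth_map_const_mul {p : ℝ} (hp : 0 ≤ p) {μ : Measure ℝ}
    (hmom : ∫⁻ lam : ℝ, ENNReal.ofReal ((1 + lam ^ 2) ^ (-p)) ∂μ < ⊤) {c : ℝ} (hc : 0 < c) :
    (μ.map fun lam ↦ c * lam).HasTemperateGrowth := by
  let k : ℝ := max 1 c⁻¹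
  have hk : 0 < k := zero_lt_one.trans_le (le_max_left _ _)
  have hint : Integrable (fun lam : ℝ ↦ (1 + lam ^ 2) ^ (-p)) μ := by
    refine ⟨(by fun_prop : Measurable _).aestronglyMeasurable, ?_⟩
    rwa [hasFiniteIntegral_iff_ofReal (.of_forall fun lam ↦ by positivity)]
  refine ⟨⌈2 * p⌉₊, ?_⟩
  rw [integrable_map_measure (by fun_prop : Measurable _).aestronglyMeasurable (by fun_prop)]
  refine (hint.const_mul (k ^ (2 * p))).mono' (by fun_prop : Measurable _).aestronglyMeasurable
    (.of_forall fun lam ↦ ?_)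
  have h1 : 1 ≤ 1 + |c * lam| := by linarith [abs_nonneg (c * lam)]
  have h2 : 1 + lam ^ 2 ≤ (k * (1 + |c * lam|)) ^ 2 := by
    have h3 : |lam| ≤ k * |c * lam| := by
      rw [abs_mul, abs_of_pos hc]
      calc |lam| = c⁻¹ * (c * |lam|) := by field_simp
        _ ≤ _ := by gcongr; exact le_max_right _ _
    have h4 : (1 : ℝ) ≤ k := le_max_left _ _
    rw [← sq_abs lam]
    nlinarith [abs_nonneg lam]
  simp only [Function.comp_apply, Real.norm_eq_abs]
  rw [abs_of_nonneg (by positivity)]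
  calc (1 + |c * lam|) ^ (-(⌈2 * p⌉₊ : ℝ)) ≤ (1 + |c * lam|) ^ (-(2 * p)) :=
        Real.rpow_le_rpow_of_exponent_le h1 (neg_le_neg (Nat.le_ceil _))
    _ = k ^ (2 * p) * ((k * (1 + |c * lam|)) ^ 2) ^ (-p) := by
        rw [← Real.rpow_natCast _ 2, ← Real.rpow_mul (by positivity),
          Real.mul_rpow hk.le (by positivity), ← mul_assoc, ← Real.rpow_add hk]
        simp
    _ ≤ _ := by
        gcongr ?_ * ?_
        exact Real.rpow_le_rpow_of_nonpos (by positivity) h2 (by linarith)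

/-- Cauchy–Schwarz for `∫ f g`, when `f` is supported in `s` and `g` is square-integrable on
`s`. -/
theorem sq_norm_integral_mul_le_of_tsupport_subset {f g : ℝ → ℂ} {s : Set ℝ}
    (hf : MemLp f 2) (hfs : tsupport f ⊆ s)
    (hg : MemLp g 2 (volume.restrict s)) :
    ‖∫ x, f x * g x‖ ^ 2 ≤ (∫ x in s, ‖g x‖ ^ 2) * ∫ x, ‖f x‖ ^ 2 := by
  have hfs' (x : ℝ) (hx : x ∉ s) : f x = 0 := image_eq_zero_of_notMem_tsupport fun h ↦ hx (hfs h)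
  rw [← setIntegral_eq_integral_of_forall_compl_eq_zero (s := s) fun x hx ↦ by simp [hfs' x hx],
    ← setIntegral_eq_integral_of_forall_compl_eq_zero (s := s) (f := fun x ↦ ‖f x‖ ^ 2)
      fun x hx ↦ by simp [hfs' x hx]]
  have key := integral_mul_norm_le_Lp_mul_Lq (μ := volume.restrict s) (f := f) (g := g)
    Real.HolderConjugate.two_two (by simpa using hf.restrict s) (by simpa using hg)
  simp only [Real.rpow_two, ← Real.sqrt_eq_rpow] at key
  have h1 := (norm_integral_le_integral_norm (μ := volume.restrict s) fun x ↦ f x * g x)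
  simp only [norm_mul] at h1
  calc _ ≤ _ := pow_le_pow_left₀ (norm_nonneg _) (h1.trans key) 2
    _ = _ := by
      rw [mul_pow, Real.sq_sqrt (by positivity), Real.sq_sqrt (by positivity), mul_comm]
end

/-- Continuous analogue of the Riesz Brothers theorem: if the Fourier transform of a
complex measure `dM = h dμ` (with `|h| = 1`, so `μ` is the variation of `M`) of at most
polynomial growth coincides on a half-line `(a, ∞)` with a square-integrable function `g`,
then `μ` is absolutely continuous with respect to Lebesgue measure. The coincidence is
expressed by testing against all `φ ∈ C_c^∞((a,∞))`:
`∫ φ(x) g(x) dx = (2π)⁻¹ ∫ (∫ e^{-iλx} φ(x) dx) h(λ) dμ(λ)`. -/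
theorem continuous_riesz_brothers (p : ℝ) (hp : 0 ≤ p)
    (μ : Measure ℝ)
    (hmom : ∫⁻ lam : ℝ, ENNReal.ofReal ((1 + lam ^ 2) ^ (-p)) ∂μ < ⊤)
    (h : ℝ → ℂ) (hmeas : Measurable h) (hmod : ∀ lam : ℝ, ‖h lam‖ = 1)
    (a : ℝ) (g : ℝ → ℂ) (hgmeas : Measurable g)
    (hgL2 : ∫⁻ x in Ioi a, ENNReal.ofReal (‖g x‖ ^ 2) < ⊤)
    (hrepr : ∀ φ : ℝ → ℂ, ContDiff ℝ (⊤ : ℕ∞) φ → HasCompactSupport φ → tsupport φ ⊆ Ioi a →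
      ∫ x : ℝ, φ x * g x =
        (2 * Real.pi)⁻¹ *
          ∫ lam : ℝ, (∫ x : ℝ, Complex.exp (-(Complex.I * lam * x)) * φ x) * h lam ∂μ) :
    μ ≪ (volume : Measure ℝ) := by
  have hc : 0 < (2 * Real.pi)⁻¹ := by positivity
  let T : ℝ → ℝ := fun lam ↦ (2 * Real.pi)⁻¹ * lam
  have hT : MeasurableEmbedding T := measurableEmbedding_mulLeft₀ hc.ne'
  have : (μ.map T).HasTemperateGrowth := hasTemperateGrowth_map_const_mul hp hmom hc
  have hg : MemLp g 2 (volume.restrict (Ioi a)) := by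
    rw [memLp_two_iff_integrable_sq_norm hgmeas.aestronglyMeasurable]
    refine ⟨by fun_prop, ?_⟩
    rwa [hasFiniteIntegral_iff_ofReal (.of_forall fun x ↦ by positivity)]
  have hac : μ.map T ≪ volume := by
    refine absolutelyContinuous_of_sq_norm_integral_fourier_mul_le
      (h := fun ξ ↦ h (2 * Real.pi * ξ)) (a := a)
      (C := (2 * Real.pi) ^ 2 * ∫ x in Ioi a, ‖g x‖ ^ 2) (by fun_prop) (fun ξ ↦ hmod _)
      (by positivity) fun φ hφ hφc hφs ↦ ?_
    have hF (lam : ℝ) :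
        FourierTransform.fourier φ (T lam) = ∫ x : ℝ, Complex.exp (-(Complex.I * lam * x)) * φ x := by
      rw [Real.fourier_real_eq_integral_exp_smul]
      refine integral_congr_ae (.of_forall fun x ↦ ?_)
      simp only [T, smul_eq_mul]
      congr 2
      push_cast
      field_simp
    have hh (lam : ℝ) : h (2 * Real.pi * T lam) = h lam := by
      congr 1
      simp only [T]
      field_simp
    have hpair : ∫ ξ, FourierTransform.fourier φ ξ * h (2 * Real.pi * ξ) ∂(μ.map T) =
        (2 * Real.pi) * ∫ x, φ x * g x := by
      rw [hT.integral_map, hrepr φ hφ hφc hφs]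
      simp only [hF, hh]
      push_cast
      rw [mul_inv_cancel_left₀ (by simp [Real.pi_ne_zero])]
    rw [hpair, norm_mul, mul_pow, mul_assoc]
    refine mul_le_mul (by simp [abs_of_pos Real.pi_pos])
      (sq_norm_integral_mul_le_of_tsupport_subset
        (hφ.continuous.memLp_of_hasCompactSupport hφc) hφs hg) (by positivity) (by positivity)
  refine Measure.AbsolutelyContinuous.mk fun s hs h0 ↦ ?_
  have hs' : s = T ⁻¹' (T '' s) := (hT.injective.preimage_image s).symm
  rw [hs', ← hT.map_apply]
  refine hac ?_
  exact (Measure.addHaar_smul volume _ s).trans (by rw [h0, mul_zero])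
end

section
/- Let M be a nonnegative Borel measure on ℝ with ∫_ℝ (1+λ²)^{-p} dM(λ) < ∞ for some p > 0, and let C > 0. If (2π)^{-1} ∫_ℝ |∫_0^∞ e^{iλx} f(x) dx|² dM(λ) ≤ C ‖f‖²_{L²((0,∞))} for every f ∈ C_c^∞((0,∞)), then M(X) ≤ C |X| for every Borel set X ⊆ ℝ (|X| the Lebesgue measure); in particular M is absolutely continuous with bounded density. -/
open MeasureTheory Filter Set

open scoped FourierTransform SchwartzMap ContDiff Topology Manifold

/-- The Fourier transform `∫ e^{iλx} f(x) dx` in the normalization with angular frequency. -/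
noncomputable def angularFourier (f : ℝ → ℂ) (lam : ℝ) : ℂ :=
  ∫ x : ℝ, Complex.exp (Complex.I * lam * x) * f x

theorem norm_exp_I_mul_mul (lam x : ℝ) : ‖Complex.exp (Complex.I * lam * x)‖ = 1 := by
  rw [show Complex.I * lam * x = ((lam * x : ℝ) : ℂ) * Complex.I by push_cast; ring,
    Complex.norm_exp_ofReal_mul_I]

theorem angularFourier_eq_fourier (f : ℝ → ℂ) (lam : ℝ) :
    angularFourier f lam = 𝓕 f (lam * -(2 * Real.pi)⁻¹) := by
  rw [Real.fourier_real_eq_integral_exp_smul, angularFourier]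
  congr with x
  rw [smul_eq_mul]
  congr 2
  have : (Real.pi : ℂ) ≠ 0 := by exact_mod_cast Real.pi_ne_zero
  push_cast
  field_simp

theorem norm_angularFourier_comp_sub (f : ℝ → ℂ) (a lam : ℝ) :
    ‖angularFourier (fun x ↦ f (x - a)) lam‖ = ‖angularFourier f lam‖ := by
  have h : angularFourier (fun x ↦ f (x - a)) lam =
      Complex.exp (Complex.I * lam * a) * angularFourier f lam := by
    simp only [angularFourier]
    rw [← integral_const_mul, ← integral_add_right_eq_self _ a]
    congr with x
    rw [add_sub_cancel_right, ← mul_assoc, ← Complex.exp_add]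
    congr 2
    push_cast
    ring
  rw [h, norm_mul, norm_exp_I_mul_mul, one_mul]

/-- Dilation `x ↦ f (x * c)` of a Schwartz function. -/
noncomputable def SchwartzMap.dilate (c : ℝ) (hc : c ≠ 0) (f : 𝓢(ℝ, ℂ)) : 𝓢(ℝ, ℂ) :=
  SchwartzMap.compCLMOfContinuousLinearEquiv ℂ
    (ContinuousLinearEquiv.unitsEquivAut ℝ (Units.mk0 c hc)) f

theorem SchwartzMap.dilate_apply (c : ℝ) (hc : c ≠ 0) (f : 𝓢(ℝ, ℂ)) (x : ℝ) :
    f.dilate c hc x = f (x * c) := rfl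

theorem neg_two_pi_inv_ne_zero : -(2 * Real.pi)⁻¹ ≠ 0 :=
  neg_ne_zero.mpr (inv_ne_zero (by positivity))

theorem SchwartzMap.angularFourier_eq (f : 𝓢(ℝ, ℂ)) :
    angularFourier f = (𝓕 f).dilate (-(2 * Real.pi)⁻¹) neg_two_pi_inv_ne_zero := by
  ext lam
  rw [angularFourier_eq_fourier, SchwartzMap.dilate_apply, SchwartzMap.fourier_coe]

theorem MeasureTheory.MemLp.lintegral_enorm_sq {α : Type*} [MeasurableSpace α] {μ : Measure α}
    {f : α → ℂ} (hf : MemLp f 2 μ) :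
    ∫⁻ x, ‖f x‖ₑ ^ 2 ∂μ = ENNReal.ofReal (∫ x, ‖f x‖ ^ 2 ∂μ) := by
  rw [ofReal_integral_eq_lintegral_ofReal ((memLp_two_iff_integrable_sq_norm hf.1).mp hf)
    (.of_forall fun x ↦ by positivity)]
  simp_rw [ENNReal.ofReal_pow (norm_nonneg _), ofReal_norm]

theorem hasTemperateGrowth_of_lintegral_rpow_lt_top {M : Measure ℝ} {p : ℝ} (hp : 0 < p)
    (hmom : ∫⁻ lam : ℝ, ENNReal.ofReal ((1 + lam ^ 2) ^ (-p)) ∂M < ⊤) :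
    M.HasTemperateGrowth := by
  obtain ⟨n, hn⟩ := exists_nat_ge (2 * p)
  have hInt : Integrable (fun x : ℝ ↦ (1 + x ^ 2) ^ (-p)) M := by
    refine ⟨Measurable.aestronglyMeasurable (by fun_prop), ?_⟩
    rw [hasFiniteIntegral_iff_ofReal (.of_forall fun x ↦ by positivity)]
    exact hmom
  refine ⟨n, hInt.mono' (Measurable.aestronglyMeasurable (by fun_prop)) (.of_forall fun x ↦ ?_)⟩
  have h1 : 1 ≤ 1 + |x| := by linarith [abs_nonneg x]
  rw [Real.norm_of_nonneg (by positivity), Real.norm_eq_abs]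
  calc (1 + |x|) ^ (-(n : ℝ)) ≤ (1 + |x|) ^ (2 * -p) :=
        Real.rpow_le_rpow_of_exponent_le h1 (by linarith)
    _ = ((1 + |x|) ^ 2) ^ (-p) := by
        rw [Real.rpow_mul (by positivity), Real.rpow_two]
    _ ≤ (1 + x ^ 2) ^ (-p) :=
        Real.rpow_le_rpow_of_nonpos (by positivity)
          (by nlinarith [abs_nonneg x, sq_abs x]) (by linarith)

theorem IsTestHalf.setIntegral_Ioi_eq {f : ℝ → ℂ} (hf : IsTestHalf f) {E : Type*}
    [NormedAddCommGroup E] [NormedSpace ℝ E] {g : ℝ → E} (hg : ∀ x, f x = 0 → g x = 0) :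
    ∫ x in Ioi (0 : ℝ), g x = ∫ x, g x :=
  setIntegral_eq_integral_of_forall_compl_eq_zero fun x hx ↦
    hg x (image_eq_zero_of_notMem_tsupport fun h ↦ hx (hf.2.2 h))

theorem exists_isTestHalf_comp_sub {f : ℝ → ℂ} (hf : ContDiff ℝ ∞ f) (hc : HasCompactSupport f) :
    ∃ a : ℝ, IsTestHalf fun x ↦ f (x - a) := by
  obtain ⟨b, hb⟩ := hc.isCompact.bddBelow
  have hcl : tsupport (fun x ↦ f (x - (1 - b))) ⊆ (fun x ↦ x - (1 - b)) ⁻¹' tsupport f :=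
    closure_minimal (fun x hx ↦ subset_tsupport f hx)
      ((isClosed_tsupport f).preimage (by fun_prop))
  refine ⟨1 - b, hf.comp (by fun_prop), hc.comp_homeomorph (Homeomorph.subRight (1 - b)),
    fun x hx ↦ ?_⟩
  have := hb (hcl hx)
  simp only [mem_Ioi] at this ⊢
  linarith

section

variable {M : Measure ℝ} {C : ℝ}

/-- The quadratic form bound on test functions of the half-line, freed from the support
condition by translation invariance. -/
theorem lintegral_angularFourier_le_of_hasCompactSupport [M.HasTemperateGrowth]
    (hbound : ∀ f : ℝ → ℂ, IsTestHalf f →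
      (2 * Real.pi)⁻¹ *
          (∫ lam : ℝ, ‖∫ x in Ioi (0 : ℝ), Complex.exp (Complex.I * lam * x) * f x‖ ^ 2 ∂M) ≤
        C * ∫ x in Ioi (0 : ℝ), ‖f x‖ ^ 2)
    {f : ℝ → ℂ} (hf : ContDiff ℝ ∞ f) (hc : HasCompactSupport f) :
    ∫⁻ lam, ‖angularFourier f lam‖ₑ ^ 2 ∂M ≤
      ENNReal.ofReal (2 * Real.pi * C * ∫ x, ‖f x‖ ^ 2) := by
  obtain ⟨a, ha⟩ := exists_isTestHalf_comp_sub hf hc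
  have key := hbound _ ha
  rw [ha.setIntegral_Ioi_eq (fun x hx ↦ by simp [hx]),
    integral_sub_right_eq_self (fun x ↦ ‖f x‖ ^ 2) a] at key
  have hF : ∀ lam : ℝ,
      ‖∫ x in Ioi (0 : ℝ), Complex.exp (Complex.I * lam * x) * f (x - a)‖ =
        ‖angularFourier f lam‖ := fun lam ↦ by
    rw [ha.setIntegral_Ioi_eq (fun x hx ↦ by simp [hx]), ← norm_angularFourier_comp_sub f a]
    rfl
  simp_rw [hF] at key
  have hmem : MemLp (angularFourier f) 2 M := by
    have := (hc.toSchwartzMap hf).angularFourier_eq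
    rw [show (⇑(hc.toSchwartzMap hf) : ℝ → ℂ) = f from rfl] at this
    rw [this]
    exact SchwartzMap.memLp _ 2 M
  rw [hmem.lintegral_enorm_sq]
  apply ENNReal.ofReal_le_ofReal
  rwa [inv_mul_le_iff₀ (by positivity), ← mul_assoc] at key

/-- A Schwartz function is the limit of its smooth cutoffs, uniformly dominated by it. -/
theorem SchwartzMap.exists_hasCompactSupport_tendsto (f : 𝓢(ℝ, ℂ)) :
    ∃ F : ℕ → ℝ → ℂ, (∀ n, ContDiff ℝ ∞ (F n)) ∧ (∀ n, HasCompactSupport (F n)) ∧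
      (∀ n x, ‖F n x‖ ≤ ‖f x‖) ∧ ∀ x, Tendsto (fun n ↦ F n x) atTop (𝓝 (f x)) := by
  let χ : ContDiffBump (0 : ℝ) := ⟨1, 2, one_pos, one_lt_two⟩
  have hpos : ∀ n : ℕ, ((n : ℝ) + 1)⁻¹ ≠ 0 := fun n ↦ by positivity
  refine ⟨fun n x ↦ (χ (x * ((n : ℝ) + 1)⁻¹) : ℂ) * f x, fun n ↦ ?_, fun n ↦ ?_, fun n x ↦ ?_,
    fun x ↦ ?_⟩
  · exact (Complex.ofRealCLM.contDiff.comp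
      (χ.contDiff.comp (contDiff_id.mul contDiff_const))).mul (f.smooth ⊤)
  · have h : HasCompactSupport fun x : ℝ ↦ (χ (x * ((n : ℝ) + 1)⁻¹) : ℂ) :=
      (χ.hasCompactSupport.comp_homeomorph (Homeomorph.mulRight₀ _ (hpos n))).comp_left
        (g := Complex.ofReal) Complex.ofReal_zero
    exact h.mul_right
  · rw [norm_mul, Complex.norm_real, Real.norm_of_nonneg χ.nonneg]
    exact mul_le_of_le_one_left (norm_nonneg _) χ.le_one
  · have h0 : Tendsto (fun n : ℕ ↦ x * ((n : ℝ) + 1)⁻¹) atTop (𝓝 0) := by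
      simpa using tendsto_one_div_add_atTop_nhds_zero_nat.const_mul x
    have h1 : Tendsto (fun n : ℕ ↦ (χ (x * ((n : ℝ) + 1)⁻¹) : ℂ)) atTop (𝓝 1) := by
      have := (Complex.continuous_ofReal.comp χ.continuous).tendsto 0
      have h2 : χ 0 = 1 := χ.one_of_mem_closedBall (by simp [χ])
      simp only [Function.comp_apply, h2, Complex.ofReal_one] at this
      exact this.comp h0
    simpa using h1.mul_const (f x)

theorem SchwartzMap.lintegral_angularFourier_le (hC : 0 ≤ C)
    (h : ∀ f : ℝ → ℂ, ContDiff ℝ ∞ f → HasCompactSupport f →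
      ∫⁻ lam, ‖angularFourier f lam‖ₑ ^ 2 ∂M ≤ ENNReal.ofReal (C * ∫ x, ‖f x‖ ^ 2))
    (f : 𝓢(ℝ, ℂ)) :
    ∫⁻ lam, ‖angularFourier f lam‖ₑ ^ 2 ∂M ≤ ENNReal.ofReal (C * ∫ x, ‖f x‖ ^ 2) := by
  obtain ⟨F, hF, hFc, hFle, hFlim⟩ := f.exists_hasCompactSupport_tendsto
  have hlim : ∀ lam, Tendsto (fun n ↦ ‖angularFourier (F n) lam‖ₑ ^ 2) atTop
      (𝓝 (‖angularFourier f lam‖ₑ ^ 2)) := fun lam ↦ by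
    refine (ENNReal.continuous_pow 2).continuousAt.tendsto.comp
      (Tendsto.enorm (tendsto_integral_of_dominated_convergence (fun x ↦ ‖f x‖) (fun n ↦ ?_)
        f.integrable.norm (fun n ↦ .of_forall fun x ↦ ?_) (.of_forall fun x ↦ ?_)))
    · have := (hF n).continuous
      exact Continuous.aestronglyMeasurable (by fun_prop)
    · rw [norm_mul, norm_exp_I_mul_mul, one_mul]
      exact hFle n x
    · exact (hFlim x).const_mul _
  have hmeas : ∀ n, Measurable fun lam ↦ ‖angularFourier (F n) lam‖ₑ ^ 2 := fun n ↦ by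
    have hcont : Continuous (angularFourier (F n)) := by
      have := ((hFc n).toSchwartzMap (hF n)).angularFourier_eq
      rw [show (⇑((hFc n).toSchwartzMap (hF n)) : ℝ → ℂ) = F n from rfl] at this
      rw [this]
      exact SchwartzMap.continuous _
    exact (hcont.measurable.enorm).pow_const 2
  calc ∫⁻ lam, ‖angularFourier f lam‖ₑ ^ 2 ∂M
      = ∫⁻ lam, liminf (fun n ↦ ‖angularFourier (F n) lam‖ₑ ^ 2) atTop ∂M := by
        simp_rw [fun lam ↦ (hlim lam).liminf_eq]
    _ ≤ liminf (fun n ↦ ∫⁻ lam, ‖angularFourier (F n) lam‖ₑ ^ 2 ∂M) atTop :=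
        lintegral_liminf_le hmeas
    _ ≤ ENNReal.ofReal (C * ∫ x, ‖f x‖ ^ 2) := by
        refine liminf_le_of_frequently_le' (Frequently.of_forall fun n ↦
          (h _ (hF n) (hFc n)).trans (ENNReal.ofReal_le_ofReal
            (mul_le_mul_of_nonneg_left ?_ hC)))
        exact integral_mono_of_nonneg (.of_forall fun x ↦ by positivity)
          ((memLp_two_iff_integrable_sq_norm f.continuous.aestronglyMeasurable).mp (f.memLp 2))
          (.of_forall fun x ↦ pow_le_pow_left₀ (norm_nonneg _) (hFle n x) 2)

/-- Every Schwartz function is an angular Fourier transform, with Plancherel's identity. -/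
theorem SchwartzMap.exists_angularFourier_eq (g : 𝓢(ℝ, ℂ)) :
    ∃ f : 𝓢(ℝ, ℂ), angularFourier f = g ∧
      2 * Real.pi * ∫ x, ‖f x‖ ^ 2 = ∫ lam, ‖g lam‖ ^ 2 := by
  have hc : -(2 * Real.pi) ≠ 0 := neg_ne_zero.mpr (by positivity)
  refine ⟨𝓕⁻ (g.dilate (-(2 * Real.pi)) hc), ?_, ?_⟩
  · ext lam
    rw [SchwartzMap.angularFourier_eq, FourierTransform.fourier_fourierInv_eq,
      SchwartzMap.dilate_apply, SchwartzMap.dilate_apply, ← inv_neg, inv_mul_cancel_right₀ hc]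
  · rw [← SchwartzMap.integral_norm_sq_fourier, FourierTransform.fourier_fourierInv_eq]
    simp_rw [SchwartzMap.dilate_apply]
    rw [Measure.integral_comp_mul_right (fun x ↦ ‖g x‖ ^ 2), abs_inv, abs_neg,
      abs_of_pos (by positivity), smul_eq_mul, mul_inv_cancel_left₀ (by positivity)]

end

/-- If `M` is dominated by `c • volume` on squares of Schwartz functions, then `M K` is at most
`c * volume U` for every compact `K` and every open `U` containing it. -/
theorem measure_isCompact_le_of_lintegral_schwartz_le {M : Measure ℝ} {c : ENNReal}
    (h : ∀ g : 𝓢(ℝ, ℂ), ∫⁻ x, ‖g x‖ₑ ^ 2 ∂M ≤ c * ∫⁻ x, ‖g x‖ₑ ^ 2)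
    {K U : Set ℝ} (hK : IsCompact K) (hU : IsOpen U) (hKU : K ⊆ U) :
    M K ≤ c * volume U := by
  obtain ⟨L, hL, hKL, hLU⟩ := exists_compact_between hK hU hKU
  obtain ⟨φ, hφ1, hφ0, hφ⟩ := exists_contMDiffMap_one_nhds_of_subset_interior (n := ⊤) 𝓘(ℝ, ℝ)
    hK.isClosed hKL
  have hsmooth : ContDiff ℝ ∞ fun x ↦ (φ x : ℂ) :=
    Complex.ofRealCLM.contDiff.comp φ.contMDiff.contDiff
  have hcomp : HasCompactSupport fun x ↦ (φ x : ℂ) :=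
    HasCompactSupport.intro hL fun x hx ↦ by simp [hφ0 x hx]
  have hle : ∀ x, ‖(φ x : ℂ)‖ₑ ^ 2 ≤ U.indicator 1 x := fun x ↦ by
    by_cases hx : x ∈ L
    · rw [indicator_of_mem (hLU hx), Pi.one_apply]
      refine pow_le_one₀ zero_le ?_
      rw [← ofReal_norm, Complex.norm_real, Real.norm_of_nonneg (hφ x).1]
      exact ENNReal.ofReal_le_one.mpr (hφ x).2
    · simp [hφ0 x hx]
  calc M K = ∫⁻ x, K.indicator 1 x ∂M := (lintegral_indicator_one hK.measurableSet).symm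
    _ ≤ ∫⁻ x, ‖(φ x : ℂ)‖ₑ ^ 2 ∂M := lintegral_mono fun x ↦ by
        by_cases hx : x ∈ K
        · have h1 : φ x = 1 := hφ1.self_of_nhdsSet x hx
          simp [hx, h1]
        · simp [hx]
    _ ≤ c * ∫⁻ x, ‖(φ x : ℂ)‖ₑ ^ 2 := h (hcomp.toSchwartzMap hsmooth)
    _ ≤ c * ∫⁻ x, U.indicator 1 x := by gcongr with x; exact hle x
    _ = c * volume U := by rw [lintegral_indicator_one hU.measurableSet]

theorem measure_le_of_forall_isCompact_subset_isOpen {M : Measure ℝ} {c : ENNReal} (hc : c ≠ ⊤)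
    (h : ∀ K U : Set ℝ, IsCompact K → IsOpen U → K ⊆ U → M K ≤ c * volume U) (X : Set ℝ) :
    M X ≤ c * volume X := by
  have : IsFiniteMeasureOnCompacts M := ⟨fun K hK ↦ by
    obtain ⟨r, hr⟩ := hK.isBounded.subset_ball 0
    exact (h K _ hK Metric.isOpen_ball hr).trans_lt
      (ENNReal.mul_lt_top hc.lt_top measure_ball_lt_top)⟩
  have hopen : ∀ U : Set ℝ, IsOpen U → M U ≤ c * volume U := fun U hU ↦ by
    rw [hU.measure_eq_iSup_isCompact M]
    exact iSup₂_le fun K hKU ↦ iSup_le fun hK ↦ h K U hK hU hKU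
  have hreg : (c • (volume : Measure ℝ)).OuterRegular := Measure.OuterRegular.smul _ hc
  rw [← smul_eq_mul, ← Measure.smul_apply, X.measure_eq_iInf_isOpen (c • volume)]
  exact le_iInf₂ fun U hXU ↦ le_iInf fun hU ↦ (measure_mono hXU).trans (hopen U hU)

/-- If the Wiener–Hopf quadratic form of a nonnegative spectral measure `M` of at most
polynomial growth is bounded by `C ‖f‖²` on test functions supported in `(0,∞)`, then
`M(X) ≤ C |X|` for every Borel set `X`; in particular `M` is absolutely continuous with
a density bounded by `C`. -/
theorem wienerHopf_form_bounded_implies_bounded_density (M : Measure ℝ)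
    (p : ℝ) (hp : 0 < p)
    (hmom : ∫⁻ lam : ℝ, ENNReal.ofReal ((1 + lam ^ 2) ^ (-p)) ∂M < ⊤)
    (C : ℝ) (hC : 0 < C)
    (hbound : ∀ f : ℝ → ℂ, IsTestHalf f →
      (2 * Real.pi)⁻¹ *
          (∫ lam : ℝ, ‖∫ x in Ioi (0 : ℝ), Complex.exp (Complex.I * lam * x) * f x‖ ^ 2 ∂M) ≤
        C * ∫ x in Ioi (0 : ℝ), ‖f x‖ ^ 2) :
    ∀ X : Set ℝ, MeasurableSet X → M X ≤ ENNReal.ofReal C * volume X := by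
  have := hasTemperateGrowth_of_lintegral_rpow_lt_top hp hmom
  refine fun X _ ↦ measure_le_of_forall_isCompact_subset_isOpen ENNReal.ofReal_ne_top
    (fun K U hK hU hKU ↦ measure_isCompact_le_of_lintegral_schwartz_le (fun g ↦ ?_) hK hU hKU) X
  obtain ⟨f, hfg, hnorm⟩ := g.exists_angularFourier_eq
  have hle := f.lintegral_angularFourier_le (M := M) (C := 2 * Real.pi * C) (by positivity)
    fun _ ↦ lintegral_angularFourier_le_of_hasCompactSupport hbound
  rwa [hfg, mul_right_comm, hnorm, mul_comm, ENNReal.ofReal_mul hC.le,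
    ← (g.memLp 2 volume).lintegral_enorm_sq] at hle
end

section
/- Let M be a nonnegative Borel measure on ℝ which is finite on bounded Borel sets. Let D be a set of Borel functions u : ℝ → ℂ with ∫_ℝ |u|² dM < ∞ whose image in L²(ℝ, dM) is dense. Suppose that for every u ∈ D the measure X ↦ ∫_X |u(λ)| dM(λ) is absolutely continuous with respect to Lebesgue measure. Then M is absolutely continuous with respect to Lebesgue measure. -/
open MeasureTheory Filter Set

/-- If `D` is a set of square-integrable functions (w.r.t. a Borel measure `M` on `ℝ`
which is finite on bounded sets) which is dense in `L²(ℝ, dM)`, and for every `u ∈ D`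
the measure `|u| dM` is absolutely continuous with respect to Lebesgue measure, then `M`
itself is absolutely continuous with respect to Lebesgue measure. -/
theorem absolutelyContinuous_of_dense_absolutelyContinuous (M : Measure ℝ)
    (hloc : ∀ X : Set ℝ, MeasurableSet X → Bornology.IsBounded X → M X < ⊤)
    (D : Set (ℝ → ℂ))
    (hDmeas : ∀ u ∈ D, Measurable u)
    (hDL2 : ∀ u ∈ D, ∫⁻ lam : ℝ, (‖u lam‖₊ : ENNReal) ^ 2 ∂M < ⊤)
    (hdense : ∀ v : ℝ → ℂ, Measurable v → (∫⁻ lam : ℝ, (‖v lam‖₊ : ENNReal) ^ 2 ∂M < ⊤) →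
      ∀ ε : ℝ, 0 < ε → ∃ u ∈ D,
        ∫⁻ lam : ℝ, (‖u lam - v lam‖₊ : ENNReal) ^ 2 ∂M < ENNReal.ofReal ε)
    (hac : ∀ u ∈ D,
      M.withDensity (fun lam => (‖u lam‖₊ : ENNReal)) ≪ (volume : Measure ℝ)) :
    M ≪ (volume : Measure ℝ) := by
  refine Measure.AbsolutelyContinuous.mk fun N hN hN0 => ?_
  have bounded_part (n : ℕ) : M (N ∩ Metric.ball 0 n) = 0 := by
    set X := N ∩ Metric.ball (0 : ℝ) n
    have hXm : MeasurableSet X := hN.inter measurableSet_ball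
    have hXfin : M X < ⊤ := hloc X hXm (Metric.isBounded_ball.subset inter_subset_right)
    have hv : Measurable (X.indicator (fun _ => (1 : ℂ))) := measurable_const.indicator hXm
    have hv_sq : (fun lam => (‖X.indicator (fun _ => (1 : ℂ)) lam‖₊ : ENNReal) ^ 2) =
        X.indicator (fun _ => 1) := by
      funext lam
      by_cases h : lam ∈ X <;> simp [h]
    have hvL2 : ∫⁻ lam, (‖X.indicator (fun _ => (1 : ℂ)) lam‖₊ : ENNReal) ^ 2 ∂M < ⊤ := by
      rw [hv_sq, lintegral_indicator hXm]
      simpa using hXfin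
    have small (ε : ℝ) (hε : 0 < ε) : M X < ENNReal.ofReal ε := by
      obtain ⟨u, huD, hu⟩ := hdense _ hv hvL2 ε hε
      refine lt_of_le_of_lt ?_ hu
      have hX0 : (volume : Measure ℝ) X = 0 := measure_mono_null inter_subset_left hN0
      have hu0 := hac u huD hX0
      have hum : Measurable fun lam => (‖u lam‖₊ : ENNReal) :=
        (hDmeas u huD).nnnorm.coe_nnreal_ennreal
      rw [withDensity_apply _ hXm, lintegral_eq_zero_iff hum] at hu0
      calc M X = ∫⁻ _ in X, 1 ∂M := by simp
        _ = ∫⁻ lam in X, (‖u lam - X.indicator (fun _ => (1 : ℂ)) lam‖₊ : ENNReal) ^ 2 ∂M := by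
          refine lintegral_congr_ae ?_
          filter_upwards [hu0, ae_restrict_mem hXm] with lam h0 hmem
          have hz : u lam = 0 := by simpa using h0
          simp [hz, hmem]
        _ ≤ _ := setLIntegral_le_lintegral _ _
    by_contra hne
    have h := small (M X).toReal (ENNReal.toReal_pos hne hXfin.ne)
    rw [ENNReal.ofReal_toReal hXfin.ne] at h
    exact lt_irrefl _ h
  rw [← inter_univ N, ← Metric.iUnion_ball_nat (0 : ℝ), inter_iUnion]
  exact measure_iUnion_null bounded_part
end

section
/- Let 𝕋 = ℝ/2πℤ be the circle, let ν be a finite nonnegative Borel measure on 𝕋, and let h : 𝕋 → ℂ be a Borel function with |h(t)| = 1 for all t (so that dμ = h dν represents a complex measure with variation ν). Let N ∈ ℕ and b ∈ ℂ, and suppose that ∫_𝕋 e^{-int} h(t) dν(t) = b for every integer n ≥ N+1. Then the restriction of ν to 𝕋 \ {0} is absolutely continuous with respect to the Haar (Lebesgue) measure on 𝕋, and ∫_{{0}} h dν = b (equivalently h(0) ν({0}) = b). In particular, if ν({0}) = 0 then b = 0 and ν itself is absolutely continuous with respect to Haar measure. -/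
open MeasureTheory Filter Set

instance : Fact (0 < 2 * Real.pi) := ⟨by positivity⟩

open Complex Topology

/-- A function holomorphic on a disc of radius greater than `1` has an absolutely summable sequence
of Taylor coefficients at `0`. -/
theorem exists_summable_hasSum_of_differentiableOn_ball {F : ℂ → ℂ} {R : ℝ} (hR : 1 < R)
    (hF : DifferentiableOn ℂ F (Metric.ball 0 R)) :
    ∃ a : ℕ → ℂ, (Summable fun n => ‖a n‖) ∧
      ∀ z : ℂ, ‖z‖ ≤ 1 → HasSum (fun n => a n * z ^ n) (F z) := by
  have key : ∀ z : ℂ, ‖z‖ ≤ 1 →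
      HasSum (fun n : ℕ => ((n.factorial : ℂ)⁻¹ * iteratedDeriv n F 0) * z ^ n) (F z) := by
    intro z hz
    have hz' : z ∈ Metric.ball (0 : ℂ) R := by
      simpa using hz.trans_lt hR
    have h := hasSum_taylorSeries_on_ball hF hz'
    simp only [sub_zero, smul_eq_mul] at h
    simpa only [mul_assoc, mul_comm (z ^ _)] using h
  refine ⟨_, ?_, key⟩
  have h1 := (key 1 (by simp)).summable
  simpa using h1.norm

/-- If `∫ u ^ n * g = 0` for all `n : ℕ`, with `u` unimodular, then `∫ F(u) * g = 0` for all `F`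
holomorphic in a neighbourhood of the closed unit disc. -/
theorem integral_comp_mul_eq_zero_of_integral_pow_mul_eq_zero {α : Type*} [MeasurableSpace α]
    {μ : Measure α} {u g : α → ℂ} (hu : Measurable u) (hu1 : ∀ t, ‖u t‖ = 1) (hg : Integrable g μ)
    (h0 : ∀ n : ℕ, ∫ t, u t ^ n * g t ∂μ = 0) {F : ℂ → ℂ} {R : ℝ} (hR : 1 < R)
    (hF : DifferentiableOn ℂ F (Metric.ball 0 R)) :
    ∫ t, F (u t) * g t ∂μ = 0 := by
  obtain ⟨a, ha, hsum⟩ := exists_summable_hasSum_of_differentiableOn_ball hR hF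
  have hnorm : ∀ n t, ‖a n * (u t ^ n * g t)‖ = ‖a n‖ * ‖g t‖ := by
    intro n t
    simp [hu1]
  have hs := hasSum_integral_of_summable_integral_norm (μ := μ)
    (F := fun n t => a n * (u t ^ n * g t))
    (fun n => by
      refine Integrable.const_mul ?_ _
      refine hg.bdd_mul (c := 1) (hu.pow_const n).aestronglyMeasurable ?_
      exact Eventually.of_forall fun t => by simp [hu1])
    (by
      simp only [hnorm, integral_const_mul]
      exact ha.mul_right _)
  have htsum : ∀ t, ∑' n, a n * (u t ^ n * g t) = F (u t) * g t := by
    intro t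
    rw [← ((hsum (u t) (hu1 t).le).mul_right (g t)).tsum_eq]
    simp only [mul_assoc]
  simp only [htsum, integral_const_mul, h0, mul_zero] at hs
  exact hs.unique hasSum_zero

theorem norm_sub_mul_ge {R : ℝ} {w u : ℂ} (hu : ‖u‖ = 1) : R - ‖w‖ ≤ ‖(R : ℂ) - w * u‖ := by
  have h1 : ‖w * u‖ = ‖w‖ := by simp [hu]
  have h2 := norm_sub_norm_le (R : ℂ) (w * u)
  have h3 : R ≤ ‖(R : ℂ)‖ := by simpa using le_abs_self R
  linarith

/-- Cauchy-type integrals `w ↦ ∫ (R - w u)⁻¹` with `u` unimodular are holomorphic on the disc of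
radius `R`. -/
theorem differentiableOn_integral_inv_sub_mul {α : Type*} [MeasurableSpace α] {μ : Measure α}
    [IsFiniteMeasure μ] {u : α → ℂ} (hu : Measurable u) (hu1 : ∀ t, ‖u t‖ = 1) (R : ℝ) :
    DifferentiableOn ℂ (fun w : ℂ => ∫ s, ((R : ℂ) - w * u s)⁻¹ ∂μ) (Metric.ball 0 R) := by
  intro w₀ hw₀
  have hw₀' : ‖w₀‖ < R := by simpa using hw₀
  set δ : ℝ := (R - ‖w₀‖) / 2 with hδ
  have hδ0 : 0 < δ := by rw [hδ]; linarith
  have hlow : ∀ w ∈ Metric.ball w₀ δ, ∀ s, δ ≤ ‖(R : ℂ) - w * u s‖ := by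
    intro w hw s
    have h1 := norm_sub_mul_ge (R := R) (w := w) (hu1 s)
    have h2 : ‖w‖ - ‖w₀‖ ≤ ‖w - w₀‖ := norm_sub_norm_le _ _
    have h3 : ‖w - w₀‖ < δ := by simpa [dist_eq_norm] using hw
    linarith
  have hmeas : ∀ w : ℂ, Measurable fun s => ((R : ℂ) - w * u s)⁻¹ := fun w => by fun_prop
  have := (hasDerivAt_integral_of_dominated_loc_of_deriv_le (μ := μ) (x₀ := w₀)
    (F := fun w s => ((R : ℂ) - w * u s)⁻¹)
    (F' := fun w s => u s / ((R : ℂ) - w * u s) ^ 2)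
    (bound := fun _ => 1 / δ ^ 2) (Metric.ball_mem_nhds w₀ hδ0)
    (Eventually.of_forall fun w => (hmeas w).aestronglyMeasurable)
    (Integrable.of_bound (hmeas w₀).aestronglyMeasurable δ⁻¹ (Eventually.of_forall fun s => by
      rw [norm_inv]
      exact inv_anti₀ hδ0 (hlow w₀ (Metric.mem_ball_self hδ0) s)))
    (by
      have : Measurable fun s => u s / ((R : ℂ) - w₀ * u s) ^ 2 := by fun_prop
      exact this.aestronglyMeasurable)
    (Eventually.of_forall fun s w hw => by
      rw [norm_div, norm_pow, hu1]
      have := hlow w hw s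
      gcongr)
    (integrable_const _)
    (Eventually.of_forall fun s w hw => by
      have hne : (R : ℂ) - w * u s ≠ 0 := by
        rw [← norm_pos_iff]
        exact hδ0.trans_le (hlow w hw s)
      simpa using (((hasDerivAt_id w).mul_const (u s)).const_sub (R : ℂ)).fun_inv hne)).2
  exact this.differentiableAt.differentiableWithinAt

theorem norm_fourier_neg_one_sub_one_bounds (x : AddCircle (2 * Real.pi)) :
    2 / Real.pi * ‖x‖ ≤ ‖(fourier (-1) x : ℂ) - 1‖ ∧ ‖(fourier (-1) x : ℂ) - 1‖ ≤ ‖x‖ := by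
  obtain ⟨y, hy, rfl⟩ : x ∈ ((↑) : ℝ → AddCircle (2 * Real.pi)) ''
      Ioc (-Real.pi) (-Real.pi + 2 * Real.pi) := by
    rw [AddCircle.coe_image_Ioc_eq]; trivial
  have hpi := Real.pi_pos
  have habs : |y| ≤ Real.pi := abs_le.2 ⟨hy.1.le, by linarith [hy.2]⟩
  have hnorm : ‖(y : AddCircle (2 * Real.pi))‖ = |y| := by
    rw [AddCircle.norm_coe_eq_abs_iff _ (by positivity : 2 * Real.pi ≠ 0),
      abs_of_pos (by positivity : 0 < 2 * Real.pi)]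
    linarith
  have hf : (fourier (-1) (y : AddCircle (2 * Real.pi)) : ℂ) = exp (I * ((-y : ℝ) : ℂ)) := by
    rw [fourier_coe_apply]
    congr 1
    have : (Real.pi : ℂ) ≠ 0 := by exact_mod_cast hpi.ne'
    push_cast
    field_simp
  rw [hnorm, hf]
  constructor
  · rw [norm_exp_I_mul_ofReal_sub_one, norm_mul, Real.norm_eq_abs, Real.norm_eq_abs, abs_two]
    have := Real.mul_abs_le_abs_sin (x := -y / 2) (by
      rw [abs_div, abs_neg, abs_two]; linarith)
    rw [abs_div, abs_neg, abs_two] at this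
    linarith
  · simpa using Real.norm_exp_I_mul_ofReal_sub_one_le (x := -y)

theorem norm_fourier_apply (n : ℤ) (t : AddCircle (2 * Real.pi)) : ‖(fourier n t : ℂ)‖ = 1 := by
  rw [fourier_apply]
  exact Circle.norm_coe _

theorem fourier_neg_one_mul_fourier_one (t s : AddCircle (2 * Real.pi)) :
    (fourier (-1) t : ℂ) * fourier 1 s = fourier (-1) (t - s) := by
  rw [fourier_apply, fourier_apply, fourier_apply, ← Circle.coe_mul, ← AddCircle.toCircle_add]
  congr 2
  simp [sub_eq_add_neg, add_comm]

/-- On the circle, a compact null set is a peak set for functions holomorphic in a neighbourhood of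
the closed disc, in a quantitative sense. -/
theorem exists_approx_peak {K : Set (AddCircle (2 * Real.pi))} (hK : IsCompact K)
    (hK0 : volume K = 0) {ε : ℝ} (hε : 0 < ε) :
    ∃ (F : ℂ → ℂ) (R : ℝ), 1 < R ∧ DifferentiableOn ℂ F (Metric.ball 0 R) ∧
      (∀ t : AddCircle (2 * Real.pi), ‖F (fourier (-1) t)‖ ≤ 1) ∧
      (∀ t ∈ K, ‖F (fourier (-1) t) - 1‖ ≤ ε) ∧
      (∀ t, ε ≤ Metric.infDist t K → K.Nonempty → ‖F (fourier (-1) t)‖ ≤ ε) := by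
  have hpi := Real.pi_pos
  have hpi3 := Real.pi_gt_three
  obtain ⟨r, hr0, hr1, hrε, hvol⟩ : ∃ r : ℝ, 0 < r ∧ r ≤ 1 ∧ r ≤ ε / 2 ∧
      volume.real (Metric.cthickening r K) ≤ ε ^ 3 / (2 * Real.pi) := by
    have h := tendsto_measure_cthickening_of_isCompact (μ := volume) hK
    rw [hK0] at h
    have h1 : ∀ᶠ r in 𝓝[>] (0 : ℝ),
        volume (Metric.cthickening r K) < ENNReal.ofReal (ε ^ 3 / (2 * Real.pi)) :=
      (h.mono_left nhdsWithin_le_nhds).eventually_lt_const (by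
        rw [ENNReal.ofReal_pos]; positivity)
    have h2 : ∀ᶠ r in 𝓝[>] (0 : ℝ), r < min 1 (ε / 2) :=
      (eventually_lt_nhds (by positivity)).filter_mono nhdsWithin_le_nhds
    obtain ⟨r, ha, hb, hc⟩ := (h1.and (h2.and self_mem_nhdsWithin)).exists
    refine ⟨r, hc, (hb.trans_le (min_le_left _ _)).le, (hb.trans_le (min_le_right _ _)).le, ?_⟩
    exact ENNReal.toReal_le_of_le_ofReal (by positivity) ha.le
  set V := Metric.cthickening r K with hV
  have hVm : MeasurableSet V := Metric.isClosed_cthickening.measurableSet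
  let k : ℂ → AddCircle (2 * Real.pi) → ℂ := fun w s => (((1 + r : ℝ) : ℂ) - w * fourier 1 s)⁻¹
  let U : ℂ → ℂ := fun w => ∫ s in V, k w s
  have hkm : ∀ w, Measurable (k w) := fun w => by
    have : Measurable fun s : AddCircle (2 * Real.pi) => (fourier 1 s : ℂ) :=
      (map_continuous _).measurable
    fun_prop
  have hUd : DifferentiableOn ℂ U (Metric.ball 0 (1 + r)) :=
    differentiableOn_integral_inv_sub_mul (map_continuous (fourier 1)).measurable
      (norm_fourier_apply 1) (1 + r)
  have hki : ∀ w, ‖w‖ < 1 + r → Integrable (k w) volume := by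
    intro w hw
    refine Integrable.of_bound (hkm w).aestronglyMeasurable (1 + r - ‖w‖)⁻¹
      (Eventually.of_forall fun s => ?_)
    rw [norm_inv]
    exact inv_anti₀ (by linarith) (norm_sub_mul_ge (norm_fourier_apply 1 s))
  have hUre : ∀ w, ‖w‖ < 1 + r → (U w).re = ∫ s in V, (k w s).re := fun w hw =>
    (reCLM.integral_comp_comm (hki w hw).integrableOn).symm
  have hkre : ∀ w, ‖w‖ < 1 + r → ∀ s, 0 ≤ (k w s).re := by
    intro w hw s
    simp only [k, inv_re]
    refine div_nonneg ?_ (normSq_nonneg _)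
    have h1 : (w * fourier 1 s).re ≤ ‖w‖ := by
      refine (re_le_norm _).trans ?_
      rw [norm_mul, norm_fourier_apply, mul_one]
    rw [sub_re, ofReal_re]
    linarith
  have hU0 : ∀ w, ‖w‖ < 1 + r → 0 ≤ (U w).re := fun w hw => by
    rw [hUre w hw]
    exact integral_nonneg (hkre w hw)
  have hMU : ∀ w, ‖w‖ < 1 + r → 0 ≤ (((2 / ε : ℝ) : ℂ) * U w).re := fun w hw => by
    rw [re_ofReal_mul]
    exact mul_nonneg (by positivity) (hU0 w hw)
  have hne : ∀ w, ‖w‖ < 1 + r → 1 + ((2 / ε : ℝ) : ℂ) * U w ≠ 0 := fun w hw h => by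
    have h1 := congrArg re h
    rw [add_re, one_re, zero_re] at h1
    linarith [hMU w hw]
  have hge : ∀ w, ‖w‖ < 1 + r → 1 + (((2 / ε : ℝ) : ℂ) * U w).re
      ≤ ‖1 + ((2 / ε : ℝ) : ℂ) * U w‖ := fun w hw => by
    refine le_trans (le_of_eq ?_) (re_le_norm _)
    rw [add_re, one_re]
  have hle : ∀ w, ‖w‖ < 1 + r → ‖((2 / ε : ℝ) : ℂ) * U w‖
      ≤ ‖1 + ((2 / ε : ℝ) : ℂ) * U w‖ := fun w hw => by
    rw [← sq_le_sq₀ (norm_nonneg _) (norm_nonneg _), ← normSq_eq_norm_sq, ← normSq_eq_norm_sq,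
      normSq_apply, normSq_apply, add_re, add_im, one_re, one_im]
    nlinarith [hMU w hw]
  have hlt : ∀ t : AddCircle (2 * Real.pi), ‖(fourier (-1) t : ℂ)‖ < 1 + r := fun t => by
    rw [norm_fourier_apply]; linarith
  refine ⟨fun w => ((2 / ε : ℝ) : ℂ) * U w / (1 + ((2 / ε : ℝ) : ℂ) * U w), 1 + r, by linarith,
    ?_, ?_, ?_, ?_⟩
  · exact (hUd.const_mul _).div ((hUd.const_mul _).const_add _)
      fun w hw => hne w (by simpa using hw)
  · intro t
    rw [norm_div]
    exact div_le_one_of_le₀ (hle _ (hlt t)) (norm_nonneg _)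
  · intro t ht
    have hball : Metric.closedBall t r ⊆ V := Metric.closedBall_subset_cthickening ht r
    have hkl : ∀ s ∈ Metric.closedBall t r, 1 / (4 * r) ≤ (k (fourier (-1) t) s).re := by
      intro s hs
      have h1 : ‖t - s‖ ≤ r := by simpa [dist_eq_norm, norm_sub_rev] using hs
      have h2 := (norm_fourier_neg_one_sub_one_bounds (t - s)).2.trans h1
      simp only [k, fourier_neg_one_mul_fourier_one, inv_re]
      set z : ℂ := fourier (-1) (t - s) with hz
      have h3 : z.re ≤ 1 := (re_le_norm z).trans (norm_fourier_apply _ _).le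
      have h4 : ‖((1 + r : ℝ) : ℂ) - z‖ ≤ 2 * r := by
        have : ((1 + r : ℝ) : ℂ) - z = (r : ℂ) - (z - 1) := by push_cast; ring
        rw [this]
        refine (norm_sub_le _ _).trans ?_
        rw [norm_real, Real.norm_of_nonneg hr0.le]
        linarith
      have h5 : r ≤ (((1 + r : ℝ) : ℂ) - z).re := by
        rw [sub_re, ofReal_re]; linarith
      have h6 : normSq (((1 + r : ℝ) : ℂ) - z) ≤ (2 * r) ^ 2 := by
        rw [normSq_eq_norm_sq]; gcongr
      have h7 : 0 < normSq (((1 + r : ℝ) : ℂ) - z) := by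
        rw [normSq_pos]
        intro h
        rw [h, zero_re] at h5
        linarith
      rw [div_le_div_iff₀ (by positivity) h7]
      nlinarith
    have hvb : volume.real (Metric.closedBall t r) = 2 * r := by
      rw [measureReal_def, AddCircle.volume_closedBall, min_eq_right (by linarith),
        ENNReal.toReal_ofReal (by positivity)]
    have hUt : 1 / 2 ≤ (U (fourier (-1) t)).re := by
      rw [hUre _ (hlt t)]
      calc (1 / 2 : ℝ) = ∫ _ in Metric.closedBall t r, 1 / (4 * r) := by
            rw [setIntegral_const, hvb, smul_eq_mul]; field_simp; norm_num
        _ ≤ ∫ s in Metric.closedBall t r, (k (fourier (-1) t) s).re := by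
            refine setIntegral_mono_on (integrable_const _)
              (hki _ (hlt t)).re.integrableOn Metric.isClosed_closedBall.measurableSet hkl
        _ ≤ ∫ s in V, (k (fourier (-1) t) s).re :=
            setIntegral_mono_set (hki _ (hlt t)).re.integrableOn
              (Eventually.of_forall (hkre _ (hlt t))) hball.eventuallyLE
    have hn := hne _ (hlt t)
    have : ∀ x : ℂ, 1 + x ≠ 0 → x / (1 + x) - 1 = -(1 + x)⁻¹ := by
      intro x hx; field_simp; ring
    rw [this _ hn, norm_neg, norm_inv]
    have h8 : ε⁻¹ ≤ ‖1 + ((2 / ε : ℝ) : ℂ) * U (fourier (-1) t)‖ := by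
      refine le_trans ?_ (hge _ (hlt t))
      rw [re_ofReal_mul]
      have : 2 / ε * (1 / 2) ≤ 2 / ε * (U (fourier (-1) t)).re := by gcongr
      have h9 : 2 / ε * (1 / 2) = ε⁻¹ := by field_simp
      linarith
    simpa using inv_anti₀ (by positivity) h8
  · intro t ht hKne
    have hUt : ‖U (fourier (-1) t)‖ ≤ Real.pi / ε * volume.real V := by
      refine norm_setIntegral_le_of_norm_le_const (measure_lt_top _ _) fun s hs => ?_
      have h1 : ε / 2 ≤ ‖t - s‖ := by
        have h2 : Metric.infDist s K ≤ r :=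
          ENNReal.toReal_le_of_le_ofReal hr0.le (Metric.mem_cthickening_iff.1 hs)
        have h3 := Metric.infDist_le_infDist_add_dist (s := K) (x := t) (y := s)
        rw [dist_eq_norm] at h3
        linarith
      have h4 := (norm_fourier_neg_one_sub_one_bounds (t - s)).1
      simp only [k, fourier_neg_one_mul_fourier_one, norm_inv]
      set z : ℂ := fourier (-1) (t - s) with hz
      have hz1 : ‖z‖ = 1 := norm_fourier_apply _ _
      have h5 : ‖z - 1‖ ≤ ‖((1 + r : ℝ) : ℂ) - z‖ := by
        have h6 : z.re ≤ 1 := (re_le_norm z).trans hz1.le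
        rw [← sq_le_sq₀ (norm_nonneg _) (norm_nonneg _), ← normSq_eq_norm_sq,
          ← normSq_eq_norm_sq, normSq_apply, normSq_apply, sub_re, sub_im, sub_re, sub_im,
          one_re, one_im, ofReal_re, ofReal_im]
        nlinarith
      have h6 : ε / Real.pi ≤ ‖((1 + r : ℝ) : ℂ) - z‖ := by
        refine le_trans ?_ (h4.trans h5)
        calc ε / Real.pi = 2 / Real.pi * (ε / 2) := by field_simp
          _ ≤ _ := by gcongr
      rw [← inv_div]
      exact inv_anti₀ (by positivity) h6
    have h1 : 1 ≤ ‖1 + ((2 / ε : ℝ) : ℂ) * U (fourier (-1) t)‖ := by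
      linarith [hge _ (hlt t), hMU _ (hlt t)]
    rw [norm_div]
    refine (div_le_self (norm_nonneg _) h1).trans ?_
    rw [norm_mul, norm_real, Real.norm_of_nonneg (by positivity)]
    calc 2 / ε * ‖U (fourier (-1) t)‖
        ≤ 2 / ε * (Real.pi / ε * (ε ^ 3 / (2 * Real.pi))) := by
          gcongr
          exact hUt.trans (by gcongr)
      _ = ε := by field_simp

/-- If all Fourier coefficients of nonnegative index of `g dμ` vanish, then `g dμ` vanishes on
compact null sets. -/
theorem setIntegral_eq_zero_of_isCompact_of_volume_eq_zero
    {μ : Measure (AddCircle (2 * Real.pi))} {g : AddCircle (2 * Real.pi) → ℂ}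
    (hg : Integrable g μ)
    (h0 : ∀ n : ℕ, ∫ t, (fourier (-(n : ℤ)) t : ℂ) * g t ∂μ = 0)
    {K : Set (AddCircle (2 * Real.pi))} (hK : IsCompact K) (hK0 : volume K = 0) :
    ∫ t in K, g t ∂μ = 0 := by
  rcases K.eq_empty_or_nonempty with rfl | hne
  · simp
  have hpos : ∀ m : ℕ, (0 : ℝ) < 1 / ((m : ℝ) + 1) := fun m => Nat.one_div_pos_of_nat
  choose F R hR hFd hF1 hFK hFoff using fun m : ℕ => exists_approx_peak hK hK0 (hpos m)
  have hlim : Tendsto (fun m : ℕ => 1 / ((m : ℝ) + 1)) atTop (𝓝 0) :=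
    tendsto_one_div_add_atTop_nhds_zero_nat
  have hcont : ∀ m, Continuous fun t : AddCircle (2 * Real.pi) => F m (fourier (-1) t) := fun m =>
    (hFd m).continuousOn.comp_continuous (map_continuous _) fun t => by
      rw [mem_ball_zero_iff, norm_fourier_apply]
      exact hR m
  have hpow : ∀ (n : ℕ) (t : AddCircle (2 * Real.pi)),
      (fourier (-1) t : ℂ) ^ n = fourier (-(n : ℤ)) t := by
    intro n t
    rw [fourier_apply, fourier_apply, ← Circle.coe_pow, ← AddCircle.toCircle_nsmul]
    congr 2
    simp
  have hzero : ∀ m, ∫ t, F m (fourier (-1) t) * g t ∂μ = 0 := fun m =>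
    integral_comp_mul_eq_zero_of_integral_pow_mul_eq_zero
      (map_continuous (fourier (-1))).measurable (norm_fourier_apply _) hg
      (fun n => by simpa only [hpow] using h0 n) (hR m) (hFd m)
  have hconv : Tendsto (fun m => ∫ t, F m (fourier (-1) t) * g t ∂μ) atTop
      (𝓝 (∫ t, K.indicator g t ∂μ)) := by
    refine tendsto_integral_of_dominated_convergence (fun t => ‖g t‖)
      (fun m => (hcont m).aestronglyMeasurable.mul hg.1) hg.norm (fun m => ?_) ?_
    · refine Eventually.of_forall fun t => ?_
      rw [norm_mul]
      exact mul_le_of_le_one_left (norm_nonneg _) (hF1 m t)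
    · refine Eventually.of_forall fun t => ?_
      by_cases ht : t ∈ K
      · rw [indicator_of_mem ht]
        have : Tendsto (fun m => F m (fourier (-1) t)) atTop (𝓝 1) :=
          tendsto_iff_norm_sub_tendsto_zero.2
            (squeeze_zero (fun _ => norm_nonneg _) (fun m => hFK m t ht) hlim)
        simpa using this.mul_const (g t)
      · rw [indicator_of_notMem ht]
        have hd : 0 < Metric.infDist t K := (hK.isClosed.notMem_iff_infDist_pos hne).1 ht
        have : Tendsto (fun m => F m (fourier (-1) t)) atTop (𝓝 0) := by
          refine squeeze_zero_norm' ?_ hlim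
          filter_upwards [hlim.eventually_lt_const hd] with m hm
          exact hFoff m t hm.le hne
        simpa using this.mul_const (g t)
  rw [integral_indicator hK.isClosed.measurableSet] at hconv
  simp only [hzero] at hconv
  exact tendsto_nhds_unique hconv tendsto_const_nhds

/-- **F. and M. Riesz theorem**, for a complex measure `g dμ` on the circle: it vanishes on
compact null sets, i.e. `g = 0` almost everywhere there. -/
theorem ae_restrict_eq_zero_of_isCompact_of_volume_eq_zero
    {μ : Measure (AddCircle (2 * Real.pi))} {g : AddCircle (2 * Real.pi) → ℂ}
    (hg : Integrable g μ)
    (h0 : ∀ n : ℕ, ∫ t, (fourier (-(n : ℤ)) t : ℂ) * g t ∂μ = 0)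
    {K : Set (AddCircle (2 * Real.pi))} (hK : IsCompact K) (hK0 : volume K = 0) :
    g =ᵐ[μ.restrict K] 0 := by
  refine ae_eq_zero_of_forall_setIntegral_isCompact_eq_zero hg.integrableOn fun s hs => ?_
  rw [Measure.restrict_restrict hs.isClosed.measurableSet]
  exact setIntegral_eq_zero_of_isCompact_of_volume_eq_zero hg h0 (hs.inter hK)
    (measure_mono_null inter_subset_right hK0)

/-- **F. and M. Riesz theorem**: if the Fourier coefficients of index at least `M` of `g dμ`
vanish, then `g = 0` almost everywhere on Lebesgue null sets. -/
theorem measure_eq_zero_of_volume_eq_zero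
    {μ : Measure (AddCircle (2 * Real.pi))} [IsFiniteMeasure μ] {g : AddCircle (2 * Real.pi) → ℂ}
    (hg : Integrable g μ) (M : ℤ)
    (h0 : ∀ n : ℤ, M ≤ n → ∫ t, (fourier (-n) t : ℂ) * g t ∂μ = 0)
    {S : Set (AddCircle (2 * Real.pi))} (hS : MeasurableSet S) (hS0 : volume S = 0)
    (hgS : ∀ t ∈ S, g t ≠ 0) : μ S = 0 := by
  rw [hS.measure_eq_iSup_isCompact]
  simp only [ENNReal.iSup_eq_zero]
  intro K hKS hK
  have hg' : Integrable (fun t => (fourier (-M) t : ℂ) * g t) μ :=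
    hg.bdd_mul (c := 1) (map_continuous (fourier (-M))).aestronglyMeasurable
      (Eventually.of_forall fun t => (norm_fourier_apply _ t).le)
  have h := ae_restrict_eq_zero_of_isCompact_of_volume_eq_zero hg' (fun n => by
    rw [← h0 (M + n) (by simp)]
    refine integral_congr_ae (Eventually.of_forall fun t => ?_)
    simp only [← mul_assoc, ← fourier_add]
    congr 3
    ring) hK (measure_mono_null hKS hS0)
  have h' : ∀ᵐ t ∂μ.restrict K, t ∉ K := by
    filter_upwards [h] with t ht htK
    refine hgS t (hKS htK) ?_
    refine (mul_eq_zero.1 ht).resolve_left fun h => ?_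
    simpa [h] using norm_fourier_apply (-M) t
  rw [ae_restrict_iff' hK.isClosed.measurableSet] at h'
  refine measure_mono_null (fun t ht => ?_) h'
  simpa using ht

/-- Variant of the Riesz Brothers theorem on the circle `𝕋 = ℝ/2πℤ`: if all sufficiently
high negative Fourier coefficients `∫ e^{-int} h dν` of the complex measure `h dν`
(where `|h| = 1`, so `ν` is its variation) are equal to a constant `b`, then `ν` is
absolutely continuous with respect to Haar measure away from the point `0`, and
`∫_{{0}} h dν = b`. In particular, if `ν({0}) = 0`, then `b = 0` and `ν` is absolutely
continuous with respect to Haar measure. -/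
theorem riesz_brothers_constant_coefficients
    (ν : Measure (AddCircle (2 * Real.pi))) [IsFiniteMeasure ν]
    (h : AddCircle (2 * Real.pi) → ℂ) (hmeas : Measurable h)
    (hmod : ∀ t, ‖h t‖ = 1)
    (N : ℕ) (b : ℂ)
    (hcoef : ∀ n : ℤ, (N : ℤ) + 1 ≤ n → ∫ t, (fourier (-n) t : ℂ) * h t ∂ν = b) :
    ν.restrict ({(0 : AddCircle (2 * Real.pi))}ᶜ) ≪
        (volume : Measure (AddCircle (2 * Real.pi))) ∧
      (∫ t in ({0} : Set (AddCircle (2 * Real.pi))), h t ∂ν = b) ∧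
      (ν {(0 : AddCircle (2 * Real.pi))} = 0 →
        b = 0 ∧ ν ≪ (volume : Measure (AddCircle (2 * Real.pi)))) := by
  classical
  have hint : Integrable h ν := Integrable.of_bound hmeas.aestronglyMeasurable 1
    (Eventually.of_forall fun t => (hmod t).le)
  set c : ℂ := ∫ t in ({0} : Set (AddCircle (2 * Real.pi))), h t ∂ν with hc
  have hs0 : MeasurableSet ({0} : Set (AddCircle (2 * Real.pi))) := measurableSet_singleton 0
  let g : AddCircle (2 * Real.pi) → ℂ := fun t => if t = 0 then c - b else h t
  let μ : Measure (AddCircle (2 * Real.pi)) := ν.restrict {0}ᶜ + Measure.dirac 0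
  have hgm : Measurable g := Measurable.ite hs0 measurable_const hmeas
  have hgb : ∀ t, ‖g t‖ ≤ max ‖c - b‖ 1 := by
    intro t
    simp only [g]
    split_ifs
    · exact le_max_left _ _
    · exact (hmod t).le.trans (le_max_right _ _)
  have hgi : Integrable g μ := Integrable.of_bound hgm.aestronglyMeasurable _
    (Eventually.of_forall hgb)
  have hg0 : ∀ n : ℤ, (N : ℤ) + 1 ≤ n → ∫ t, (fourier (-n) t : ℂ) * g t ∂μ = 0 := by
    intro n hn
    have hbdd : ∀ {ρ : Measure (AddCircle (2 * Real.pi))} {f : AddCircle (2 * Real.pi) → ℂ},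
        Integrable f ρ → Integrable (fun t => (fourier (-n) t : ℂ) * f t) ρ := fun hf =>
      hf.bdd_mul (c := 1) (map_continuous (fourier (-n))).aestronglyMeasurable
        (Eventually.of_forall fun t => (norm_fourier_apply _ t).le)
    have hi := hbdd hgi
    rw [integral_add_measure (hi.mono_measure (Measure.le_add_right le_rfl))
      (hi.mono_measure (Measure.le_add_left le_rfl)), integral_dirac]
    have h1 : ∫ t in ({0} : Set (AddCircle (2 * Real.pi)))ᶜ, (fourier (-n) t : ℂ) * g t ∂ν =
        ∫ t in ({0} : Set (AddCircle (2 * Real.pi)))ᶜ, (fourier (-n) t : ℂ) * h t ∂ν := by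
      refine setIntegral_congr_fun hs0.compl fun t ht => ?_
      simp only [g, if_neg (show t ≠ 0 from ht)]
    have h2 : ∫ t in ({0} : Set (AddCircle (2 * Real.pi))), (fourier (-n) t : ℂ) * h t ∂ν = c := by
      refine setIntegral_congr_fun hs0 fun t ht => ?_
      rw [mem_singleton_iff.1 ht, fourier_eval_zero, one_mul]
    have h3 := integral_add_compl hs0 (hbdd hint)
    rw [hcoef n hn, h2] at h3
    rw [h1, fourier_eval_zero, one_mul]
    simp only [g, if_true]
    linear_combination h3
  have hnull : ∀ S, MeasurableSet S → volume S = 0 → (∀ t ∈ S, g t ≠ 0) → μ S = 0 :=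
    fun S hS hS0 hgS => measure_eq_zero_of_volume_eq_zero hgi _ hg0 hS hS0 hgS
  have hac : ν.restrict ({(0 : AddCircle (2 * Real.pi))}ᶜ) ≪
      (volume : Measure (AddCircle (2 * Real.pi))) := by
    refine Measure.AbsolutelyContinuous.mk fun S hS hS0 => ?_
    rw [Measure.restrict_apply hS]
    have h1 := hnull (S ∩ {0}ᶜ) (hS.inter hs0.compl) (measure_mono_null inter_subset_left hS0)
      (fun t ht h0 => by
        have ht0 : t ≠ 0 := ht.2
        simp only [g, if_neg ht0] at h0
        simpa [h0] using hmod t)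
    have h2 := (Measure.le_add_right (le_refl (ν.restrict {0}ᶜ)) :
      ν.restrict {0}ᶜ ≤ μ) (S ∩ {0}ᶜ)
    rw [h1, Measure.restrict_apply (hS.inter hs0.compl), inter_assoc, inter_self] at h2
    exact le_antisymm h2 zero_le
  have hcb : c = b := by
    by_contra hne
    have h1 := hnull {0} hs0 (by
      have := AddCircle.volume_closedBall (T := 2 * Real.pi) (x := 0) 0
      simpa [Real.pi_pos.le] using this) (fun t ht h0 => by
        simp only [g, if_pos (mem_singleton_iff.1 ht)] at h0
        exact hne (sub_eq_zero.1 h0))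
    simp [μ] at h1
  refine ⟨hac, hcb, fun hν => ⟨?_, ?_⟩⟩
  · rw [← hcb, hc, Measure.restrict_eq_zero.2 hν, integral_zero_measure]
  · rwa [Measure.restrict_eq_self_of_ae_mem] at hac
    exact compl_mem_ae_iff.2 hν
end

section
/- For every integer n ≥ 1 and every λ ∈ ℝ, ((λ − i)/(λ + i))^{-n} = 1 − 2 ∫_0^∞ L_{n−1}^1(2x) e^{-x - iλx} dx, where L_{n−1}^1 is the Laguerre polynomial with parameter α = 1. -/
open MeasureTheory Set Finset

/-- The generalized Laguerre polynomial
`L_n^α(x) = Σ_{k=0}^n (-1)^k C(n+α, n-k) x^k / k!`. -/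
noncomputable def laguerre (α n : ℕ) (x : ℝ) : ℝ :=
  ∑ k ∈ Finset.range (n + 1),
    (-1 : ℝ) ^ k * ((n + α).choose (n - k) : ℝ) * x ^ k / (Nat.factorial k : ℝ)

theorem integrableOn_pow_mul_cexp_neg_mul {s : ℂ} (hs : 0 < s.re) (k : ℕ) :
    IntegrableOn (fun x : ℝ => (x : ℂ) ^ k * Complex.exp (-s * x)) (Ioi 0) := by
  have h := integrableOn_rpow_mul_exp_neg_mul_rpow (p := 1) (s := k) (b := s.re)
    (by have : (0 : ℝ) ≤ k := k.cast_nonneg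
        linarith) one_pos hs
  refine Integrable.mono' h (by fun_prop) ?_
  filter_upwards [ae_restrict_mem measurableSet_Ioi] with x hx
  have hx' : (0 : ℝ) < x := hx
  simp [Complex.norm_exp, abs_of_pos hx']

theorem tendsto_pow_mul_cexp_neg_mul_atTop_nhds_zero {s : ℂ} (hs : 0 < s.re) (k : ℕ) :
    Filter.Tendsto (fun x : ℝ => (x : ℂ) ^ k * Complex.exp (-s * x)) Filter.atTop (nhds 0) := by
  rw [tendsto_zero_iff_norm_tendsto_zero]
  refine (tendsto_rpow_mul_exp_neg_mul_atTop_nhds_zero k s.re hs).congr' ?_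
  filter_upwards [Filter.eventually_gt_atTop 0] with x hx
  simp [Complex.norm_exp, abs_of_pos hx]

theorem integral_pow_mul_cexp_neg_mul {s : ℂ} (hs : 0 < s.re) (k : ℕ) :
    ∫ x in Ioi (0 : ℝ), (x : ℂ) ^ k * Complex.exp (-s * x) = (k.factorial : ℂ) / s ^ (k + 1) := by
  have hs0 : s ≠ 0 := by
    rintro rfl
    simp at hs
  induction k with
  | zero =>
    simpa [neg_div_neg_eq] using integral_exp_mul_complex_Ioi (a := -s) (by simpa using hs) 0
  | succ k ih =>
    have hexp (x : ℝ) : HasDerivAt (fun x : ℝ => Complex.exp (-s * x))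
        (Complex.exp (-s * x) * -s) x := by
      simpa using ((Complex.ofRealCLM.hasDerivAt (x := x)).const_mul (-s)).cexp
    have hpow (x : ℝ) : HasDerivAt (fun x : ℝ => (x : ℂ) ^ (k + 1))
        ((k + 1 : ℂ) * (x : ℂ) ^ k) x := by
      simpa using (Complex.ofRealCLM.hasDerivAt (x := x)).fun_pow (k + 1)
    have hderiv (x : ℝ) : HasDerivAt (fun x : ℝ => (x : ℂ) ^ (k + 1) * Complex.exp (-s * x))
        ((k + 1 : ℂ) * ((x : ℂ) ^ k * Complex.exp (-s * x))
          - s * ((x : ℂ) ^ (k + 1) * Complex.exp (-s * x))) x :=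
      ((hpow x).mul (hexp x)).congr_deriv (by ring)
    have h₁ := (integrableOn_pow_mul_cexp_neg_mul hs k).const_mul (k + 1 : ℂ)
    have h₂ := (integrableOn_pow_mul_cexp_neg_mul hs (k + 1)).const_mul s
    have h := integral_Ioi_of_hasDerivAt_of_tendsto' (a := 0) (fun x _ => hderiv x) (h₁.sub h₂)
      (tendsto_pow_mul_cexp_neg_mul_atTop_nhds_zero hs (k + 1))
    rw [integral_sub h₁ h₂, integral_const_mul, integral_const_mul, ih] at h
    have h' : s * ∫ x in Ioi (0 : ℝ), (x : ℂ) ^ (k + 1) * Complex.exp (-s * x) =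
        (k + 1 : ℂ) * ((k.factorial : ℂ) / s ^ (k + 1)) := by
      rw [Complex.ofReal_zero, zero_pow k.succ_ne_zero] at h
      linear_combination -h
    rw [Nat.factorial_succ, ← mul_right_inj' hs0, h']
    push_cast
    field_simp
    ring

theorem integral_laguerre_mul_cexp_neg_mul {s : ℂ} (hs : 0 < s.re) (α n : ℕ) (c : ℝ) :
    ∫ x in Ioi (0 : ℝ), (laguerre α n (c * x) : ℂ) * Complex.exp (-s * x) =
      ∑ k ∈ Finset.range (n + 1),
        (-1 : ℂ) ^ k * ((n + α).choose (n - k) : ℂ) * (c : ℂ) ^ k / s ^ (k + 1) := by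
  have hexpand (x : ℝ) : (laguerre α n (c * x) : ℂ) * Complex.exp (-s * x) =
      ∑ k ∈ Finset.range (n + 1), ((-1 : ℂ) ^ k * ((n + α).choose (n - k) : ℂ) * (c : ℂ) ^ k /
        (k.factorial : ℂ)) * ((x : ℂ) ^ k * Complex.exp (-s * x)) := by
    rw [laguerre, Complex.ofReal_sum, Finset.sum_mul]
    refine Finset.sum_congr rfl fun k _ => ?_
    push_cast
    ring
  simp_rw [hexpand]
  rw [integral_finsetSum _ fun k _ => (integrableOn_pow_mul_cexp_neg_mul hs k).const_mul _]
  refine Finset.sum_congr rfl fun k _ => ?_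
  rw [integral_const_mul, integral_pow_mul_cexp_neg_mul hs]
  have := Nat.cast_ne_zero (R := ℂ).mpr k.factorial_ne_zero
  field_simp

/-- The Laguerre integral representation of the negative powers of the Cayley transform:
`((λ-i)/(λ+i))^{-n} = 1 - 2 ∫_0^∞ L_{n-1}^1(2x) e^{-x-iλx} dx` for `n ≥ 1` and real `λ`. -/
theorem cayley_negative_power_laguerre (n : ℕ) (hn : 1 ≤ n) (lam : ℝ) :
    (((lam : ℂ) - Complex.I) / ((lam : ℂ) + Complex.I)) ^ (-(n : ℤ)) =
      1 - 2 * ∫ x in Ioi (0 : ℝ),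
        (laguerre 1 (n - 1) (2 * x) : ℂ) * Complex.exp (-x - Complex.I * lam * x) := by
  obtain ⟨m, rfl⟩ : ∃ m, n = m + 1 := ⟨n - 1, by omega⟩
  set s : ℂ := 1 + Complex.I * lam with hs_def
  have hs : 0 < s.re := by simp [hs_def]
  have hs0 : s ≠ 0 := by
    intro h
    simp [h] at hs
  have hminus : (lam : ℂ) - Complex.I = -Complex.I * s := by
    linear_combination (lam : ℂ) * Complex.I_sq
  have hplus : (lam : ℂ) + Complex.I = -Complex.I * (s - 2) := by
    linear_combination (lam : ℂ) * Complex.I_sq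
  have hbase : (((lam : ℂ) - Complex.I) / ((lam : ℂ) + Complex.I))⁻¹ = -2 / s + 1 := by
    rw [hminus, hplus, mul_div_mul_left _ _ (neg_ne_zero.mpr Complex.I_ne_zero), inv_div]
    field_simp
    ring
  have hexp (x : ℝ) : Complex.exp (-x - Complex.I * lam * x) = Complex.exp (-s * x) := by
    congr 1
    rw [hs_def]
    ring
  have hint := integral_laguerre_mul_cexp_neg_mul hs 1 m 2
  simp_rw [hexp, Nat.add_sub_cancel]
  rw [hint, zpow_neg, zpow_natCast, ← inv_pow, hbase, add_pow, Finset.sum_range_succ',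
    Finset.mul_sum, add_comm, sub_eq_add_neg, ← Finset.sum_neg_distrib]
  congr 1
  · simp
  · refine Finset.sum_congr rfl fun k hk => ?_
    have hk' : k ≤ m := Nat.lt_succ_iff.mp (Finset.mem_range.mp hk)
    rw [Nat.choose_symm_of_eq_add (show m + 1 = (m - k) + (k + 1) by omega), div_pow,
      neg_pow (2 : ℂ)]
    push_cast
    ring
end

section
/- Let μ be a finite nonnegative Borel measure on ℝ and h : ℝ → ℂ a bounded Borel function (so that dm = h dμ represents a finite complex measure). Then for every integer n ≥ 1, ∫_ℝ ((λ − i)/(λ + i))^{-n} h(λ) dμ(λ) = ∫_ℝ h(λ) dμ(λ) − 2 ∫_0^∞ L_{n−1}^1(2x) e^{-x} ( ∫_ℝ e^{-iλx} h(λ) dμ(λ) ) dx, where L_{n−1}^1 is the Laguerre polynomial with parameter α = 1 (all integrals converge absolutely). -/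
open MeasureTheory Set Finset

theorem integrableOn_pow_mul_cexp_neg_mul_Ioi (k : ℕ) {z : ℂ} (hz : 0 < z.re) :
    IntegrableOn (fun x : ℝ => (x : ℂ) ^ k * Complex.exp (-(z * x))) (Ioi 0) := by
  have hs : (-1 : ℝ) < k := by linarith [(Nat.cast_nonneg k : (0 : ℝ) ≤ k)]
  have hconv := integrableOn_rpow_mul_exp_neg_mul_rpow hs one_pos hz
  refine Integrable.mono hconv (Continuous.aestronglyMeasurable (by fun_prop))
    (Filter.Eventually.of_forall fun x => ?_)
  simp [Complex.norm_exp]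

/-- The Laplace transform of `x ^ k` at a complex point of positive real part. -/
theorem integral_pow_mul_cexp_neg_mul_Ioi (k : ℕ) {z : ℂ} (hz : 0 < z.re) :
    ∫ x in Ioi (0 : ℝ), (x : ℂ) ^ k * Complex.exp (-(z * x)) =
      (Nat.factorial k : ℂ) / z ^ (k + 1) := by
  have hz0 : z ≠ 0 := fun h0 => by simp [h0] at hz
  induction k with
  | zero =>
    have h0 := integral_exp_mul_complex_Ioi (a := -z) (by simpa using hz) 0
    simpa using h0
  | succ k ih =>
    have hderiv : ∀ x ∈ Ici (0 : ℝ),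
        HasDerivAt (fun x : ℝ => (x : ℂ) ^ (k + 1) * Complex.exp (-(z * x)))
          (((k : ℂ) + 1) * ((x : ℂ) ^ k * Complex.exp (-(z * x))) -
            z * ((x : ℂ) ^ (k + 1) * Complex.exp (-(z * x)))) x := fun x _ => by
      have hpow := (hasDerivAt_id (x : ℂ)).pow (k + 1)
      have hexp := (((hasDerivAt_id (x : ℂ)).const_mul z).neg).cexp
      convert! (hpow.mul hexp).comp_ofReal using 1
      simp
      ring
    have hlim : Filter.Tendsto (fun x : ℝ => (x : ℂ) ^ (k + 1) * Complex.exp (-(z * x)))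
        Filter.atTop (nhds 0) := by
      rw [tendsto_zero_iff_norm_tendsto_zero]
      refine (tendsto_rpow_mul_exp_neg_mul_atTop_nhds_zero ((k + 1 : ℕ) : ℝ) z.re hz).congr' ?_
      filter_upwards [Filter.eventually_ge_atTop 0] with x hx
      rw [Real.rpow_natCast]
      simp [Complex.norm_exp, abs_of_nonneg hx]
    have hk := (integrableOn_pow_mul_cexp_neg_mul_Ioi k hz).const_mul ((k : ℂ) + 1)
    have hk' := (integrableOn_pow_mul_cexp_neg_mul_Ioi (k + 1) hz).const_mul z
    have hparts := integral_Ioi_of_hasDerivAt_of_tendsto' hderiv (hk.sub hk') hlim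
    rw [integral_sub hk hk', integral_const_mul, integral_const_mul, ih] at hparts
    simp only [Complex.ofReal_zero, zero_pow k.succ_ne_zero, zero_mul, sub_zero] at hparts
    apply mul_left_cancel₀ hz0
    rw [← sub_eq_zero.mp hparts, Nat.factorial_succ]
    push_cast
    field_simp
    ring

theorem laguerre_ofReal_two_mul (n : ℕ) (x : ℝ) :
    (laguerre 1 n (2 * x) : ℂ) = ∑ k ∈ Finset.range (n + 1),
      ((-2 : ℂ) ^ k * ((n + 1).choose (k + 1) : ℂ) / (Nat.factorial k : ℂ)) * (x : ℂ) ^ k := by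
  unfold laguerre
  push_cast
  refine Finset.sum_congr rfl fun k hk => ?_
  have hk' : k ≤ n := Nat.lt_succ_iff.mp (Finset.mem_range.mp hk)
  have hc : (n + 1).choose (n - k) = (n + 1).choose (k + 1) := by
    rw [← Nat.choose_symm (by omega : k + 1 ≤ n + 1)]
    congr 1
    omega
  rw [hc, mul_pow, show (-2 : ℂ) = (-1) * 2 by norm_num, mul_pow]
  ring

theorem integrableOn_laguerre_mul_cexp_neg_Ioi (n : ℕ) :
    IntegrableOn (fun x : ℝ => (laguerre 1 n (2 * x) : ℂ) * Complex.exp (-x)) (Ioi 0) := by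
  simp only [laguerre_ofReal_two_mul, Finset.sum_mul]
  refine integrable_finsetSum _ fun k _ => ?_
  have hk := integrableOn_pow_mul_cexp_neg_mul_Ioi k (z := 1) (by simp)
  simp only [one_mul] at hk
  simpa only [mul_assoc] using hk.const_mul _

/-- The Laguerre integral representation of the powers of the Cayley transform. -/
theorem cayley_zpow_neg_eq_laguerre_integral (n : ℕ) (lam : ℝ) :
    (((lam : ℂ) - Complex.I) / ((lam : ℂ) + Complex.I)) ^ (-((n + 1 : ℕ) : ℤ)) =
      1 - 2 * ∫ x in Ioi (0 : ℝ), (laguerre 1 n (2 * x) : ℂ) * Complex.exp (-x) *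
        Complex.exp (-(Complex.I * lam * x)) := by
  set z : ℂ := 1 + Complex.I * lam with hz
  have hzre : 0 < z.re := by simp [hz]
  have hz0 : z ≠ 0 := fun h0 => by simp [h0] at hzre
  have hint : ∫ x in Ioi (0 : ℝ), (laguerre 1 n (2 * x) : ℂ) * Complex.exp (-x) *
        Complex.exp (-(Complex.I * lam * x)) =
      ∑ k ∈ Finset.range (n + 1), (-2 : ℂ) ^ k * ((n + 1).choose (k + 1) : ℂ) / z ^ (k + 1) := by
    have hfun : ∀ x : ℝ, (laguerre 1 n (2 * x) : ℂ) * Complex.exp (-x) *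
        Complex.exp (-(Complex.I * lam * x)) = ∑ k ∈ Finset.range (n + 1),
        ((-2 : ℂ) ^ k * ((n + 1).choose (k + 1) : ℂ) / (Nat.factorial k : ℂ)) *
          ((x : ℂ) ^ k * Complex.exp (-(z * x))) := fun x => by
      rw [mul_assoc, ← Complex.exp_add, laguerre_ofReal_two_mul, Finset.sum_mul]
      refine Finset.sum_congr rfl fun k _ => ?_
      rw [mul_assoc, hz]
      congr 3
      ring
    simp only [hfun]
    rw [integral_finsetSum _ fun k _ => (integrableOn_pow_mul_cexp_neg_mul_Ioi k hzre).const_mul _]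
    refine Finset.sum_congr rfl fun k _ => ?_
    rw [integral_const_mul, integral_pow_mul_cexp_neg_mul_Ioi k hzre]
    have hk : (Nat.factorial k : ℂ) ≠ 0 := by exact_mod_cast Nat.factorial_ne_zero k
    field_simp
  have hcayley : (((lam : ℂ) - Complex.I) / ((lam : ℂ) + Complex.I))⁻¹ = -2 / z + 1 := by
    have hsub : (lam : ℂ) - Complex.I = -Complex.I * z := by
      rw [hz]; linear_combination (lam : ℂ) * Complex.I_sq
    have hadd : (lam : ℂ) + Complex.I = -Complex.I * (z - 2) := by
      rw [hz]; linear_combination (lam : ℂ) * Complex.I_sq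
    rw [hsub, hadd, mul_div_mul_left _ _ (neg_ne_zero.mpr Complex.I_ne_zero), inv_div]
    field_simp
    ring
  rw [hint, zpow_neg, zpow_natCast, ← inv_pow, hcayley, add_pow, Finset.sum_range_succ']
  simp only [one_pow, mul_one, pow_zero, Nat.choose_zero_right, Nat.cast_one]
  rw [Finset.mul_sum, sub_eq_add_neg, ← Finset.sum_neg_distrib, add_comm]
  congr 1
  refine Finset.sum_congr rfl fun k _ => ?_
  rw [div_pow, pow_succ (-2 : ℂ)]
  ring

theorem integrable_prod_mul_cexp_neg_mul {μ : Measure ℝ} [SFinite μ]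
    {ν : Measure ℝ} [SFinite ν] {h g : ℝ → ℂ} (hh : Integrable h μ) (hg : Integrable g ν) :
    Integrable (fun p : ℝ × ℝ => g p.2 * (Complex.exp (-(Complex.I * p.1 * p.2)) * h p.1))
      (μ.prod ν) := by
  refine (hh.mul_prod hg).mono ?_ (Filter.Eventually.of_forall fun p => ?_)
  · exact hg.1.comp_snd.mul ((by fun_prop : Continuous fun p : ℝ × ℝ =>
      Complex.exp (-(Complex.I * p.1 * p.2))).aestronglyMeasurable.mul hh.1.comp_fst)
  · simp [Complex.norm_exp, mul_comm]

/-- The negative Cayley–Fourier coefficients of a finite complex measure `h dμ` in terms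
of its Fourier transform on the half-line:
`∫ ((λ-i)/(λ+i))^{-n} h dμ = ∫ h dμ - 2 ∫_0^∞ L_{n-1}^1(2x) e^{-x} (∫ e^{-iλx} h(λ) dμ(λ)) dx`. -/
theorem cayley_coefficients_eq_halfline_fourier
    (μ : Measure ℝ) [IsFiniteMeasure μ]
    (h : ℝ → ℂ) (hmeas : Measurable h) (C : ℝ) (hbd : ∀ lam, ‖h lam‖ ≤ C)
    (n : ℕ) (hn : 1 ≤ n) :
    ∫ lam : ℝ, (((lam : ℂ) - Complex.I) / ((lam : ℂ) + Complex.I)) ^ (-(n : ℤ)) * h lam ∂μ =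
      (∫ lam : ℝ, h lam ∂μ) -
        2 * ∫ x in Ioi (0 : ℝ),
          (laguerre 1 (n - 1) (2 * x) : ℂ) * Complex.exp (-x) *
            (∫ lam : ℝ, Complex.exp (-(Complex.I * lam * x)) * h lam ∂μ) := by
  have hint : Integrable h μ :=
    Integrable.of_bound hmeas.aestronglyMeasurable C (Filter.Eventually.of_forall hbd)
  obtain ⟨m, rfl⟩ : ∃ m, n = m + 1 := ⟨n - 1, by omega⟩
  rw [Nat.add_sub_cancel]
  have hprod := integrable_prod_mul_cexp_neg_mul hint (integrableOn_laguerre_mul_cexp_neg_Ioi m)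
  have hswap := integral_integral_swap (f := fun lam x : ℝ =>
    (laguerre 1 m (2 * x) : ℂ) * Complex.exp (-x) *
      (Complex.exp (-(Complex.I * lam * x)) * h lam)) hprod
  simp only [integral_const_mul] at hswap
  rw [← hswap, ← integral_const_mul, ← integral_sub hint (hprod.integral_prod_left.const_mul 2)]
  refine integral_congr_ae (Filter.Eventually.of_forall fun lam => ?_)
  simp only [cayley_zpow_neg_eq_laguerre_integral, ← mul_assoc, integral_mul_const]
  ring
end
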